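/- arXiv:1104.4732 — 2 statements merged into one kernel-verified Lean document; each statement's English description precedes it below -/
import Mathlib

section
/- Let (X_1, X_2) and (W_1, W_2) be two centered Gaussian vectors in R^ν × R^ν such that E[X_i X_i^⊤] = E[W_i W_i^⊤] = I (the ν × ν identity) for i = 1,2, with cross-covariance matrices E[X_1 X_2^⊤] = Σ_1 and E[W_1 W_2^⊤] = Σ_0. Let f : R^ν → R be a Lipschitz function with |f(x) − f(y)| ≤ |∂f|_∞ |x − y| for all x, y. Then |Cov(f(X_1), f(X_2)) − Cov(f(W_1), f(W_2))| ≤ |∂f|_∞² ‖Σ_1 − Σ_0‖, where ‖·‖ is the matrix spectral norm. -/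
open MeasureTheory ProbabilityTheory Finset Filter
open scoped BigOperators NNReal Topology

noncomputable section

/-- A family of real random variables is jointly Gaussian if every finite linear
combination has a (possibly degenerate) Gaussian law. -/
def IsJointGaussian {Ω : Type*} [MeasurableSpace Ω] (P : Measure Ω) {ι : Type*}
    (X : ι → Ω → ℝ) : Prop :=
  ∀ (s : Finset ι) (c : ι → ℝ), ∃ (μ : ℝ) (v : ℝ≥0),
    P.map (fun ω => ∑ i ∈ s, c i * X i ω) = gaussianReal μ v

/-- Matrix spectral (operator) norm. -/
def specNorm {ν : ℕ} (A : Matrix (Fin ν) (Fin ν) ℝ) : ℝ :=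
  ‖LinearMap.toContinuousLinearMap (Matrix.toEuclideanLin A)‖

theorem hasDerivAt_gaussianPDFReal (v : ℝ≥0) (x : ℝ) :
    HasDerivAt (gaussianPDFReal 0 v) (-(x / v) * gaussianPDFReal 0 v x) x := by
  have h : HasDerivAt (fun y : ℝ => -(y - 0) ^ 2 / (2 * v)) (-(x / v)) x := by
    have := (((hasDerivAt_id x).sub_const 0).pow 2).neg.div_const (2 * (v : ℝ))
    convert! this using 1
    simp only [id, sub_zero, Nat.cast_ofNat]
    ring
  rw [gaussianPDFReal_def]
  convert! h.exp.const_mul ((√(2 * Real.pi * v))⁻¹) using 1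
  ring

theorem integrable_gaussianPDFReal_mul {v : ℝ≥0} (hv : v ≠ 0) {g : ℝ → ℝ}
    (hg : Integrable g (gaussianReal 0 v)) :
    Integrable (fun x => gaussianPDFReal 0 v x * g x) := by
  rw [gaussianReal_of_var_ne_zero _ hv, integrable_withDensity_iff_integrable_smul'
    (measurable_gaussianPDF 0 v) (ae_of_all _ fun _ => gaussianPDF_lt_top)] at hg
  simpa [toReal_gaussianPDF] using hg

theorem memLp_comp_lipschitzWith {Ω E : Type*} [MeasurableSpace Ω] {P : Measure Ω}
    [IsFiniteMeasure P] [NormedAddCommGroup E] {f : E → ℝ} {K : ℝ≥0} (hf : LipschitzWith K f)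
    {X : Ω → E} {p : ENNReal} (hX : MemLp X p P) : MemLp (fun ω => f (X ω)) p P := by
  have hg : LipschitzWith K (fun x => f x - f 0) := by
    simpa using hf.sub (LipschitzWith.const (f 0))
  convert! (hg.comp_memLp (by simp) hX).add (memLp_const (f 0)) using 1
  ext ω
  simp

theorem integrable_fderiv_mul {Ω E : Type*} [MeasurableSpace Ω] {P : Measure Ω}
    [IsFiniteMeasure P] [NormedAddCommGroup E] [NormedSpace ℝ E] {V Z Z' : Ω → E}
    (hV : MemLp V 2 P) (hZ : MemLp Z 2 P) (hZ' : MemLp Z' 2 P) {f : E → ℝ} {K : ℝ≥0}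
    (hf : ContDiff ℝ 1 f) (hK : LipschitzWith K f) :
    Integrable (fun ω => fderiv ℝ f (Z ω) (V ω) * f (Z' ω)) P := by
  have hdapp : Continuous fun p : E × E => fderiv ℝ f p.1 p.2 :=
    ((hf.continuous_fderiv one_ne_zero).comp continuous_fst).clm_apply continuous_snd
  have h : MemLp (fun ω => fderiv ℝ f (Z ω) (V ω)) 2 P :=
    hV.of_le_mul (c := K) (hdapp.comp_aestronglyMeasurable
      (hZ.aestronglyMeasurable.prodMk hV.aestronglyMeasurable))
      (ae_of_all _ fun ω =>
        ContinuousLinearMap.le_of_opNorm_le _ (norm_fderiv_le_of_lipschitz ℝ hK) _)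
  exact h.integrable_mul (memLp_comp_lipschitzWith hK hZ')

/-- Stein's identity for a centred real Gaussian law. -/
theorem integral_id_mul_gaussianReal {h : ℝ → ℝ} {K : ℝ≥0} (hd : Differentiable ℝ h)
    (hK : LipschitzWith K h) (v : ℝ≥0) :
    ∫ x, x * h x ∂gaussianReal 0 v = v * ∫ x, deriv h x ∂gaussianReal 0 v := by
  rcases eq_or_ne v 0 with rfl | hv
  · simp
  have hid : MemLp id 2 (gaussianReal 0 v) := IsGaussian.memLp_two_id
  have hh : MemLp h 2 (gaussianReal 0 v) := memLp_comp_lipschitzWith hK hid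
  have hxh : Integrable (fun x => x * h x) (gaussianReal 0 v) := hid.integrable_mul hh
  have hh' : Integrable (deriv h) (gaussianReal 0 v) :=
    .of_bound (measurable_deriv h).aestronglyMeasurable K
      (ae_of_all _ fun x => norm_deriv_le_of_lipschitz hK)
  have key := integral_mul_deriv_eq_deriv_mul_of_integrable (u := h) (u' := deriv h)
    (v := gaussianPDFReal 0 v) (v' := fun x => -(x / v) * gaussianPDFReal 0 v x)
    (fun x _ => (hd x).hasDerivAt) (fun x _ => hasDerivAt_gaussianPDFReal v x)
    (((integrable_gaussianPDFReal_mul hv hxh).const_mul (-(v : ℝ)⁻¹)).congr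
      (ae_of_all _ fun x => by simp only [Pi.mul_apply]; ring))
    ((integrable_gaussianPDFReal_mul hv hh').congr
      (ae_of_all _ fun x => by simp only [Pi.mul_apply]; ring))
    ((integrable_gaussianPDFReal_mul hv (hh.integrable one_le_two)).congr
      (ae_of_all _ fun x => by simp only [Pi.mul_apply]; ring))
  rw [integral_gaussianReal_eq_integral_smul hv, integral_gaussianReal_eq_integral_smul hv]
  simp only [smul_eq_mul]
  have hv' : (v : ℝ) ≠ 0 := by exact_mod_cast hv
  calc ∫ x, gaussianPDFReal 0 v x * (x * h x)
      = ∫ x, -(v : ℝ) * (h x * (-(x / v) * gaussianPDFReal 0 v x)) := by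
        congr with x; field_simp
    _ = v * ∫ x, gaussianPDFReal 0 v x * deriv h x := by
        rw [integral_const_mul, key, neg_mul_neg]
        simp only [mul_comm]

theorem covariance_inner_rotation {Ω E : Type*} [MeasurableSpace Ω] {P : Measure Ω}
    [IsFiniteMeasure P] [NormedAddCommGroup E] [InnerProductSpace ℝ E] {X₁ X₂ W₁ W₂ : Ω → E}
    (hX₁ : MemLp X₁ 2 P) (hX₂ : MemLp X₂ 2 P)
    (hW₁ : MemLp W₁ 2 P) (hW₂ : MemLp W₂ 2 P) (x y : E)
    (hXW : cov[fun ω => inner ℝ x (X₁ ω), fun ω => inner ℝ y (W₂ ω); P] = 0)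
    (hWX : cov[fun ω => inner ℝ x (W₁ ω), fun ω => inner ℝ y (X₂ ω); P] = 0) (c s : ℝ) :
    cov[fun ω => inner ℝ x (c • X₁ ω - s • W₁ ω), fun ω => inner ℝ y (s • X₂ ω + c • W₂ ω); P] =
      s * c * (cov[fun ω => inner ℝ x (X₁ ω), fun ω => inner ℝ y (X₂ ω); P] -
        cov[fun ω => inner ℝ x (W₁ ω), fun ω => inner ℝ y (W₂ ω); P]) := by
  have e₁ : (fun ω => inner ℝ x (c • X₁ ω - s • W₁ ω)) =
      c • (fun ω => inner ℝ x (X₁ ω)) - s • fun ω => inner ℝ x (W₁ ω) := by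
    ext ω; simp [inner_sub_right, real_inner_smul_right]
  have e₂ : (fun ω => inner ℝ y (s • X₂ ω + c • W₂ ω)) =
      s • (fun ω => inner ℝ y (X₂ ω)) + c • fun ω => inner ℝ y (W₂ ω) := by
    ext ω; simp [inner_add_right, real_inner_smul_right]
  have m₁ := (hX₁.const_inner (𝕜 := ℝ) x).const_smul c
  have m₂ := (hW₁.const_inner (𝕜 := ℝ) x).const_smul s
  have m₃ := (hX₂.const_inner (𝕜 := ℝ) y).const_smul s
  have m₄ := (hW₂.const_inner (𝕜 := ℝ) y).const_smul c
  rw [e₁, e₂, covariance_sub_left m₁ m₂ (m₃.add m₄), covariance_add_right m₁ m₃ m₄,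
    covariance_add_right m₂ m₃ m₄]
  simp only [covariance_smul_left, covariance_smul_right, hXW, hWX]
  ring

theorem hasDerivAt_comp_rotation {E : Type*} [NormedAddCommGroup E] [NormedSpace ℝ E] {f : E → ℝ}
    (hf : Differentiable ℝ f) (x w : E) (t : ℝ) :
    HasDerivAt (fun t => f (Real.sin t • x + Real.cos t • w))
      (fderiv ℝ f (Real.sin t • x + Real.cos t • w) (Real.cos t • x - Real.sin t • w)) t := by
  have h : HasDerivAt (fun t => Real.sin t • x + Real.cos t • w)
      (Real.cos t • x - Real.sin t • w) t := by
    have := ((Real.hasDerivAt_sin t).smul_const x).add ((Real.hasDerivAt_cos t).smul_const w)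
    rw [neg_smul, ← sub_eq_add_neg] at this
    exact this
  exact (hf _).hasFDerivAt.comp_hasDerivAt t h

theorem abs_fderiv_rotation_mul_le {E : Type*} [NormedAddCommGroup E] [NormedSpace ℝ E] {f : E → ℝ}
    {K : ℝ≥0} (hK : LipschitzWith K f) {x w x' w' : E} {M : ℝ} (h : ‖x‖ + ‖w‖ ≤ M)
    (h' : ‖x'‖ + ‖w'‖ ≤ M) (t : ℝ) :
    |fderiv ℝ f (Real.sin t • x + Real.cos t • w) (Real.cos t • x - Real.sin t • w) *
      f (Real.sin t • x' + Real.cos t • w')| ≤ K * M * (|f 0| + K * M) := by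
  have hsin : ∀ x : E, ‖Real.sin t • x‖ ≤ ‖x‖ := fun x => by
    rw [norm_smul]; exact mul_le_of_le_one_left (norm_nonneg _) (Real.abs_sin_le_one t)
  have hcos : ∀ x : E, ‖Real.cos t • x‖ ≤ ‖x‖ := fun x => by
    rw [norm_smul]; exact mul_le_of_le_one_left (norm_nonneg _) (Real.abs_cos_le_one t)
  have hM : 0 ≤ M := (by positivity : (0 : ℝ) ≤ ‖x‖ + ‖w‖).trans h
  have hz := (norm_add_le _ _).trans ((add_le_add (hsin x') (hcos w')).trans h')
  have hv := (norm_sub_le _ _).trans ((add_le_add (hcos x) (hsin w)).trans h)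
  rw [abs_mul]
  refine mul_le_mul (ContinuousLinearMap.le_of_opNorm_le_of_le _
    (norm_fderiv_le_of_lipschitz ℝ hK) hv) ?_ (abs_nonneg _) (by positivity)
  have h₁ := hK.dist_le_mul (Real.sin t • x' + Real.cos t • w') 0
  rw [dist_zero_right, Real.dist_eq] at h₁
  have h₂ := abs_sub_abs_le_abs_sub (f (Real.sin t • x' + Real.cos t • w')) (f 0)
  have h₃ := mul_le_mul_of_nonneg_left hz K.coe_nonneg
  linarith

theorem hasDerivAt_integral_rotation {Ω E : Type*} [MeasurableSpace Ω] {P : Measure Ω}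
    [IsFiniteMeasure P] [NormedAddCommGroup E] [NormedSpace ℝ E] {X₁ X₂ W₁ W₂ : Ω → E}
    (hX₁ : MemLp X₁ 2 P) (hX₂ : MemLp X₂ 2 P) (hW₁ : MemLp W₁ 2 P) (hW₂ : MemLp W₂ 2 P)
    {f : E → ℝ} {K : ℝ≥0} (hf : ContDiff ℝ 1 f) (hK : LipschitzWith K f) (t : ℝ) :
    HasDerivAt (fun t => ∫ ω, f (Real.sin t • X₁ ω + Real.cos t • W₁ ω) *
        f (Real.sin t • X₂ ω + Real.cos t • W₂ ω) ∂P)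
      (∫ ω, fderiv ℝ f (Real.sin t • X₁ ω + Real.cos t • W₁ ω)
          (Real.cos t • X₁ ω - Real.sin t • W₁ ω) * f (Real.sin t • X₂ ω + Real.cos t • W₂ ω) ∂P +
        ∫ ω, fderiv ℝ f (Real.sin t • X₂ ω + Real.cos t • W₂ ω)
          (Real.cos t • X₂ ω - Real.sin t • W₂ ω) * f (Real.sin t • X₁ ω + Real.cos t • W₁ ω) ∂P)
      t := by
  have hZ₁ : ∀ t, MemLp (fun ω => Real.sin t • X₁ ω + Real.cos t • W₁ ω) 2 P := fun t =>
    (hX₁.const_smul (Real.sin t)).add (hW₁.const_smul (Real.cos t))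
  have hZ₂ : ∀ t, MemLp (fun ω => Real.sin t • X₂ ω + Real.cos t • W₂ ω) 2 P := fun t =>
    (hX₂.const_smul (Real.sin t)).add (hW₂.const_smul (Real.cos t))
  have hV₁ : MemLp (fun ω => Real.cos t • X₁ ω - Real.sin t • W₁ ω) 2 P :=
    (hX₁.const_smul (Real.cos t)).sub (hW₁.const_smul (Real.sin t))
  have hV₂ : MemLp (fun ω => Real.cos t • X₂ ω - Real.sin t • W₂ ω) 2 P :=
    (hX₂.const_smul (Real.cos t)).sub (hW₂.const_smul (Real.sin t))
  have hpi : ∀ t, Integrable (fun ω => f (Real.sin t • X₁ ω + Real.cos t • W₁ ω) *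
      f (Real.sin t • X₂ ω + Real.cos t • W₂ ω)) P := fun t =>
    (memLp_comp_lipschitzWith hK (hZ₁ t)).integrable_mul (memLp_comp_lipschitzWith hK (hZ₂ t))
  obtain ⟨N, hNdef⟩ : ∃ N : Ω → ℝ, ∀ ω, N ω = ‖X₁ ω‖ + ‖W₁ ω‖ + (‖X₂ ω‖ + ‖W₂ ω‖) :=
    ⟨_, fun _ => rfl⟩
  have hN : MemLp N 2 P := by
    rw [funext hNdef]
    exact (hX₁.norm.add hW₁.norm).add (hX₂.norm.add hW₂.norm)
  have hle₁ : ∀ ω, ‖X₁ ω‖ + ‖W₁ ω‖ ≤ N ω := fun ω => by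
    rw [hNdef]; exact le_add_of_nonneg_right (by positivity)
  have hle₂ : ∀ ω, ‖X₂ ω‖ + ‖W₂ ω‖ ≤ N ω := fun ω => by
    rw [hNdef]; exact le_add_of_nonneg_left (by positivity)
  have hbi : Integrable (fun ω => K * N ω * (|f 0| + K * N ω)) P :=
    (hN.const_mul (K : ℝ)).integrable_mul ((memLp_const |f 0|).add (hN.const_mul (K : ℝ)))
  have i₁ := integrable_fderiv_mul hV₁ (hZ₁ t) (hZ₂ t) hf hK
  have i₂ := integrable_fderiv_mul hV₂ (hZ₂ t) (hZ₁ t) hf hK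
  rw [← integral_add i₁ i₂]
  refine (hasDerivAt_integral_of_dominated_loc_of_deriv_le (s := Set.univ)
    (bound := fun ω => K * N ω * (|f 0| + K * N ω) + K * N ω * (|f 0| + K * N ω))
    (F' := fun t ω => fderiv ℝ f (Real.sin t • X₁ ω + Real.cos t • W₁ ω)
          (Real.cos t • X₁ ω - Real.sin t • W₁ ω) * f (Real.sin t • X₂ ω + Real.cos t • W₂ ω) +
        fderiv ℝ f (Real.sin t • X₂ ω + Real.cos t • W₂ ω)
          (Real.cos t • X₂ ω - Real.sin t • W₂ ω) * f (Real.sin t • X₁ ω + Real.cos t • W₁ ω))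
    univ_mem (.of_forall fun t => (hpi t).aestronglyMeasurable) (hpi t)
    (i₁.add i₂).aestronglyMeasurable (ae_of_all _ fun ω t _ => ?_) (hbi.add hbi)
    (ae_of_all _ fun ω t _ => ?_)).2
  · exact (norm_add_le _ _).trans (add_le_add (abs_fderiv_rotation_mul_le hK (hle₁ ω) (hle₂ ω) t)
      (abs_fderiv_rotation_mul_le hK (hle₂ ω) (hle₁ ω) t))
  · have hd := hf.differentiable one_ne_zero
    refine ((hasDerivAt_comp_rotation hd (X₁ ω) (W₁ ω) t).mul
      (hasDerivAt_comp_rotation hd (X₂ ω) (W₂ ω) t)).congr_deriv ?_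
    rw [mul_comm (f _)]

section

variable {Ω E : Type*} [MeasurableSpace Ω] {P : Measure Ω} [IsProbabilityMeasure P]
  [NormedAddCommGroup E] [InnerProductSpace ℝ E] [FiniteDimensional ℝ E] [MeasurableSpace E]
  [BorelSpace E]

theorem integral_mul_comp_add_smul_of_indepFun {Y : Ω → ℝ} {Z R : Ω → E} {v : ℝ≥0}
    (hYm : AEMeasurable Y P) (hY : P.map Y = gaussianReal 0 v) (hZ : AEMeasurable Z P)
    (hR : MemLp R 2 P) (hind : IndepFun Y (fun ω => (Z ω, R ω)) P)
    {g f : E → ℝ} {C : ℝ} {K : ℝ≥0} (hg : Measurable g) (hgC : ∀ x, |g x| ≤ C)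
    (hf : ContDiff ℝ 1 f) (hK : LipschitzWith K f) (a : E) :
    ∫ ω, Y ω * (g (Z ω) * f (R ω + Y ω • a)) ∂P =
      v * ∫ ω, g (Z ω) * fderiv ℝ f (R ω + Y ω • a) a ∂P := by
  have : ProperSpace E := FiniteDimensional.proper ℝ E
  have hRm : AEMeasurable R P := hR.aestronglyMeasurable.aemeasurable
  have hYm2 : MemLp Y 2 P := by
    have h : MemLp id 2 (P.map Y) := hY ▸ IsGaussian.memLp_two_id
    simpa using (memLp_map_measure_iff aestronglyMeasurable_id hYm).1 h
  have hW : AEMeasurable (fun ω => (Y ω, (Z ω, R ω))) P := by fun_prop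
  have hmap : P.map (fun ω => (Y ω, (Z ω, R ω))) =
      (gaussianReal 0 v).prod (P.map fun ω => (Z ω, R ω)) := by
    rw [(indepFun_iff_map_prod_eq_prod_map_map hYm (by fun_prop)).1 hind, hY]
  have hfm : Measurable f := hf.continuous.measurable
  have hdf : Measurable (fun x => fderiv ℝ f x a) :=
    ((hf.continuous_fderiv one_ne_zero).clm_apply continuous_const).measurable
  have hfR : MemLp (fun ω => f (R ω + Y ω • a)) 2 P :=
    memLp_comp_lipschitzWith hK (hR.add
      (((1 : ℝ →L[ℝ] ℝ).smulRight a).comp_memLp' hYm2))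
  have hbg : ∀ᵐ ω ∂P, ‖g (Z ω)‖ ≤ C := ae_of_all _ fun _ => hgC _
  have hgm : AEStronglyMeasurable (fun ω => g (Z ω)) P :=
    (hg.comp_aemeasurable hZ).aestronglyMeasurable
  let H : ℝ × E × E → ℝ := fun p => p.1 * (g p.2.1 * f (p.2.2 + p.1 • a))
  let H' : ℝ × E × E → ℝ := fun p => g p.2.1 * fderiv ℝ f (p.2.2 + p.1 • a) a
  have hHm : Measurable H := by fun_prop
  have hH'm : Measurable H' := by
    have : Measurable fun p : ℝ × E × E => fderiv ℝ f (p.2.2 + p.1 • a) a :=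
      hdf.comp (by fun_prop)
    fun_prop
  have hHi : Integrable H (P.map fun ω => (Y ω, (Z ω, R ω))) := by
    rw [integrable_map_measure hHm.aestronglyMeasurable hW]
    refine ((hYm2.integrable_mul hfR).bdd_mul hgm hbg).congr (ae_of_all _ fun ω => ?_)
    simp only [Pi.mul_apply, H, Function.comp_apply]
    ring
  have hH'i : Integrable H' (P.map fun ω => (Y ω, (Z ω, R ω))) := by
    rw [integrable_map_measure hH'm.aestronglyMeasurable hW]
    refine (Integrable.of_bound (C := K * ‖a‖) (μ := P)
      (f := fun ω => fderiv ℝ f (R ω + Y ω • a) a)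
      (hdf.comp_aemeasurable (by fun_prop)).aestronglyMeasurable
      (ae_of_all _ fun ω => ?_)).bdd_mul hgm hbg
    exact ContinuousLinearMap.le_of_opNorm_le _ (norm_fderiv_le_of_lipschitz ℝ hK) a
  have e1 : ∫ ω, Y ω * (g (Z ω) * f (R ω + Y ω • a)) ∂P =
      ∫ p, H p ∂(P.map fun ω => (Y ω, (Z ω, R ω))) :=
    (integral_map hW hHm.aestronglyMeasurable).symm
  have e2 : ∫ ω, g (Z ω) * fderiv ℝ f (R ω + Y ω • a) a ∂P =
      ∫ p, H' p ∂(P.map fun ω => (Y ω, (Z ω, R ω))) :=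
    (integral_map hW hH'm.aestronglyMeasurable).symm
  rw [hmap] at hHi hH'i
  have : IsProbabilityMeasure (P.map fun ω => (Z ω, R ω)) :=
    Measure.isProbabilityMeasure_map (by fun_prop)
  rw [e1, e2, hmap, integral_prod_symm _ hHi, integral_prod_symm _ hH'i, ← integral_const_mul]
  congr with p
  simp only [H, H']
  have hdiff : ∀ y : ℝ, HasDerivAt (fun y => f (p.2 + y • a)) (fderiv ℝ f (p.2 + y • a) a) y :=
    fun y => by
      have h1 : HasDerivAt (fun y : ℝ => p.2 + y • a) a y := by
        simpa using ((hasDerivAt_id y).smul_const a).const_add p.2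
      exact ((hf.differentiable one_ne_zero _).hasFDerivAt).comp_hasDerivAt y h1
  have hlip : LipschitzWith (K * ‖a‖₊) (fun y : ℝ => f (p.2 + y • a)) := by
    refine hK.comp (LipschitzWith.of_dist_le_mul fun x y => ?_)
    rw [dist_add_left, dist_eq_norm, ← sub_smul, norm_smul, Real.dist_eq, Real.norm_eq_abs,
      mul_comm, coe_nnnorm]
  have := integral_id_mul_gaussianReal (fun y => (hdiff y).differentiableAt) hlip v
  simp only [fun y => (hdiff y).deriv] at this
  rw [integral_const_mul, mul_left_comm, ← this, ← integral_const_mul]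
  congr with y
  ring

/-- Gaussian integration by parts against a variable uncorrelated with one of the factors. -/
theorem integral_mul_comp_of_hasGaussianLaw {Y : Ω → ℝ} {Z₁ Z₂ : Ω → E}
    (hG : HasGaussianLaw (fun ω => (Y ω, (Z₁ ω, Z₂ ω))) P) (hY0 : ∫ ω, Y ω ∂P = 0)
    (h₁ : ∀ x, cov[Y, fun ω => inner ℝ x (Z₁ ω); P] = 0) {b : E}
    (h₂ : ∀ x, cov[Y, fun ω => inner ℝ x (Z₂ ω); P] = inner ℝ x b)
    {g f : E → ℝ} {C : ℝ} {K : ℝ≥0} (hg : Measurable g) (hgC : ∀ x, |g x| ≤ C)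
    (hf : ContDiff ℝ 1 f) (hK : LipschitzWith K f) :
    ∫ ω, Y ω * (g (Z₁ ω) * f (Z₂ ω)) ∂P = ∫ ω, g (Z₁ ω) * fderiv ℝ f (Z₂ ω) b ∂P := by
  have : ProperSpace E := FiniteDimensional.proper ℝ E
  have hYG := hG.fst
  have hY2 := hYG.memLp_two
  have hZ₁ := hG.snd.fst
  have hZ₂ := hG.snd.snd
  obtain ⟨v, hv⟩ : ∃ v : ℝ≥0, (v : ℝ) = Var[Y; P] := ⟨⟨_, variance_nonneg Y P⟩, rfl⟩
  have hlaw : P.map Y = gaussianReal 0 v := by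
    rw [hYG.map_eq_gaussianReal, hY0, ← hv, Real.toNNReal_coe]
  have hcc : cov[Y, Y; P] = v := by rw [hv, covariance_self hYG.aemeasurable]
  rcases eq_or_ne v 0 with rfl | hv0
  · have hY : Y =ᵐ[P] 0 := by
      have := ae_eq_integral_of_variance_eq_zero hY2 (by simpa using hv.symm)
      filter_upwards [this] with ω hω
      rw [hω, hY0]; rfl
    have hb : b = 0 := by
      rw [← inner_self_eq_zero (𝕜 := ℝ), ← h₂ b, covariance, hY0]
      refine integral_eq_zero_of_ae ?_
      filter_upwards [hY] with ω hω
      simp [hω]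
    subst hb
    simp only [map_zero, mul_zero, integral_zero]
    refine integral_eq_zero_of_ae ?_
    filter_upwards [hY] with ω hω
    simp [hω]
  have hv' : (v : ℝ) ≠ 0 := by exact_mod_cast hv0
  set a : E := (v : ℝ)⁻¹ • b with ha
  let T : ℝ × E × E →L[ℝ] ℝ × E × E :=
    (ContinuousLinearMap.fst ℝ ℝ (E × E)).prod
      (((ContinuousLinearMap.fst ℝ E E).comp (ContinuousLinearMap.snd ℝ ℝ (E × E))).prod
      ((ContinuousLinearMap.snd ℝ E E).comp (ContinuousLinearMap.snd ℝ ℝ (E × E)) -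
        (ContinuousLinearMap.fst ℝ ℝ (E × E)).smulRight a))
  have hG' : HasGaussianLaw (fun ω => (Y ω, (Z₁ ω, Z₂ ω - Y ω • a))) P := hG.map_fun T
  have hin : ∀ {V : Ω → E}, MemLp V 2 P → ∀ x, MemLp (fun ω => inner ℝ x (V ω)) 2 P :=
    fun hV x => hV.const_inner x
  have hind : IndepFun Y (fun ω => (Z₁ ω, Z₂ ω - Y ω • a)) P := by
    refine hG'.indepFun_of_covariance_strongDual fun L₁ L₂ => ?_
    have e₁ : L₁ ∘ Y = fun ω => L₁ 1 * Y ω := by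
      ext ω
      simpa [mul_comm] using L₁.map_smul (Y ω) 1
    let u := (InnerProductSpace.toDual ℝ E).symm (L₂.comp (.inl ℝ E E))
    let w := (InnerProductSpace.toDual ℝ E).symm (L₂.comp (.inr ℝ E E))
    have e₂ : L₂ ∘ (fun ω => (Z₁ ω, Z₂ ω - Y ω • a)) =
        (fun ω => inner ℝ u (Z₁ ω)) + ((fun ω => inner ℝ w (Z₂ ω)) -
          fun ω => inner ℝ w a * Y ω) := by
      ext ω
      have hu : inner ℝ u (Z₁ ω) = L₂ (Z₁ ω, 0) := by simp [u]
      have hw : ∀ z, inner ℝ w z = L₂ (0, z) := by simp [w]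
      have : inner ℝ w a * Y ω = inner ℝ w (Y ω • a) := by
        rw [inner_smul_right w a (Y ω), mul_comm]
      simp only [Function.comp_apply, Pi.add_apply, Pi.sub_apply]
      rw [this, hu, hw, hw, ← map_sub, ← map_add]
      simp
    rw [e₁, e₂, covariance_const_mul_left, covariance_add_right hY2 (hin hZ₁.memLp_two u)
      ((hin hZ₂.memLp_two w).sub (hY2.const_mul _)), covariance_sub_right hY2
      (hin hZ₂.memLp_two w) (hY2.const_mul _), covariance_const_mul_right, h₁, h₂, hcc, ha,
      inner_smul_right]
    field_simp
    simp
  have key := integral_mul_comp_add_smul_of_indepFun hYG.aemeasurable hlaw hZ₁.aemeasurable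
    hG'.snd.snd.memLp_two hind hg hgC hf hK a
  simp only [sub_add_cancel] at key
  rw [key, ← integral_const_mul]
  congr with ω
  rw [ha, map_smul, smul_eq_mul]
  field_simp

theorem abs_integral_fderiv_mul_le {V Z₁ Z₂ : Ω → E}
    (hG : HasGaussianLaw (fun ω => (V ω, (Z₁ ω, Z₂ ω))) P) (hV : ∫ ω, V ω ∂P = 0)
    (h₁ : ∀ x y, cov[fun ω => inner ℝ x (V ω), fun ω => inner ℝ y (Z₁ ω); P] = 0)
    (A : E →L[ℝ] E)
    (h₂ : ∀ x y, cov[fun ω => inner ℝ x (V ω), fun ω => inner ℝ y (Z₂ ω); P] = inner ℝ x (A y))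
    {f : E → ℝ} {K : ℝ≥0} (hf : ContDiff ℝ 1 f) (hK : LipschitzWith K f) :
    |∫ ω, fderiv ℝ f (Z₁ ω) (V ω) * f (Z₂ ω) ∂P| ≤ K ^ 2 * ‖A‖ := by
  have : ProperSpace E := FiniteDimensional.proper ℝ E
  let e := stdOrthonormalBasis ℝ E
  have hV2 := hG.fst.memLp_two
  have hZ₁ := hG.snd.fst
  have hZ₂ := hG.snd.snd
  have hdK : ∀ x, ‖fderiv ℝ f x‖ ≤ K := fun x => norm_fderiv_le_of_lipschitz ℝ hK
  have hdf : ∀ a, Measurable (fun x => fderiv ℝ f x a) := fun a =>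
    ((hf.continuous_fderiv one_ne_zero).clm_apply continuous_const).measurable
  have hgC : ∀ a x, |fderiv ℝ f x a| ≤ K * ‖a‖ := fun a x =>
    ContinuousLinearMap.le_of_opNorm_le _ (hdK x) a
  have hY2 : ∀ i, MemLp (fun ω => inner ℝ (e i) (V ω)) 2 P := fun i => hV2.const_inner (e i)
  have hbase : ∀ i, Integrable
      (fun ω => inner ℝ (e i) (V ω) * (fderiv ℝ f (Z₁ ω) (e i) * f (Z₂ ω))) P := fun i => by
    refine (((hY2 i).integrable_mul (memLp_comp_lipschitzWith hK hZ₂.memLp_two)).bdd_mul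
      ((hdf (e i)).comp_aemeasurable hZ₁.aemeasurable).aestronglyMeasurable
      (ae_of_all _ fun ω => hgC (e i) (Z₁ ω))).congr (ae_of_all _ fun ω => ?_)
    simp only [Pi.mul_apply, Function.comp_apply]
    ring
  have hstein : ∀ i, ∫ ω, inner ℝ (e i) (V ω) * (fderiv ℝ f (Z₁ ω) (e i) * f (Z₂ ω)) ∂P =
      ∫ ω, fderiv ℝ f (Z₁ ω) (e i) * fderiv ℝ f (Z₂ ω) (A.adjoint (e i)) ∂P := fun i => by
    let T : E × E × E →L[ℝ] ℝ × E × E :=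
      ((innerSL ℝ (e i)).comp (ContinuousLinearMap.fst ℝ E (E × E))).prod
        (ContinuousLinearMap.snd ℝ E (E × E))
    have hG' : HasGaussianLaw (fun ω => (inner ℝ (e i) (V ω), (Z₁ ω, Z₂ ω))) P := hG.map_fun T
    refine integral_mul_comp_of_hasGaussianLaw hG' ?_ (h₁ (e i)) (fun x => ?_) (hdf (e i))
      (hgC (e i)) hf hK
    · rw [integral_inner hG.fst.integrable, hV, inner_zero_right]
    · rw [h₂, real_inner_comm, A.adjoint_inner_right]
  have hint : ∀ i, Integrable
      (fun ω => fderiv ℝ f (Z₁ ω) (e i) * fderiv ℝ f (Z₂ ω) (A.adjoint (e i))) P := fun i =>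
    (Integrable.of_bound
      ((hdf _).comp_aemeasurable hZ₂.aemeasurable).aestronglyMeasurable _
      (ae_of_all _ fun ω => hgC (A.adjoint (e i)) (Z₂ ω))).bdd_mul
      ((hdf (e i)).comp_aemeasurable hZ₁.aemeasurable).aestronglyMeasurable
      (ae_of_all _ fun ω => hgC (e i) (Z₁ ω))
  have hsum : ∫ ω, fderiv ℝ f (Z₁ ω) (V ω) * f (Z₂ ω) ∂P =
      ∫ ω, fderiv ℝ f (Z₂ ω)
        (A.adjoint ((InnerProductSpace.toDual ℝ E).symm (fderiv ℝ f (Z₁ ω)))) ∂P := by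
    calc ∫ ω, fderiv ℝ f (Z₁ ω) (V ω) * f (Z₂ ω) ∂P
        = ∫ ω, ∑ i, inner ℝ (e i) (V ω) * (fderiv ℝ f (Z₁ ω) (e i) * f (Z₂ ω)) ∂P := by
          congr with ω
          conv_lhs => rw [← e.sum_repr' (V ω)]
          simp only [map_sum, map_smul, smul_eq_mul, Finset.sum_mul, mul_assoc]
      _ = ∫ ω, ∑ i, fderiv ℝ f (Z₁ ω) (e i) * fderiv ℝ f (Z₂ ω) (A.adjoint (e i)) ∂P := by
          rw [integral_finsetSum _ fun i _ => hbase i, integral_finsetSum _ fun i _ => hint i]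
          simp only [hstein]
      _ = _ := by
          congr with ω
          conv_rhs => rw [← e.sum_repr' ((InnerProductSpace.toDual ℝ E).symm _)]
          simp only [map_sum, map_smul, smul_eq_mul]
          refine Finset.sum_congr rfl fun i _ => ?_
          rw [real_inner_comm, InnerProductSpace.toDual_symm_apply]
  rw [hsum]
  rw [← Real.norm_eq_abs]
  refine (norm_integral_le_of_norm_le_const (C := K ^ 2 * ‖A‖)
    (ae_of_all _ fun ω => ?_)).trans (by rw [probReal_univ, mul_one])
  calc ‖fderiv ℝ f (Z₂ ω) (A.adjoint ((InnerProductSpace.toDual ℝ E).symm (fderiv ℝ f (Z₁ ω))))‖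
      ≤ K * (‖A‖ * K) := by
        refine ContinuousLinearMap.le_of_opNorm_le_of_le _ (hdK _) ?_
        refine ContinuousLinearMap.le_of_opNorm_le_of_le _
          (ContinuousLinearMap.adjoint.norm_map A).le ?_
        simpa using hdK (Z₁ ω)
    _ = K ^ 2 * ‖A‖ := by ring

theorem abs_integral_fderiv_rotation_mul_le {X₁ X₂ W₁ W₂ : Ω → E}
    (hG : HasGaussianLaw (fun ω => ((X₁ ω, X₂ ω), (W₁ ω, W₂ ω))) P)
    (hX₁ : ∫ ω, X₁ ω ∂P = 0) (hW₁ : ∫ ω, W₁ ω ∂P = 0)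
    (h₁₁ : ∀ x y, cov[fun ω => inner ℝ x (X₁ ω), fun ω => inner ℝ y (W₁ ω); P] = 0)
    (h₁₂ : ∀ x y, cov[fun ω => inner ℝ x (X₁ ω), fun ω => inner ℝ y (W₂ ω); P] = 0)
    (h₂₁ : ∀ x y, cov[fun ω => inner ℝ x (X₂ ω), fun ω => inner ℝ y (W₁ ω); P] = 0)
    (h : ∀ x y, cov[fun ω => inner ℝ x (X₁ ω), fun ω => inner ℝ y (X₁ ω); P] =
      cov[fun ω => inner ℝ x (W₁ ω), fun ω => inner ℝ y (W₁ ω); P])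
    (B : E →L[ℝ] E)
    (hB : ∀ x y, cov[fun ω => inner ℝ x (X₁ ω), fun ω => inner ℝ y (X₂ ω); P] -
      cov[fun ω => inner ℝ x (W₁ ω), fun ω => inner ℝ y (W₂ ω); P] = inner ℝ x (B y))
    {f : E → ℝ} {K : ℝ≥0} (hf : ContDiff ℝ 1 f) (hK : LipschitzWith K f) (c s : ℝ) :
    |∫ ω, fderiv ℝ f (s • X₁ ω + c • W₁ ω) (c • X₁ ω - s • W₁ ω) *
      f (s • X₂ ω + c • W₂ ω) ∂P| ≤ K ^ 2 * ‖(s * c) • B‖ := by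
  have mX₁ := hG.fst.fst.memLp_two
  have mX₂ := hG.fst.snd.memLp_two
  have mW₁ := hG.snd.fst.memLp_two
  have mW₂ := hG.snd.snd.memLp_two
  let p₁ : (E × E) × (E × E) →L[ℝ] E :=
    (ContinuousLinearMap.fst ℝ E E).comp (.fst ℝ (E × E) (E × E))
  let p₂ : (E × E) × (E × E) →L[ℝ] E :=
    (ContinuousLinearMap.snd ℝ E E).comp (.fst ℝ (E × E) (E × E))
  let q₁ : (E × E) × (E × E) →L[ℝ] E :=
    (ContinuousLinearMap.fst ℝ E E).comp (.snd ℝ (E × E) (E × E))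
  let q₂ : (E × E) × (E × E) →L[ℝ] E :=
    (ContinuousLinearMap.snd ℝ E E).comp (.snd ℝ (E × E) (E × E))
  have hG' : HasGaussianLaw (fun ω => (c • X₁ ω - s • W₁ ω,
      (s • X₁ ω + c • W₁ ω, s • X₂ ω + c • W₂ ω))) P :=
    hG.map_fun ((c • p₁ - s • q₁).prod ((s • p₁ + c • q₁).prod (s • p₂ + c • q₂)))
  refine abs_integral_fderiv_mul_le hG' ?_ (fun x y => ?_) ((s * c) • B) (fun x y => ?_) hf hK
  · rw [integral_sub ((mX₁.integrable one_le_two).fun_smul c)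
      ((mW₁.integrable one_le_two).fun_smul s), integral_smul, integral_smul, hX₁, hW₁, smul_zero,
      smul_zero, sub_zero]
  · rw [covariance_inner_rotation mX₁ mX₁ mW₁ mW₁ x y (h₁₁ x y), h, sub_self, mul_zero]
    rw [covariance_comm, h₁₁]
  · rw [covariance_inner_rotation mX₁ mX₂ mW₁ mW₂ x y (h₁₂ x y), hB, _root_.smul_apply,
      real_inner_smul_right]
    rw [covariance_comm, h₂₁]

/-- Gaussian interpolation along `sin t • X + cos t • W`, for `C¹` Lipschitz functions. -/
theorem abs_integral_mul_sub_le_of_contDiff {X₁ X₂ W₁ W₂ : Ω → E}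
    (hG : HasGaussianLaw (fun ω => ((X₁ ω, X₂ ω), (W₁ ω, W₂ ω))) P)
    (hX₁ : ∫ ω, X₁ ω ∂P = 0) (hX₂ : ∫ ω, X₂ ω ∂P = 0)
    (hW₁ : ∫ ω, W₁ ω ∂P = 0) (hW₂ : ∫ ω, W₂ ω ∂P = 0)
    (h₁₁ : ∀ x y, cov[fun ω => inner ℝ x (X₁ ω), fun ω => inner ℝ y (W₁ ω); P] = 0)
    (h₁₂ : ∀ x y, cov[fun ω => inner ℝ x (X₁ ω), fun ω => inner ℝ y (W₂ ω); P] = 0)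
    (h₂₁ : ∀ x y, cov[fun ω => inner ℝ x (X₂ ω), fun ω => inner ℝ y (W₁ ω); P] = 0)
    (h₂₂ : ∀ x y, cov[fun ω => inner ℝ x (X₂ ω), fun ω => inner ℝ y (W₂ ω); P] = 0)
    (h₁ : ∀ x y, cov[fun ω => inner ℝ x (X₁ ω), fun ω => inner ℝ y (X₁ ω); P] =
      cov[fun ω => inner ℝ x (W₁ ω), fun ω => inner ℝ y (W₁ ω); P])
    (h₂ : ∀ x y, cov[fun ω => inner ℝ x (X₂ ω), fun ω => inner ℝ y (X₂ ω); P] =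
      cov[fun ω => inner ℝ x (W₂ ω), fun ω => inner ℝ y (W₂ ω); P])
    (B : E →L[ℝ] E)
    (hB : ∀ x y, cov[fun ω => inner ℝ x (X₁ ω), fun ω => inner ℝ y (X₂ ω); P] -
      cov[fun ω => inner ℝ x (W₁ ω), fun ω => inner ℝ y (W₂ ω); P] = inner ℝ x (B y))
    {f : E → ℝ} {K : ℝ≥0} (hf : ContDiff ℝ 1 f) (hK : LipschitzWith K f) :
    |∫ ω, f (X₁ ω) * f (X₂ ω) ∂P - ∫ ω, f (W₁ ω) * f (W₂ ω) ∂P| ≤ K ^ 2 * ‖B‖ := by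
  have hderiv := hasDerivAt_integral_rotation hG.fst.fst.memLp_two hG.fst.snd.memLp_two
    hG.snd.fst.memLp_two hG.snd.snd.memLp_two hf hK
  let sw := (ContinuousLinearMap.snd ℝ E E).prod (ContinuousLinearMap.fst ℝ E E)
  have hG' : HasGaussianLaw (fun ω => ((X₂ ω, X₁ ω), (W₂ ω, W₁ ω))) P :=
    hG.map_fun (sw.prodMap sw)
  have hB' : ∀ x y, cov[fun ω => inner ℝ x (X₂ ω), fun ω => inner ℝ y (X₁ ω); P] -
      cov[fun ω => inner ℝ x (W₂ ω), fun ω => inner ℝ y (W₁ ω); P] =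
        inner ℝ x (B.adjoint y) := fun x y => by
    rw [covariance_comm, covariance_comm (fun ω => inner ℝ x _), hB, B.adjoint_inner_right,
      real_inner_comm]
  have hbound : ∀ t ∈ Set.Ico 0 (Real.pi / 2),
      ‖∫ ω, fderiv ℝ f (Real.sin t • X₁ ω + Real.cos t • W₁ ω)
          (Real.cos t • X₁ ω - Real.sin t • W₁ ω) * f (Real.sin t • X₂ ω + Real.cos t • W₂ ω) ∂P +
        ∫ ω, fderiv ℝ f (Real.sin t • X₂ ω + Real.cos t • W₂ ω)
          (Real.cos t • X₂ ω - Real.sin t • W₂ ω) *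
            f (Real.sin t • X₁ ω + Real.cos t • W₁ ω) ∂P‖ ≤
      K ^ 2 * ‖B‖ * (2 * Real.sin t * Real.cos t) := fun t ht => by
    have hs : 0 ≤ Real.sin t := Real.sin_nonneg_of_nonneg_of_le_pi ht.1
      (by linarith [ht.2, Real.pi_pos])
    have hc : 0 ≤ Real.cos t := Real.cos_nonneg_of_neg_pi_div_two_le_of_le
      (by linarith [ht.1, Real.pi_pos]) ht.2.le
    have b₁ := abs_integral_fderiv_rotation_mul_le hG hX₁ hW₁ h₁₁ h₁₂ h₂₁ h₁ B hB hf hK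
      (Real.cos t) (Real.sin t)
    have b₂ := abs_integral_fderiv_rotation_mul_le hG' hX₂ hW₂ h₂₂ h₂₁ h₁₂ h₂ B.adjoint hB' hf hK
      (Real.cos t) (Real.sin t)
    rw [norm_smul, Real.norm_of_nonneg (mul_nonneg hs hc)] at b₁ b₂
    rw [ContinuousLinearMap.adjoint.norm_map] at b₂
    refine (norm_add_le _ _).trans ((add_le_add b₁ b₂).trans (le_of_eq ?_))
    ring
  have key := image_norm_le_of_norm_deriv_right_le_deriv_boundary (a := 0) (b := Real.pi / 2)
    (f := fun t => ∫ ω, f (Real.sin t • X₁ ω + Real.cos t • W₁ ω) *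
      f (Real.sin t • X₂ ω + Real.cos t • W₂ ω) ∂P - ∫ ω, f (W₁ ω) * f (W₂ ω) ∂P)
    (B := fun t => K ^ 2 * ‖B‖ * Real.sin t ^ 2)
    (fun t _ => ((hderiv t).sub_const _).continuousAt.continuousWithinAt)
    (fun t _ => ((hderiv t).sub_const _).hasDerivWithinAt) (by simp)
    (fun t => by simpa using ((Real.hasDerivAt_sin t).pow 2).const_mul (K ^ 2 * ‖B‖))
    hbound (Set.right_mem_Icc.2 (by positivity))
  simpa using key

/-- A Lipschitz function is a uniform limit of `C¹` functions with the same Lipschitz constant. -/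
theorem exists_contDiff_lipschitzWith_approx {f : E → ℝ} {K : ℝ≥0} (hf : LipschitzWith K f)
    {δ : ℝ} (hδ : 0 < δ) :
    ∃ g : E → ℝ, ContDiff ℝ 1 g ∧ LipschitzWith K g ∧ ∀ x, |g x - f x| ≤ δ := by
  have : ProperSpace E := FiniteDimensional.proper ℝ E
  let μ : Measure E := Measure.addHaar
  have hK : (0 : ℝ) < K + 1 := by positivity
  have hr : 0 < δ / (K + 1) := by positivity
  let φ : ContDiffBump (0 : E) := ⟨δ / (K + 1) / 2, δ / (K + 1), half_pos hr, half_lt_self hr⟩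
  have hφi : ∀ x, Integrable (fun t => φ.normed μ t * f (x - t)) μ := fun x =>
    (φ.continuous_normed.mul (hf.continuous.comp
      (continuous_const.sub continuous_id))).integrable_of_hasCompactSupport
      φ.hasCompactSupport_normed.mul_right
  have hconv : ∀ x, convolution (φ.normed μ) f (ContinuousLinearMap.lsmul ℝ ℝ) μ x =
      ∫ t, φ.normed μ t * f (x - t) ∂μ := fun x => rfl
  refine ⟨convolution (φ.normed μ) f (ContinuousLinearMap.lsmul ℝ ℝ) μ,
    φ.hasCompactSupport_normed.contDiff_convolution_left _ φ.contDiff_normed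
      hf.continuous.locallyIntegrable, ?_, fun x => ?_⟩
  · refine LipschitzWith.of_dist_le_mul fun x y => ?_
    rw [hconv, hconv, dist_eq_norm, ← integral_sub (hφi x) (hφi y)]
    calc ‖∫ t, φ.normed μ t * f (x - t) - φ.normed μ t * f (y - t) ∂μ‖
        ≤ ∫ t, φ.normed μ t * (K * dist x y) ∂μ := by
          refine norm_integral_le_of_norm_le (φ.integrable_normed.mul_const _)
            (ae_of_all _ fun t => ?_)
          rw [← mul_sub, norm_mul, Real.norm_of_nonneg (φ.nonneg_normed t), ← dist_eq_norm]
          refine mul_le_mul_of_nonneg_left ?_ (φ.nonneg_normed t)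
          simpa using hf.dist_le_mul (x - t) (y - t)
      _ = K * dist x y := by rw [integral_mul_const, φ.integral_normed, one_mul]
  · rw [← Real.dist_eq]
    refine φ.dist_normed_convolution_le hf.continuous.aestronglyMeasurable fun y hy => ?_
    refine (hf.dist_le_mul y x).trans ?_
    have h : dist y x ≤ δ / (K + 1) := (Metric.mem_ball.1 hy).le
    calc (K : ℝ) * dist y x ≤ (K + 1) * (δ / (K + 1)) :=
          mul_le_mul (by linarith) h dist_nonneg hK.le
      _ = δ := by field_simp

theorem tendsto_integral_mul_of_abs_sub_le {u v : Ω → ℝ} (hu : MemLp u 2 P) (hv : MemLp v 2 P)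
    {U V : ℕ → Ω → ℝ} (hU : ∀ n, AEStronglyMeasurable (U n) P)
    (hV : ∀ n, AEStronglyMeasurable (V n) P)
    (hUu : ∀ n ω, |U n ω - u ω| ≤ 1 / ((n : ℝ) + 1))
    (hVv : ∀ n ω, |V n ω - v ω| ≤ 1 / ((n : ℝ) + 1)) :
    Tendsto (fun n => ∫ ω, U n ω * V n ω ∂P) atTop (𝓝 (∫ ω, u ω * v ω ∂P)) := by
  have hlim : ∀ {w : ℝ} {s : ℕ → ℝ}, (∀ n, |s n - w| ≤ 1 / ((n : ℝ) + 1)) →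
      Tendsto s atTop (𝓝 w) := fun h =>
    tendsto_iff_dist_tendsto_zero.2 (squeeze_zero (fun _ => dist_nonneg) h
      tendsto_one_div_add_atTop_nhds_zero_nat)
  have hle : ∀ {w x : ℝ} {n : ℕ}, |x - w| ≤ 1 / ((n : ℝ) + 1) → |x| ≤ |w| + 1 :=
    fun {w x n} h => by
      have h₁ := abs_sub_abs_le_abs_sub x w
      have h₂ : 1 / ((n : ℝ) + 1) ≤ 1 := by
        rw [div_le_one (by positivity)]
        linarith [n.cast_nonneg (α := ℝ)]
      linarith
  refine tendsto_integral_of_dominated_convergence (fun ω => (|u ω| + 1) * (|v ω| + 1))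
    (fun n => (hU n).mul (hV n)) ((hu.abs.add (memLp_const 1)).integrable_mul
      (hv.abs.add (memLp_const 1))) (fun n => ae_of_all _ fun ω => ?_)
    (ae_of_all _ fun ω => (hlim fun n => hUu n ω).mul (hlim fun n => hVv n ω))
  rw [norm_mul]
  exact mul_le_mul (hle (hUu n ω)) (hle (hVv n ω)) (abs_nonneg _) (by positivity)

theorem abs_integral_mul_sub_le_of_lipschitzWith {X₁ X₂ W₁ W₂ : Ω → E}
    (hG : HasGaussianLaw (fun ω => ((X₁ ω, X₂ ω), (W₁ ω, W₂ ω))) P)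
    (hX₁ : ∫ ω, X₁ ω ∂P = 0) (hX₂ : ∫ ω, X₂ ω ∂P = 0)
    (hW₁ : ∫ ω, W₁ ω ∂P = 0) (hW₂ : ∫ ω, W₂ ω ∂P = 0)
    (h₁₁ : ∀ x y, cov[fun ω => inner ℝ x (X₁ ω), fun ω => inner ℝ y (W₁ ω); P] = 0)
    (h₁₂ : ∀ x y, cov[fun ω => inner ℝ x (X₁ ω), fun ω => inner ℝ y (W₂ ω); P] = 0)
    (h₂₁ : ∀ x y, cov[fun ω => inner ℝ x (X₂ ω), fun ω => inner ℝ y (W₁ ω); P] = 0)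
    (h₂₂ : ∀ x y, cov[fun ω => inner ℝ x (X₂ ω), fun ω => inner ℝ y (W₂ ω); P] = 0)
    (h₁ : ∀ x y, cov[fun ω => inner ℝ x (X₁ ω), fun ω => inner ℝ y (X₁ ω); P] =
      cov[fun ω => inner ℝ x (W₁ ω), fun ω => inner ℝ y (W₁ ω); P])
    (h₂ : ∀ x y, cov[fun ω => inner ℝ x (X₂ ω), fun ω => inner ℝ y (X₂ ω); P] =
      cov[fun ω => inner ℝ x (W₂ ω), fun ω => inner ℝ y (W₂ ω); P])
    (B : E →L[ℝ] E)
    (hB : ∀ x y, cov[fun ω => inner ℝ x (X₁ ω), fun ω => inner ℝ y (X₂ ω); P] -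
      cov[fun ω => inner ℝ x (W₁ ω), fun ω => inner ℝ y (W₂ ω); P] = inner ℝ x (B y))
    {f : E → ℝ} {K : ℝ≥0} (hK : LipschitzWith K f) :
    |∫ ω, f (X₁ ω) * f (X₂ ω) ∂P - ∫ ω, f (W₁ ω) * f (W₂ ω) ∂P| ≤ K ^ 2 * ‖B‖ := by
  choose g hg hgK hgf using fun n : ℕ => exists_contDiff_lipschitzWith_approx hK
    (Nat.one_div_pos_of_nat (α := ℝ) (n := n))
  have hlim : ∀ {Y Z : Ω → E}, MemLp Y 2 P → MemLp Z 2 P →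
      Tendsto (fun n => ∫ ω, g n (Y ω) * g n (Z ω) ∂P) atTop (𝓝 (∫ ω, f (Y ω) * f (Z ω) ∂P)) :=
    fun hY hZ => tendsto_integral_mul_of_abs_sub_le (memLp_comp_lipschitzWith hK hY)
      (memLp_comp_lipschitzWith hK hZ)
      (fun n => (memLp_comp_lipschitzWith (hgK n) hY).aestronglyMeasurable)
      (fun n => (memLp_comp_lipschitzWith (hgK n) hZ).aestronglyMeasurable)
      (fun n ω => hgf n _) (fun n ω => hgf n _)
  exact le_of_tendsto ((hlim hG.fst.fst.memLp_two hG.fst.snd.memLp_two).sub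
    (hlim hG.snd.fst.memLp_two hG.snd.snd.memLp_two)).abs
    (.of_forall fun n => abs_integral_mul_sub_le_of_contDiff hG hX₁ hX₂ hW₁ hW₂ h₁₁ h₁₂ h₂₁ h₂₂
      h₁ h₂ B hB (hg n) (hgK n))

theorem integral_comp_fst_prod_self {Ω F : Type*} [MeasurableSpace Ω] {P : Measure Ω}
    [IsProbabilityMeasure P] [NormedAddCommGroup F] [NormedSpace ℝ F] (g : Ω → F) :
    ∫ p, g p.1 ∂P.prod P = ∫ ω, g ω ∂P := by
  simp [integral_fun_fst g]

theorem integral_comp_snd_prod_self {Ω F : Type*} [MeasurableSpace Ω] {P : Measure Ω}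
    [IsProbabilityMeasure P] [NormedAddCommGroup F] [NormedSpace ℝ F] (g : Ω → F) :
    ∫ p, g p.2 ∂P.prod P = ∫ ω, g ω ∂P := by
  simp [integral_fun_snd g]

theorem covariance_comp_fst_prod_self {Ω : Type*} [MeasurableSpace Ω] {P : Measure Ω}
    [IsProbabilityMeasure P] (u v : Ω → ℝ) :
    cov[fun p => u p.1, fun p => v p.1; P.prod P] = cov[u, v; P] := by
  simp only [covariance, integral_comp_fst_prod_self u, integral_comp_fst_prod_self v]
  exact integral_comp_fst_prod_self fun ω => (u ω - ∫ a, u a ∂P) * (v ω - ∫ a, v a ∂P)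

theorem covariance_comp_snd_prod_self {Ω : Type*} [MeasurableSpace Ω] {P : Measure Ω}
    [IsProbabilityMeasure P] (u v : Ω → ℝ) :
    cov[fun p => u p.2, fun p => v p.2; P.prod P] = cov[u, v; P] := by
  simp only [covariance, integral_comp_snd_prod_self u, integral_comp_snd_prod_self v]
  exact integral_comp_snd_prod_self fun ω => (u ω - ∫ a, u a ∂P) * (v ω - ∫ a, v a ∂P)

/-- Comparison of two Gaussian pairs with no assumption on their joint law: they are first
replaced by independent copies on the product space. -/
theorem abs_integral_mul_sub_le {X₁ X₂ W₁ W₂ : Ω → E}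
    (hX : HasGaussianLaw (fun ω => (X₁ ω, X₂ ω)) P) (hW : HasGaussianLaw (fun ω => (W₁ ω, W₂ ω)) P)
    (hX₁ : ∫ ω, X₁ ω ∂P = 0) (hX₂ : ∫ ω, X₂ ω ∂P = 0)
    (hW₁ : ∫ ω, W₁ ω ∂P = 0) (hW₂ : ∫ ω, W₂ ω ∂P = 0)
    (h₁ : ∀ x y, cov[fun ω => inner ℝ x (X₁ ω), fun ω => inner ℝ y (X₁ ω); P] =
      cov[fun ω => inner ℝ x (W₁ ω), fun ω => inner ℝ y (W₁ ω); P])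
    (h₂ : ∀ x y, cov[fun ω => inner ℝ x (X₂ ω), fun ω => inner ℝ y (X₂ ω); P] =
      cov[fun ω => inner ℝ x (W₂ ω), fun ω => inner ℝ y (W₂ ω); P])
    (B : E →L[ℝ] E)
    (hB : ∀ x y, cov[fun ω => inner ℝ x (X₁ ω), fun ω => inner ℝ y (X₂ ω); P] -
      cov[fun ω => inner ℝ x (W₁ ω), fun ω => inner ℝ y (W₂ ω); P] = inner ℝ x (B y))
    {f : E → ℝ} {K : ℝ≥0} (hK : LipschitzWith K f) :
    |∫ ω, f (X₁ ω) * f (X₂ ω) ∂P - ∫ ω, f (W₁ ω) * f (W₂ ω) ∂P| ≤ K ^ 2 * ‖B‖ := by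
  have : ProperSpace E := FiniteDimensional.proper ℝ E
  let Q := P.prod P
  have gX : HasGaussianLaw (fun p : Ω × Ω => (X₁ p.1, X₂ p.1)) Q := ⟨by
    have := hX.isGaussian_map
    rwa [← (measurePreserving_fst (μ := P) (ν := P)).map_eq, AEMeasurable.map_map_of_aemeasurable
      (by rw [(measurePreserving_fst (μ := P) (ν := P)).map_eq]; exact hX.aemeasurable)
      measurable_fst.aemeasurable] at this⟩
  have gW : HasGaussianLaw (fun p : Ω × Ω => (W₁ p.2, W₂ p.2)) Q := ⟨by
    have := hW.isGaussian_map
    rwa [← (measurePreserving_snd (μ := P) (ν := P)).map_eq, AEMeasurable.map_map_of_aemeasurable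
      (by rw [(measurePreserving_snd (μ := P) (ν := P)).map_eq]; exact hW.aemeasurable)
      measurable_snd.aemeasurable] at this⟩
  have hG := IndepFun.hasGaussianLaw gX gW (indepFun_prod₀ hX.aemeasurable hW.aemeasurable)
  have hzero : ∀ {Y Z : Ω → E}, MemLp Y 2 P → MemLp Z 2 P → ∀ x y,
      cov[fun p => inner ℝ x (Y p.1), fun p => inner ℝ y (Z p.2); Q] = 0 := fun hY hZ x y =>
    covariance_fst_snd_prod (hY.const_inner x) (hZ.const_inner y)
  have key := abs_integral_mul_sub_le_of_lipschitzWith (P := Q) hG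
    ((integral_comp_fst_prod_self X₁).trans hX₁) ((integral_comp_fst_prod_self X₂).trans hX₂)
    ((integral_comp_snd_prod_self W₁).trans hW₁) ((integral_comp_snd_prod_self W₂).trans hW₂)
    (hzero hX.fst.memLp_two hW.fst.memLp_two) (hzero hX.fst.memLp_two hW.snd.memLp_two)
    (hzero hX.snd.memLp_two hW.fst.memLp_two) (hzero hX.snd.memLp_two hW.snd.memLp_two)
    (fun x y => (covariance_comp_fst_prod_self _ _).trans
      ((h₁ x y).trans (covariance_comp_snd_prod_self _ _).symm))
    (fun x y => (covariance_comp_fst_prod_self _ _).trans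
      ((h₂ x y).trans (covariance_comp_snd_prod_self _ _).symm)) B
    (fun x y => (congrArg₂ _ (covariance_comp_fst_prod_self _ _)
      (covariance_comp_snd_prod_self _ _)).trans (hB x y)) hK
  rwa [integral_comp_fst_prod_self fun ω => f (X₁ ω) * f (X₂ ω),
    integral_comp_snd_prod_self fun ω => f (W₁ ω) * f (W₂ ω)] at key

theorem map_eq_of_hasGaussianLaw_of_covariance_eq {X W : Ω → E} (hX : HasGaussianLaw X P)
    (hW : HasGaussianLaw W P) (hX0 : ∫ ω, X ω ∂P = 0) (hW0 : ∫ ω, W ω ∂P = 0)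
    (h : ∀ x y, cov[fun ω => inner ℝ x (X ω), fun ω => inner ℝ y (X ω); P] =
      cov[fun ω => inner ℝ x (W ω), fun ω => inner ℝ y (W ω); P]) :
    P.map X = P.map W := by
  have : ProperSpace E := FiniteDimensional.proper ℝ E
  have := hX.isGaussian_map
  have := hW.isGaussian_map
  refine Measure.ext_of_charFun (funext fun t => ?_)
  rw [hX.charFun_map_eq, hW.charFun_map_eq, integral_inner hX.integrable,
    integral_inner hW.integrable, hX0, hW0,
    ← covariance_self (hX.memLp_two.const_inner (𝕜 := ℝ) t).aestronglyMeasurable.aemeasurable,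
    ← covariance_self (hW.memLp_two.const_inner (𝕜 := ℝ) t).aestronglyMeasurable.aemeasurable, h]

theorem abs_covariance_comp_sub_le {X₁ X₂ W₁ W₂ : Ω → E}
    (hX : HasGaussianLaw (fun ω => (X₁ ω, X₂ ω)) P) (hW : HasGaussianLaw (fun ω => (W₁ ω, W₂ ω)) P)
    (hX₁ : ∫ ω, X₁ ω ∂P = 0) (hX₂ : ∫ ω, X₂ ω ∂P = 0)
    (hW₁ : ∫ ω, W₁ ω ∂P = 0) (hW₂ : ∫ ω, W₂ ω ∂P = 0)
    (h₁ : ∀ x y, cov[fun ω => inner ℝ x (X₁ ω), fun ω => inner ℝ y (X₁ ω); P] =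
      cov[fun ω => inner ℝ x (W₁ ω), fun ω => inner ℝ y (W₁ ω); P])
    (h₂ : ∀ x y, cov[fun ω => inner ℝ x (X₂ ω), fun ω => inner ℝ y (X₂ ω); P] =
      cov[fun ω => inner ℝ x (W₂ ω), fun ω => inner ℝ y (W₂ ω); P])
    (B : E →L[ℝ] E)
    (hB : ∀ x y, cov[fun ω => inner ℝ x (X₁ ω), fun ω => inner ℝ y (X₂ ω); P] -
      cov[fun ω => inner ℝ x (W₁ ω), fun ω => inner ℝ y (W₂ ω); P] = inner ℝ x (B y))
    {f : E → ℝ} {K : ℝ≥0} (hK : LipschitzWith K f) :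
    |(∫ ω, f (X₁ ω) * f (X₂ ω) ∂P - (∫ ω, f (X₁ ω) ∂P) * ∫ ω, f (X₂ ω) ∂P) -
      (∫ ω, f (W₁ ω) * f (W₂ ω) ∂P - (∫ ω, f (W₁ ω) ∂P) * ∫ ω, f (W₂ ω) ∂P)| ≤ K ^ 2 * ‖B‖ := by
  have hmean : ∀ {Y Z : Ω → E}, HasGaussianLaw Y P → HasGaussianLaw Z P → P.map Y = P.map Z →
      ∫ ω, f (Y ω) ∂P = ∫ ω, f (Z ω) ∂P := fun hY hZ h => by
    rw [← integral_map hY.aemeasurable hK.continuous.aestronglyMeasurable, h,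
      integral_map hZ.aemeasurable hK.continuous.aestronglyMeasurable]
  rw [hmean hX.fst hW.fst (map_eq_of_hasGaussianLaw_of_covariance_eq hX.fst hW.fst hX₁ hW₁ h₁),
    hmean hX.snd hW.snd (map_eq_of_hasGaussianLaw_of_covariance_eq hX.snd hW.snd hX₂ hW₂ h₂),
    sub_sub_sub_cancel_right]
  exact abs_integral_mul_sub_le hX hW hX₁ hX₂ hW₁ hW₂ h₁ h₂ B hB hK

end

theorem IsJointGaussian.hasGaussianLaw_toLp {Ω : Type*} [MeasurableSpace Ω] {P : Measure Ω}
    {ν : ℕ} {X : Fin 2 → Fin ν → Ω → ℝ} (hX : ∀ i u, Measurable (X i u))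
    (hG : IsJointGaussian P (fun iu : Fin 2 × Fin ν => X iu.1 iu.2)) :
    HasGaussianLaw (fun ω => ((WithLp.toLp 2 fun u => X 0 u ω : EuclideanSpace ℝ (Fin ν)),
      (WithLp.toLp 2 fun u => X 1 u ω : EuclideanSpace ℝ (Fin ν)))) P := by
  refine ⟨isGaussian_of_map_eq_gaussianReal fun T => ?_⟩
  let e := EuclideanSpace.basisFun (Fin ν) ℝ
  obtain ⟨μ, v, h⟩ := hG Finset.univ fun iu => if iu.1 = 0 then T (e iu.2, 0) else T (0, e iu.2)
  refine ⟨μ, v, ?_⟩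
  rw [Measure.map_map (by fun_prop) (by fun_prop), ← h]
  refine congrArg (P.map ·) (funext fun ω => ?_)
  have hsum : ∀ x : EuclideanSpace ℝ (Fin ν), x = ∑ u, x u • e u := fun x => by
    simpa [e] using (e.sum_repr x).symm
  have hT : ∀ x y : EuclideanSpace ℝ (Fin ν),
      T (x, y) = ∑ u, T (e u, 0) * x u + ∑ u, T (0, e u) * y u := fun x y => by
    have h₁ : (T.comp (.inl ℝ _ _)) x = ∑ u, T (e u, 0) * x u := by
      conv_lhs => rw [hsum x]
      simp [mul_comm]
    have h₂ : (T.comp (.inr ℝ _ _)) y = ∑ u, T (0, e u) * y u := by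
      conv_lhs => rw [hsum y]
      simp [mul_comm]
    rw [← h₁, ← h₂, ← ContinuousLinearMap.comp_inl_add_comp_inr]
  exact (hT _ _).trans (by simp [Fintype.sum_prod_type])

theorem covariance_inner_toLp {Ω : Type*} [MeasurableSpace Ω] {P : Measure Ω}
    [IsProbabilityMeasure P] {ν : ℕ} {Y Z : Fin ν → Ω → ℝ} (hY : ∀ u, MemLp (Y u) 2 P)
    (hZ : ∀ u, MemLp (Z u) 2 P) (hY0 : ∀ u, ∫ ω, Y u ω ∂P = 0) (hZ0 : ∀ u, ∫ ω, Z u ω ∂P = 0)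
    {S : Matrix (Fin ν) (Fin ν) ℝ} (hS : ∀ u v, ∫ ω, Y u ω * Z v ω ∂P = S u v)
    (x y : EuclideanSpace ℝ (Fin ν)) :
    cov[fun ω => inner ℝ x (WithLp.toLp 2 fun u => Y u ω),
      fun ω => inner ℝ y (WithLp.toLp 2 fun u => Z u ω); P] =
      inner ℝ x (Matrix.toEuclideanLin S y) := by
  have hc : ∀ u v, cov[Y u, Z v; P] = S u v := fun u v => by
    rw [covariance_eq_sub (hY u) (hZ v), hY0, hZ0, mul_zero, sub_zero, ← hS]
    rfl
  simp only [PiLp.inner_apply, RCLike.inner_apply, conj_trivial]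
  rw [covariance_fun_sum_fun_sum (fun u => (hY u).mul_const (x u))
    (fun u => (hZ u).mul_const (y u))]
  refine Finset.sum_congr rfl fun u _ => ?_
  simp only [covariance_mul_const_left, covariance_mul_const_right, hc,
    Matrix.ofLp_toLpLin, Matrix.toLin'_apply, Matrix.mulVec, dotProduct, Finset.sum_mul]
  refine Finset.sum_congr rfl fun v _ => ?_
  ring

theorem lipschitzWith_comp_ofLp {ν : ℕ} {f : (Fin ν → ℝ) → ℝ} {L : ℝ} (hL : 0 ≤ L)
    (hLip : ∀ x y : Fin ν → ℝ, |f x - f y| ≤ L * Real.sqrt (∑ u, (x u - y u) ^ 2)) :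
    LipschitzWith ⟨L, hL⟩ fun x : EuclideanSpace ℝ (Fin ν) => f x.ofLp :=
  LipschitzWith.of_dist_le_mul fun x y => by
    rw [Real.dist_eq, EuclideanSpace.dist_eq]
    simp only [Real.dist_eq, sq_abs]
    exact hLip x.ofLp y.ofLp

/-- Gaussian interpolation covariance inequality (4.16) of
Bardet–Surgailis, after Houdré–Pérez-Abreu–Surgailis. -/
theorem gaussian_interpolation_covariance_bound
    {Ω : Type*} [MeasurableSpace Ω] (P : Measure Ω) [IsProbabilityMeasure P]
    (ν : ℕ) (X W : Fin 2 → Fin ν → Ω → ℝ)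
    (hXmeas : ∀ i u, Measurable (X i u)) (hWmeas : ∀ i u, Measurable (W i u))
    (hXG : IsJointGaussian P (fun iu : Fin 2 × Fin ν => X iu.1 iu.2))
    (hWG : IsJointGaussian P (fun iu : Fin 2 × Fin ν => W iu.1 iu.2))
    (hXc : ∀ i u, ∫ ω, X i u ω ∂P = 0) (hWc : ∀ i u, ∫ ω, W i u ω ∂P = 0)
    (hXid : ∀ i u v, ∫ ω, X i u ω * X i v ω ∂P = if u = v then 1 else 0)
    (hWid : ∀ i u v, ∫ ω, W i u ω * W i v ω ∂P = if u = v then 1 else 0)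
    (S1 S0 : Matrix (Fin ν) (Fin ν) ℝ)
    (hS1 : ∀ u v, ∫ ω, X 0 u ω * X 1 v ω ∂P = S1 u v)
    (hS0 : ∀ u v, ∫ ω, W 0 u ω * W 1 v ω ∂P = S0 u v)
    (f : (Fin ν → ℝ) → ℝ) (hfmeas : Measurable f) (L : ℝ)
    (hLip : ∀ x y : Fin ν → ℝ, |f x - f y| ≤ L * Real.sqrt (∑ u, (x u - y u) ^ 2)) :
    |((∫ ω, f (fun u => X 0 u ω) * f (fun u => X 1 u ω) ∂P)
        - (∫ ω, f (fun u => X 0 u ω) ∂P) * (∫ ω, f (fun u => X 1 u ω) ∂P))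
      - ((∫ ω, f (fun u => W 0 u ω) * f (fun u => W 1 u ω) ∂P)
        - (∫ ω, f (fun u => W 0 u ω) ∂P) * (∫ ω, f (fun u => W 1 u ω) ∂P))|
      ≤ L ^ 2 * specNorm (S1 - S0) := by
  rcases isEmpty_or_nonempty (Fin ν) with hν | ⟨⟨u₀⟩⟩
  · have hf : ∀ x, f x = f 0 := fun x => congrArg f (Subsingleton.elim _ _)
    simp only [hf, integral_const, probReal_univ, one_smul, sub_self, abs_zero]
    exact mul_nonneg (sq_nonneg L) (norm_nonneg _)
  have hL : 0 ≤ L := by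
    have h := (abs_nonneg _).trans (hLip (Pi.single u₀ 1) 0)
    simpa [Pi.single_apply] using h
  have gX := IsJointGaussian.hasGaussianLaw_toLp hXmeas hXG
  have gW := IsJointGaussian.hasGaussianLaw_toLp hWmeas hWG
  have hproj : ∀ {Y : Fin ν → Ω → ℝ}, HasGaussianLaw
      (fun ω => (WithLp.toLp 2 fun u => Y u ω : EuclideanSpace ℝ (Fin ν))) P →
      ∀ u, MemLp (Y u) 2 P := fun hY u => (hY.map_fun (EuclideanSpace.proj u)).memLp_two
  have hmean : ∀ {Y : Fin ν → Ω → ℝ}, HasGaussianLaw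
      (fun ω => (WithLp.toLp 2 fun u => Y u ω : EuclideanSpace ℝ (Fin ν))) P →
      (∀ u, ∫ ω, Y u ω ∂P = 0) →
      ∫ ω, (WithLp.toLp 2 fun u => Y u ω : EuclideanSpace ℝ (Fin ν)) ∂P = 0 := fun hY h => by
    ext u
    exact ((EuclideanSpace.proj u).integral_comp_comm hY.integrable).symm.trans (h u)
  have cX₁ := covariance_inner_toLp (hproj gX.fst) (hproj gX.fst) (hXc 0) (hXc 0)
    (S := 1) (fun u v => (hXid 0 u v).trans Matrix.one_apply.symm)
  have cX₂ := covariance_inner_toLp (hproj gX.snd) (hproj gX.snd) (hXc 1) (hXc 1)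
    (S := 1) (fun u v => (hXid 1 u v).trans Matrix.one_apply.symm)
  have cW₁ := covariance_inner_toLp (hproj gW.fst) (hproj gW.fst) (hWc 0) (hWc 0)
    (S := 1) (fun u v => (hWid 0 u v).trans Matrix.one_apply.symm)
  have cW₂ := covariance_inner_toLp (hproj gW.snd) (hproj gW.snd) (hWc 1) (hWc 1)
    (S := 1) (fun u v => (hWid 1 u v).trans Matrix.one_apply.symm)
  have cX := covariance_inner_toLp (hproj gX.fst) (hproj gX.snd) (hXc 0) (hXc 1) hS1
  have cW := covariance_inner_toLp (hproj gW.fst) (hproj gW.snd) (hWc 0) (hWc 1) hS0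
  exact abs_covariance_comp_sub_le gX gW (hmean gX.fst (hXc 0)) (hmean gX.snd (hXc 1))
    (hmean gW.fst (hWc 0)) (hmean gW.snd (hWc 1))
    (fun x y => (cX₁ x y).trans (cW₁ x y).symm) (fun x y => (cX₂ x y).trans (cW₂ x y).symm)
    (LinearMap.toContinuousLinearMap (Matrix.toEuclideanLin (S1 - S0)))
    (fun x y => by
      rw [cX, cW, ← inner_sub_right, LinearMap.coe_toContinuousLinearMap', map_sub,
        LinearMap.sub_apply])
    (lipschitzWith_comp_ofLp hL hLip)
end
end

section
/- Let (X_n(k))_{1≤k≤n, n∈N} be a triangular array of standardized Gaussian vectors in R^ν whose covariances r_n^{(p,q)}(j,k) := E[X_n^{(p)}(j)X_n^{(q)}(k)] satisfy, for some integer m ≥ 1 and all 1 ≤ p,q ≤ ν: sup_{n≥1} max_{1≤k≤n} Σ_{1≤j≤n} |r_n^{(p,q)}(j,k)|^m < ∞ and lim_{K→∞} sup_{n≥1} n^{−1} Σ_{1≤j,k≤n, |j−k|>K} |r_n^{(p,q)}(j,k)|^m = 0. Let 0 = τ_0 < τ_1 < … < τ_M < τ_{M+1} = 1 be a fixed partition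 and let g_0,…,g_M be fixed finite linear combinations of product Hermite polynomials H_k with m ≤ |k| ≤ t for some t < ∞ (so each g_i has Hermite rank at least m). Set Z_n := n^{−1/2} Σ_{i=0}^M Σ_{k: k/n ∈ (τ_i, τ_{i+1}]} g_i(X_n(k)) and σ_n² := E Z_n². If liminf_{n→∞} σ_n² > 0, then Z_n/σ_n converges in distribution to N(0,1). -/
open MeasureTheory ProbabilityTheory Finset Filter
open scoped BigOperators NNReal Topology

noncomputable section

def hermiteFun (k : ℕ) (x : ℝ) : ℝ := Polynomial.aeval x (Polynomial.hermite k)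

def hermiteProd {ν : ℕ} (k : Fin ν → ℕ) (x : Fin ν → ℝ) : ℝ := ∏ i, hermiteFun (k i) (x i)

/-! ### Gaussian integration by parts -/

/-- **Stein's identity** for the standard Gaussian measure on the line. -/
lemma integral_mul_gaussianReal_eq_integral_deriv {f f' : ℝ → ℝ}
    (hf : ∀ x, HasDerivAt f (f' x) x)
    (hint : Integrable f (gaussianReal 0 1))
    (hint_mul : Integrable (fun x => x * f x) (gaussianReal 0 1))
    (hint' : Integrable f' (gaussianReal 0 1)) :
    ∫ x, x * f x ∂(gaussianReal 0 1) = ∫ x, f' x ∂(gaussianReal 0 1) := by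
  have hγ : ∀ {h : ℝ → ℝ}, Integrable h (gaussianReal 0 1) →
      Integrable (fun x => gaussianPDFReal 0 1 x * h x) := by
    intro h hh
    rw [gaussianReal_of_var_ne_zero _ one_ne_zero,
      integrable_withDensity_iff_integrable_smul' (measurable_gaussianPDF 0 1)
        (ae_of_all _ fun _ => gaussianPDF_lt_top)] at hh
    simpa [toReal_gaussianPDF] using hh
  have hpdf : ∀ x, HasDerivAt (gaussianPDFReal 0 1) (-x * gaussianPDFReal 0 1 x) x := by
    intro x
    have h1 : HasDerivAt (fun x : ℝ => -(x - 0) ^ 2 / (2 * ((1 : ℝ≥0) : ℝ))) (-x) x := by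
      have := (((hasDerivAt_id x).sub_const 0).pow 2).neg.div_const (2 * ((1 : ℝ≥0) : ℝ))
      refine this.congr_deriv ?_
      simp only [id_eq, NNReal.coe_one]
      norm_num
      ring
    have h2 := h1.exp.const_mul ((Real.sqrt (2 * Real.pi * ((1 : ℝ≥0) : ℝ)))⁻¹)
    have h3 : gaussianPDFReal 0 1 = fun x : ℝ => (Real.sqrt (2 * Real.pi * ((1 : ℝ≥0) : ℝ)))⁻¹ *
        Real.exp (-(x - 0) ^ 2 / (2 * ((1 : ℝ≥0) : ℝ))) := by
      rw [gaussianPDFReal_def]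
    rw [h3]
    refine h2.congr_deriv ?_
    ring
  have key := integral_eq_zero_of_hasDerivAt_of_integrable
    (f := fun x => gaussianPDFReal 0 1 x * f x)
    (f' := fun x => gaussianPDFReal 0 1 x * f' x - gaussianPDFReal 0 1 x * (x * f x))
    (fun x => ((hpdf x).mul (hf x)).congr_deriv (by ring))
    ((hγ hint').sub (hγ hint_mul)) (hγ hint)
  rw [integral_sub (hγ hint') (hγ hint_mul)] at key
  rw [integral_gaussianReal_eq_integral_smul one_ne_zero,
    integral_gaussianReal_eq_integral_smul one_ne_zero]
  simp only [smul_eq_mul]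
  linarith

/-- **Gaussian integration by parts** along the covariance vector of a unit-variance coordinate. -/
lemma integral_mul_eq_integral_lineDeriv {Ω ι : Type*} [MeasurableSpace Ω] {P : Measure Ω}
    [Fintype ι] {Y : ι → Ω → ℝ}
    (hY : HasGaussianLaw (fun ω i => Y i ω) P) (hmeas : ∀ i, Measurable (Y i))
    (hcent : ∀ i, ∫ ω, Y i ω ∂P = 0) {a : ι} (ha : ∫ ω, Y a ω * Y a ω ∂P = 1)
    {G G' : (ι → ℝ) → ℝ}
    (hG : ∀ y, HasDerivAt (fun t : ℝ => G (y + t • fun b => ∫ ω, Y a ω * Y b ω ∂P)) (G' y) 0)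
    (hGm : Measurable G) (hGm' : Measurable G')
    (hint : Integrable (fun ω => G (fun i => Y i ω)) P)
    (hint_mul : Integrable (fun ω => Y a ω * G (fun i => Y i ω)) P)
    (hint' : Integrable (fun ω => G' (fun i => Y i ω)) P) :
    ∫ ω, Y a ω * G (fun i => Y i ω) ∂P = ∫ ω, G' (fun i => Y i ω) ∂P := by
  have := hY.isProbabilityMeasure
  set R : ι → ℝ := fun b => ∫ ω, Y a ω * Y b ω ∂P with hR
  have hL2 : ∀ i, MemLp (Y i) 2 P := fun i => (hY.eval i).memLp_two
  let W : ι → Ω → ℝ := fun b ω => Y b ω - R b * Y a ω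
  have hWm : Measurable fun ω b => W b ω :=
    measurable_pi_lambda _ fun b => (hmeas b).sub ((hmeas a).const_mul _)
  have hgauss : HasGaussianLaw (fun ω => ((fun _ : Unit => Y a ω), fun b => W b ω)) P := by
    let L : (ι → ℝ) →L[ℝ] (Unit → ℝ) × (ι → ℝ) :=
      (ContinuousLinearMap.pi fun _ => ContinuousLinearMap.proj a).prod
        (ContinuousLinearMap.pi fun b =>
          ContinuousLinearMap.proj b - R b • ContinuousLinearMap.proj a)
    exact hY.map_fun L
  have hcov : ∀ b, cov[Y a, W b; P] = 0 := by
    intro b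
    have hW2 : MemLp (W b) 2 P := (hL2 b).sub ((hL2 a).const_mul _)
    rw [covariance_eq_sub (hL2 a) hW2, hcent a, zero_mul, sub_zero]
    have e1 : ∫ ω, (Y a * W b) ω ∂P = ∫ ω, (Y a ω * Y b ω - R b * (Y a ω * Y a ω)) ∂P := by
      congr 1; ext ω; simp [W]; ring
    have hab : ∀ c, Integrable (fun ω => Y a ω * Y c ω) P := fun c =>
      (hL2 a).integrable_mul (hL2 c)
    rw [e1, integral_sub (hab b) ((hab a).const_mul _), integral_const_mul, ha]
    simp [hR]
  have hind : IndepFun (Y a) (fun ω b => W b ω) P := by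
    have h := hgauss.indepFun_of_covariance_eval (fun _ b => hcov b)
    exact h.comp (φ := fun f : Unit → ℝ => f ()) (ψ := id) (measurable_pi_apply _) measurable_id
  have hlaw : P.map (Y a) = gaussianReal 0 1 := by
    rw [(hY.eval a).map_eq_gaussianReal, hcent a, variance_eq_integral (hmeas a).aemeasurable,
      hcent a]
    congr 1
    simp only [sub_zero, pow_two, ha, Real.toNNReal_one]
  have hprod := hind.map_prod_eq_prod_map_map (hmeas a).aemeasurable hWm.aemeasurable
  rw [hlaw] at hprod
  set Q := P.map fun ω b => W b ω with hQ
  have : IsProbabilityMeasure Q := Measure.isProbabilityMeasure_map hWm.aemeasurable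
  have hpm : Measurable fun ω => (Y a ω, fun b => W b ω) := (hmeas a).prodMk hWm
  have hrec : ∀ ω, (fun i => Y i ω) = (fun b => W b ω) + Y a ω • R := by
    intro ω; ext b; simp [W]; ring
  have hcomb : Measurable fun p : ℝ × (ι → ℝ) => p.2 + p.1 • R := by fun_prop
  have tr : ∀ {h : ℝ × (ι → ℝ) → ℝ}, Measurable h →
      Integrable (fun ω => h (Y a ω, fun b => W b ω)) P →
      Integrable h ((gaussianReal 0 1).prod Q) ∧
      ∫ ω, h (Y a ω, fun b => W b ω) ∂P = ∫ w, ∫ x, h (x, w) ∂(gaussianReal 0 1) ∂Q := by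
    intro h hm hi
    have h1 : Integrable h ((gaussianReal 0 1).prod Q) := by
      rw [← hprod, integrable_map_measure hm.aestronglyMeasurable hpm.aemeasurable]
      exact hi
    refine ⟨h1, ?_⟩
    rw [← integral_prod_symm _ h1, ← hprod,
      integral_map hpm.aemeasurable hm.aestronglyMeasurable]
  obtain ⟨i1, -⟩ := tr (h := fun p => G (p.2 + p.1 • R)) (hGm.comp hcomb)
    (by simpa only [hrec] using hint)
  obtain ⟨i2, e2⟩ := tr (h := fun p => p.1 * G (p.2 + p.1 • R))
    (measurable_fst.mul (hGm.comp hcomb)) (by simpa only [hrec] using hint_mul)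
  obtain ⟨i3, e3⟩ := tr (h := fun p => G' (p.2 + p.1 • R)) (hGm'.comp hcomb)
    (by simpa only [hrec] using hint')
  simp only [hrec]
  rw [e2, e3]
  refine integral_congr_ae ?_
  filter_upwards [i1.prod_left_ae, i2.prod_left_ae, i3.prod_left_ae] with w h1 h2 h3
  refine integral_mul_gaussianReal_eq_integral_deriv (fun x => ?_) h1 h2 h3
  have h := hG (w + x • R)
  have h' : HasDerivAt (fun t : ℝ => t - x) 1 x := (hasDerivAt_id x).sub_const x
  have h0 : HasDerivAt (fun t : ℝ => G (w + x • R + t • R)) (G' (w + x • R)) (x - x) := by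
    simpa using h
  have hc := HasDerivAt.comp (h := fun t => t - x) x h0 h'
  rw [mul_one] at hc
  refine hc.congr_of_eventuallyEq (Eventually.of_forall fun t => ?_)
  simp only [Function.comp]
  congr 1
  rw [add_assoc, ← add_smul]
  congr 2; ring

/-! ### Hermite functions -/

lemma derivative_hermite_succ (n : ℕ) :
    Polynomial.derivative (Polynomial.hermite (n + 1)) =
      ((n + 1 : ℕ) : Polynomial ℤ) * Polynomial.hermite n := by
  induction n with
  | zero => simp
  | succ n ih =>
    have h1 := Polynomial.hermite_succ (n + 1)
    have h2 := Polynomial.hermite_succ n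
    rw [h1, Polynomial.derivative_sub, Polynomial.derivative_mul, Polynomial.derivative_X, ih,
      Polynomial.derivative_mul, Polynomial.derivative_natCast]
    have h3 : Polynomial.derivative (Polynomial.hermite n) =
        Polynomial.X * Polynomial.hermite n - Polynomial.hermite (n + 1) := by rw [h2]; ring
    rw [h3]
    push_cast
    ring

lemma hasDerivAt_hermiteFun (k : ℕ) (x : ℝ) :
    HasDerivAt (hermiteFun k) (k * hermiteFun (k - 1) x) x := by
  have h := Polynomial.hasDerivAt_aeval (Polynomial.hermite k) x
  refine h.congr_deriv ?_
  cases k with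
  | zero => simp
  | succ n => rw [derivative_hermite_succ]; simp [hermiteFun]

lemma hermiteFun_succ (k : ℕ) (x : ℝ) :
    hermiteFun (k + 1) x = x * hermiteFun k x - k * hermiteFun (k - 1) x := by
  have h : (k : ℝ) * hermiteFun (k - 1) x =
      Polynomial.aeval x (Polynomial.derivative (Polynomial.hermite k)) := by
    cases k with
    | zero => simp
    | succ n => rw [derivative_hermite_succ]; simp [hermiteFun]
  rw [h, hermiteFun, hermiteFun, Polynomial.hermite_succ]
  simp

lemma measurable_hermiteFun (k : ℕ) : Measurable (hermiteFun k) :=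
  (Polynomial.continuous_aeval _).measurable

lemma hermiteProd_zero {ν : ℕ} (x : Fin ν → ℝ) : hermiteProd 0 x = 1 := by
  simp [hermiteProd, hermiteFun]

lemma measurable_hermiteProd {ν : ℕ} (k : Fin ν → ℕ) : Measurable (hermiteProd k) :=
  Finset.measurable_fun_prod _ fun i _ => (measurable_hermiteFun _).comp (measurable_pi_apply i)

lemma hermiteProd_eq_mul_prod_erase {ν : ℕ} (k : Fin ν → ℕ) (u : Fin ν) (x : Fin ν → ℝ) :
    hermiteProd k x = hermiteFun (k u) (x u) * ∏ i ∈ univ.erase u, hermiteFun (k i) (x i) :=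
  (mul_prod_erase _ _ (mem_univ u)).symm

lemma prod_erase_sub_single {ν : ℕ} (k : Fin ν → ℕ) (u : Fin ν) (x : Fin ν → ℝ) :
    ∏ i ∈ univ.erase u, hermiteFun ((k - Pi.single u 1 : Fin ν → ℕ) i) (x i) =
      ∏ i ∈ univ.erase u, hermiteFun (k i) (x i) := by
  refine prod_congr rfl fun i hi => ?_
  rw [Pi.sub_apply, Pi.single_eq_of_ne (ne_of_mem_erase hi), Nat.sub_zero]

lemma hasDerivAt_hermiteProd {ν : ℕ} (k : Fin ν → ℕ) (x r : Fin ν → ℝ) :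
    HasDerivAt (fun t : ℝ => hermiteProd k (x + t • r))
      (∑ v, r v * (k v * hermiteProd (k - Pi.single v 1) x)) 0 := by
  have h1 : ∀ v ∈ (univ : Finset (Fin ν)),
      HasDerivAt (fun t : ℝ => hermiteFun (k v) (x v + t * r v))
        (k v * hermiteFun (k v - 1) (x v) * r v) 0 := by
    intro v _
    have ha : HasDerivAt (fun t : ℝ => x v + t * r v) (r v) 0 := by
      simpa using ((hasDerivAt_id (0 : ℝ)).mul_const (r v)).const_add (x v)
    have hb := hasDerivAt_hermiteFun (k v) (x v + 0 * r v)
    have hc := HasDerivAt.comp (h := fun t : ℝ => x v + t * r v) (0 : ℝ) hb ha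
    simp only [zero_mul, add_zero] at hc
    exact hc
  have h2 := HasDerivAt.fun_finsetProd h1
  simp only [hermiteProd, Pi.add_apply, Pi.smul_apply, smul_eq_mul] at h2 ⊢
  refine h2.congr_deriv (sum_congr rfl fun v _ => ?_)
  have := hermiteProd_eq_mul_prod_erase (k - Pi.single v 1) v x
  rw [prod_erase_sub_single, hermiteProd] at this
  rw [this]
  simp
  ring

lemma hermiteProd_eq_of_pos {ν : ℕ} {k : Fin ν → ℕ} {u : Fin ν} (hu : 0 < k u) (x : Fin ν → ℝ) :
    hermiteProd k x = x u * hermiteProd (k - Pi.single u 1) x -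
      (k - Pi.single u 1 : Fin ν → ℕ) u * hermiteProd (k - Pi.single u 1 - Pi.single u 1) x := by
  rw [hermiteProd_eq_mul_prod_erase k u, hermiteProd_eq_mul_prod_erase (k - Pi.single u 1) u,
    hermiteProd_eq_mul_prod_erase (k - Pi.single u 1 - Pi.single u 1) u,
    prod_erase_sub_single (k - Pi.single u 1), prod_erase_sub_single k]
  obtain ⟨n, hn⟩ := Nat.exists_eq_succ_of_ne_zero hu.ne'
  simp only [Pi.sub_apply, Pi.single_eq_same, hn, Nat.succ_eq_add_one, Nat.add_sub_cancel,
    hermiteFun_succ]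
  ring

/-! ### Random variables with moments of all orders -/

/-- A random variable with finite moments of all orders. -/
def HasAllMoments {Ω : Type*} [MeasurableSpace Ω] (P : Measure Ω) (f : Ω → ℝ) : Prop :=
  ∀ p : ENNReal, p ≠ ⊤ → MemLp f p P

namespace HasAllMoments

variable {Ω : Type*} [MeasurableSpace Ω] {P : Measure Ω} {f g : Ω → ℝ}

lemma mul (hf : HasAllMoments P f) (hg : HasAllMoments P g) :
    HasAllMoments P (fun ω => f ω * g ω) := by
  intro p hp
  have h2 : (2 * p : ENNReal) ≠ ⊤ := ENNReal.mul_ne_top (by simp) hp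
  have : ENNReal.HolderTriple (2 * p) (2 * p) p := ⟨by
    rw [ENNReal.mul_inv (by simp) (by simp), ← add_mul, ENNReal.inv_two_add_inv_two, one_mul]⟩
  exact (hg _ h2).mul' (hf _ h2)

lemma add (hf : HasAllMoments P f) (hg : HasAllMoments P g) :
    HasAllMoments P (fun ω => f ω + g ω) := fun p hp => (hf p hp).add (hg p hp)

lemma const_mul (hf : HasAllMoments P f) (c : ℝ) : HasAllMoments P (fun ω => c * f ω) :=
  fun p hp => (hf p hp).const_mul c

lemma sum {ι : Type*} {s : Finset ι} {F : ι → Ω → ℝ} (h : ∀ i ∈ s, HasAllMoments P (F i)) :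
    HasAllMoments P (fun ω => ∑ i ∈ s, F i ω) := fun p hp => memLp_finsetSum s fun i hi => h i hi p hp

lemma of_bound [IsFiniteMeasure P] (hf : AEStronglyMeasurable f P) (C : ℝ)
    (h : ∀ ω, |f ω| ≤ C) : HasAllMoments P f :=
  fun _ _ => MemLp.of_bound hf C (ae_of_all _ h)

lemma const [IsFiniteMeasure P] (c : ℝ) : HasAllMoments P (fun _ => c) :=
  fun _ _ => memLp_const c

lemma prod [IsFiniteMeasure P] {ι : Type*} {s : Finset ι} {F : ι → Ω → ℝ}
    (h : ∀ i ∈ s, HasAllMoments P (F i)) : HasAllMoments P (fun ω => ∏ i ∈ s, F i ω) := by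
  classical
  induction s using Finset.induction_on with
  | empty => simpa using const 1
  | insert a s ha ih =>
    simp only [prod_insert ha]
    exact (h a (mem_insert_self _ _)).mul (ih fun i hi => h i (mem_insert_of_mem hi))

lemma integrable (hf : HasAllMoments P f) : Integrable f P :=
  memLp_one_iff_integrable.1 (hf 1 (by simp))

lemma aeval [IsFiniteMeasure P] (hf : HasAllMoments P f) (p : Polynomial ℤ) :
    HasAllMoments P (fun ω => Polynomial.aeval (f ω) p) := by
  induction p using Polynomial.induction_on with
  | C a => simpa using const _
  | add p q hp hq => simpa using hp.add hq
  | monomial n a h =>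
    have := h.mul hf
    simp only [map_mul, map_pow, Polynomial.aeval_X] at this ⊢
    simpa only [pow_succ, mul_assoc] using this

end HasAllMoments

/-! ### Arrays of standardized Gaussian vectors -/

/-- A finite family of jointly Gaussian vectors in `ℝ^ν`, each with mean zero and identity
covariance matrix. -/
structure IsStdGaussianFamily {Ω J : Type*} [MeasurableSpace Ω] (P : Measure Ω) {ν : ℕ}
    (Y : J → Fin ν → Ω → ℝ) : Prop where
  measurable : ∀ i u, Measurable (Y i u)
  gaussian : HasGaussianLaw (fun ω (a : J × Fin ν) => Y a.1 a.2 ω) P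
  centered : ∀ i u, ∫ ω, Y i u ω ∂P = 0
  std : ∀ i u v, ∫ ω, Y i u ω * Y i v ω ∂P = if u = v then 1 else 0

namespace IsStdGaussianFamily

variable {Ω J : Type*} [MeasurableSpace Ω] {P : Measure Ω} {ν : ℕ} {Y : J → Fin ν → Ω → ℝ}

lemma isProbabilityMeasure (hY : IsStdGaussianFamily P Y) : IsProbabilityMeasure P :=
  hY.gaussian.isProbabilityMeasure

lemma hasAllMoments (hY : IsStdGaussianFamily P Y) (i : J) (u : Fin ν) :
    HasAllMoments P (Y i u) :=
  fun _ hp => (hY.gaussian.eval (i, u)).memLp hp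

lemma hasAllMoments_hermiteProd (hY : IsStdGaussianFamily P Y) (i : J) (k : Fin ν → ℕ) :
    HasAllMoments P (fun ω => hermiteProd k fun u => Y i u ω) := by
  have := hY.isProbabilityMeasure
  exact HasAllMoments.prod fun u _ => (hY.hasAllMoments i u).aeval _

lemma reindex [Finite J] {J' : Type*} [Finite J'] (hY : IsStdGaussianFamily P Y) (e : J' → J) :
    IsStdGaussianFamily P (fun i => Y (e i)) where
  measurable i u := hY.measurable _ _
  gaussian := by
    have := Fintype.ofFinite J
    have := Fintype.ofFinite J'
    let L : (J × Fin ν → ℝ) →L[ℝ] (J' × Fin ν → ℝ) :=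
      ContinuousLinearMap.pi fun a => ContinuousLinearMap.proj (e a.1, a.2)
    exact hY.gaussian.map_fun L
  centered i u := hY.centered _ _
  std i u v := hY.std _ _ _

variable [Fintype J]

/-- Gaussian integration by parts against a product Hermite polynomial. -/
lemma integral_hermiteProd_mul (hY : IsStdGaussianFamily P Y) (i : J) {u : Fin ν}
    {k : Fin ν → ℕ} (hk : 0 < k u) {G G' : (J × Fin ν → ℝ) → ℝ}
    (hG : ∀ y, HasDerivAt
      (fun t : ℝ => G (y + t • fun b => ∫ ω, Y i u ω * Y b.1 b.2 ω ∂P)) (G' y) 0)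
    (hGm : Measurable G) (hGm' : Measurable G')
    (hint : HasAllMoments P (fun ω => G (fun b => Y b.1 b.2 ω)))
    (hint' : HasAllMoments P (fun ω => G' (fun b => Y b.1 b.2 ω))) :
    ∫ ω, hermiteProd k (fun v => Y i v ω) * G (fun b => Y b.1 b.2 ω) ∂P =
      ∫ ω, hermiteProd (k - Pi.single u 1) (fun v => Y i v ω) *
        G' (fun b => Y b.1 b.2 ω) ∂P := by
  set k' := k - Pi.single u 1 with hk'
  let slot : (J × Fin ν → ℝ) → Fin ν → ℝ := fun y v => y (i, v)
  have hslot : Measurable slot := measurable_pi_lambda _ fun v => measurable_pi_apply _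
  have hH : ∀ y : J × Fin ν → ℝ, HasDerivAt
      (fun t : ℝ => hermiteProd k' (slot (y + t • fun b => ∫ ω, Y i u ω * Y b.1 b.2 ω ∂P)))
      (k' u * hermiteProd (k' - Pi.single u 1) (slot y)) 0 := by
    intro y
    have h := hasDerivAt_hermiteProd k' (slot y) (fun v => if u = v then 1 else 0)
    simp only [ite_mul, one_mul, zero_mul, sum_ite_eq, mem_univ, if_true] at h
    refine h.congr_of_eventuallyEq (Eventually.of_forall fun t => ?_)
    simp only
    congr 1
    ext v
    simp [slot, hY.std]
  have m0 := hY.hasAllMoments_hermiteProd i k'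
  have m1 := hY.hasAllMoments_hermiteProd i (k' - Pi.single u 1)
  have mG1 : HasAllMoments P (fun ω => k' u * hermiteProd (k' - Pi.single u 1)
      (fun v => Y i v ω) * G (fun b => Y b.1 b.2 ω)) := (m1.const_mul _).mul hint
  have mG2 := m0.mul hint'
  have hd : ∀ y : J × Fin ν → ℝ, HasDerivAt
      (fun t : ℝ => hermiteProd k' (slot (y + t • fun b => ∫ ω, Y i u ω * Y b.1 b.2 ω ∂P)) *
        G (y + t • fun b => ∫ ω, Y i u ω * Y b.1 b.2 ω ∂P))
      (k' u * hermiteProd (k' - Pi.single u 1) (slot y) * G y +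
        hermiteProd k' (slot y) * G' y) 0 := by
    intro y
    refine ((hH y).mul (hG y)).congr_deriv ?_
    simp only [zero_smul, add_zero]
  have hm1 : Measurable fun y => hermiteProd k' (slot y) * G y :=
    ((measurable_hermiteProd _).comp hslot).mul hGm
  have hm2 : Measurable fun y => k' u * hermiteProd (k' - Pi.single u 1) (slot y) * G y +
        hermiteProd k' (slot y) * G' y :=
    ((((measurable_hermiteProd _).comp hslot).const_mul _).mul hGm).add
      (((measurable_hermiteProd _).comp hslot).mul hGm')
  have hu : ∫ ω, Y i u ω * Y i u ω ∂P = 1 := by simp [hY.std]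
  have key := integral_mul_eq_integral_lineDeriv (Y := fun b : J × Fin ν => Y b.1 b.2)
    (a := (i, u)) hY.gaussian (fun b => hY.measurable _ _) (fun b => hY.centered _ _) hu hd hm1 hm2
    (m0.mul hint).integrable ((hY.hasAllMoments i u).mul (m0.mul hint)).integrable
    (mG1.add mG2).integrable
  simp only [slot] at key
  rw [integral_add mG1.integrable mG2.integrable] at key
  have e : ∀ ω, hermiteProd k (fun v => Y i v ω) * G (fun b => Y b.1 b.2 ω) =
      Y i u ω * (hermiteProd k' (fun v => Y i v ω) * G (fun b => Y b.1 b.2 ω)) -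
      k' u * hermiteProd (k' - Pi.single u 1) (fun v => Y i v ω) *
        G (fun b => Y b.1 b.2 ω) := by
    intro ω
    rw [hermiteProd_eq_of_pos hk]
    ring
  simp only [e]
  rw [integral_sub ((hY.hasAllMoments i u).mul (m0.mul hint)).integrable mG1.integrable, key]
  ring

end IsStdGaussianFamily

/-! ### Moments of products of Hermite polynomials -/

/-- Lower the multiindex of slot `i` by one in coordinate `u`. -/
def lowerIndex {J : Type*} [DecidableEq J] {ν : ℕ} (i : J) (u : Fin ν) (k : J → Fin ν → ℕ) :
    J → Fin ν → ℕ :=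
  k - Pi.single i (Pi.single u 1)

section lowerIndex

variable {J : Type*} [DecidableEq J] {ν : ℕ} {k : J → Fin ν → ℕ} {i j : J} {u v : Fin ν}

lemma lowerIndex_of_ne (h : j ≠ i) : lowerIndex i u k j = k j := by
  simp [lowerIndex, Pi.single_eq_of_ne h]

lemma lowerIndex_self : lowerIndex i u k i = k i - Pi.single u 1 := by
  simp [lowerIndex]

lemma lowerIndex_le : lowerIndex i u k j v ≤ k j v := Nat.sub_le _ _

lemma sum_sub_single (k : Fin ν → ℕ) (hk : 0 < k u) :
    ∑ w, (k - Pi.single u 1 : Fin ν → ℕ) w + 1 = ∑ w, k w := by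
  have : k = (k - Pi.single u 1) + Pi.single u 1 := by
    ext w
    by_cases h : w = u
    · subst h; simp; omega
    · simp [h]
  conv_rhs => rw [this]
  simp [sum_add_distrib]

lemma sum_lowerIndex (hk : 0 < k i u) (a : J) :
    ∑ w, lowerIndex i u k a w + (if a = i then 1 else 0) = ∑ w, k a w := by
  by_cases h : a = i
  · subst h
    rw [lowerIndex_self, if_pos rfl, sum_sub_single _ hk]
  · rw [lowerIndex_of_ne h, if_neg h, add_zero]

lemma sum_sum_lowerIndex [Fintype J] (hk : 0 < k i u) :
    ∑ a, ∑ w, lowerIndex i u k a w + 1 = ∑ a, ∑ w, k a w := by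
  simp_rw [← sum_lowerIndex hk, sum_add_distrib]
  simp

end lowerIndex

/-- The expectation of the product of the Hermite polynomials `hermiteProd (k j) (Y j)` over the
slots `j ∈ S`. -/
def hermiteMoment {Ω J : Type*} [MeasurableSpace Ω] (P : Measure Ω) {ν : ℕ}
    (Y : J → Fin ν → Ω → ℝ) (S : Finset J) (k : J → Fin ν → ℕ) : ℝ :=
  ∫ ω, ∏ j ∈ S, hermiteProd (k j) (fun v => Y j v ω) ∂P

lemma hermiteMoment_congr {Ω J : Type*} [MeasurableSpace Ω] {P : Measure Ω} {ν : ℕ}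
    {Y : J → Fin ν → Ω → ℝ} {S : Finset J} {k k' : J → Fin ν → ℕ} (h : ∀ j ∈ S, k j = k' j) :
    hermiteMoment P Y S k = hermiteMoment P Y S k' := by
  unfold hermiteMoment
  congr 1
  ext ω
  exact prod_congr rfl fun j hj => by rw [h j hj]

/-- A diagram for `k`: a loopless directed multigraph on the slots (with `l i j` edges from `i`
to `j`) in which the degree of slot `i` is the total degree of `k i`. -/
def IsDiagram {J : Type*} [Fintype J] {ν : ℕ} (k : J → Fin ν → ℕ) (l : J → J → ℕ) : Prop :=
  (∀ i, l i i = 0) ∧ ∀ i, ∑ j, (l i j + l j i) = ∑ v, k i v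

section Diagram

variable {J : Type*} [Fintype J] [DecidableEq J]

lemma IsDiagram.add_edge {ν : ℕ} {k : J → Fin ν → ℕ} {l : J → J → ℕ} {i j : J} {u v : Fin ν}
    (hij : j ≠ i) (hi : 0 < k i u) (hj : 0 < k j v)
    (h : IsDiagram (lowerIndex j v (lowerIndex i u k)) l) :
    IsDiagram k (l + Pi.single i (Pi.single j 1)) := by
  refine ⟨fun a => ?_, fun a => ?_⟩
  · rw [Pi.add_apply, Pi.add_apply, h.1 a, zero_add]
    by_cases ha : a = i
    · subst ha; simp [hij.symm]
    · simp [ha]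
  · have hj' : 0 < lowerIndex i u k j v := by rwa [lowerIndex_of_ne hij]
    rw [← sum_lowerIndex hi a, ← sum_lowerIndex hj' a, ← h.2 a]
    simp only [Pi.add_apply, sum_add_distrib]
    have h1 : ∑ b, (Pi.single i (Pi.single j 1) : J → J → ℕ) a b = if a = i then 1 else 0 := by
      by_cases ha : a = i
      · subst ha; simp
      · simp [ha]
    have h2 : ∑ b, (Pi.single i (Pi.single j 1) : J → J → ℕ) b a = if a = j then 1 else 0 := by
      rw [sum_eq_single i (fun b _ hb => by simp [hb]) (by simp)]
      simp [Pi.single_apply]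
    rw [h1, h2]
    ring

lemma prod_pow_add_edge (ρ : J → J → ℝ) (l : J → J → ℕ) (i j : J) :
    ∏ a, ∏ b, ρ a b ^ (l + Pi.single i (Pi.single j 1) : J → J → ℕ) a b =
      ρ i j * ∏ a, ∏ b, ρ a b ^ l a b := by
  simp only [Pi.add_apply, pow_add, prod_mul_distrib]
  rw [mul_comm]
  congr 1
  rw [prod_eq_single i (fun a _ ha => by simp [ha]) (by simp),
    prod_eq_single j (fun b _ hb => by simp [hb]) (by simp)]
  simp

end Diagram

lemma exists_le_card_mul_of_abs_le_sum {ι : Type*} {s : Finset ι} {f : ι → ℝ} {x : ℝ}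
    (hx : x ≠ 0) (h : |x| ≤ ∑ a ∈ s, |f a|) : ∃ a ∈ s, f a ≠ 0 ∧ |x| ≤ #s * |f a| := by
  have hs : s.Nonempty := by
    rw [nonempty_iff_ne_empty]
    rintro rfl
    exact hx (abs_nonpos_iff.1 (by simpa using h))
  obtain ⟨a, ha, hmax⟩ := exists_max_image s (fun a => |f a|) hs
  have hle : |x| ≤ #s * |f a| := by
    refine h.trans ((sum_le_card_nsmul s _ _ hmax).trans_eq ?_)
    rw [nsmul_eq_mul]
  refine ⟨a, ha, fun h0 => hx (abs_nonpos_iff.1 ?_), hle⟩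
  simpa [h0] using hle

namespace IsStdGaussianFamily

variable {Ω J : Type*} [MeasurableSpace Ω] {P : Measure Ω} {ν : ℕ} {Y : J → Fin ν → Ω → ℝ}
  [Fintype J] [DecidableEq J]

lemma hermiteMoment_eq_sum (hY : IsStdGaussianFamily P Y) {S : Finset J} {k : J → Fin ν → ℕ}
    {i : J} (hi : i ∈ S) {u : Fin ν} (hk : 0 < k i u) :
    hermiteMoment P Y S k = ∑ j ∈ S.erase i, ∑ v, (∫ ω, Y i u ω * Y j v ω ∂P) *
      (k j v * hermiteMoment P Y S (lowerIndex j v (lowerIndex i u k))) := by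
  have := hY.isProbabilityMeasure
  let G : (J × Fin ν → ℝ) → ℝ := fun y =>
    ∏ j ∈ S.erase i, hermiteProd (k j) fun v => y (j, v)
  let G' : (J × Fin ν → ℝ) → ℝ := fun y =>
    ∑ j ∈ S.erase i, (∏ j' ∈ (S.erase i).erase j, hermiteProd (k j') fun v => y (j', v)) *
      ∑ v, (∫ ω, Y i u ω * Y j v ω ∂P) *
        (k j v * hermiteProd (k j - Pi.single v 1) fun w => y (j, w))
  have hG : ∀ y : J × Fin ν → ℝ, HasDerivAt
      (fun t : ℝ => G (y + t • fun b => ∫ ω, Y i u ω * Y b.1 b.2 ω ∂P)) (G' y) 0 := by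
    intro y
    have h1 := HasDerivAt.fun_finsetProd (u := S.erase i) fun j _ =>
      hasDerivAt_hermiteProd (k j) (fun v => y (j, v)) fun v => ∫ ω, Y i u ω * Y j v ω ∂P
    simp only [zero_smul, add_zero, smul_eq_mul] at h1
    exact h1
  have hmH : ∀ (κ : Fin ν → ℕ) j, Measurable fun y : J × Fin ν → ℝ =>
      hermiteProd κ fun v => y (j, v) := fun κ j =>
    (measurable_hermiteProd κ).comp (measurable_pi_lambda _ fun v => measurable_pi_apply _)
  have m1 : ∀ j v, HasAllMoments P fun ω =>
      (∏ j' ∈ (S.erase i).erase j, hermiteProd (k j') fun v => Y j' v ω) *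
        ((∫ ω, Y i u ω * Y j v ω ∂P) *
          (k j v * hermiteProd (k j - Pi.single v 1) fun w => Y j w ω)) := fun j v =>
    (HasAllMoments.prod fun _ _ => hY.hasAllMoments_hermiteProd _ _).mul
      (((hY.hasAllMoments_hermiteProd _ _).const_mul _).const_mul _)
  have key := hY.integral_hermiteProd_mul i hk (G := G) (G' := G') hG
    (Finset.measurable_fun_prod _ fun j _ => hmH _ _)
    (Finset.measurable_fun_sum _ fun j _ =>
      (Finset.measurable_fun_prod _ fun j' _ => hmH _ _).mul
        (Finset.measurable_fun_sum _ fun v _ => ((hmH _ _).const_mul _).const_mul _))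
    (HasAllMoments.prod fun _ _ => hY.hasAllMoments_hermiteProd _ _)
    (by
      simp only [G', mul_sum]
      exact HasAllMoments.sum fun j _ => HasAllMoments.sum fun v _ => m1 j v)
  have hL : hermiteMoment P Y S k = ∫ ω, hermiteProd (k i) (fun v => Y i v ω) *
      ∏ j ∈ S.erase i, hermiteProd (k j) fun v => Y j v ω ∂P := by
    unfold hermiteMoment
    congr 1
    ext ω
    exact (mul_prod_erase S _ hi).symm
  rw [hL]
  refine key.trans ?_
  simp only [G', mul_sum]
  rw [integral_finsetSum]
  swap
  · exact fun j _ => (HasAllMoments.sum fun v _ =>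
      (hY.hasAllMoments_hermiteProd _ _).mul (m1 j v)).integrable
  refine sum_congr rfl fun j hj => ?_
  rw [integral_finsetSum]
  swap
  · exact fun v _ => ((hY.hasAllMoments_hermiteProd _ _).mul (m1 j v)).integrable
  refine sum_congr rfl fun v _ => ?_
  rw [hermiteMoment, ← integral_const_mul, ← integral_const_mul]
  congr 1
  ext ω
  rw [← mul_prod_erase S _ hi, ← mul_prod_erase (S.erase i) _ hj]
  have hji := ne_of_mem_erase hj
  rw [lowerIndex_of_ne hji.symm, lowerIndex_self, lowerIndex_self, lowerIndex_of_ne hji]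
  have : ∏ x ∈ (S.erase i).erase j,
      hermiteProd (lowerIndex j v (lowerIndex i u k) x) (fun v => Y x v ω) =
      ∏ x ∈ (S.erase i).erase j, hermiteProd (k x) (fun v => Y x v ω) := by
    refine prod_congr rfl fun x hx => ?_
    rw [lowerIndex_of_ne (ne_of_mem_erase hx),
      lowerIndex_of_ne (ne_of_mem_erase (mem_of_mem_erase hx))]
  rw [this]
  ring

/-- One step of the diagram bound. -/
lemma exists_diagram_of_sum {ρ : J → J → ℝ}
    (hρ : ∀ i j u v, |∫ ω, Y i u ω * Y j v ω ∂P| ≤ ρ i j) {D : ℕ} {k : J → Fin ν → ℕ}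
    (hD : ∀ j v, k j v ≤ D) {i : J} {u : Fin ν} (hk : 0 < k i u) {x : ℝ} (hx : x ≠ 0)
    {F : J → Fin ν → ℝ}
    (hsum : x = ∑ j ∈ univ.erase i, ∑ v, (∫ ω, Y i u ω * Y j v ω ∂P) * (k j v * F j v))
    {Q : J → (J → J → ℕ) → Prop}
    (hF : ∀ j ∈ univ.erase i, ∀ v, 0 < k j v → F j v ≠ 0 →
      ∃ l, IsDiagram (lowerIndex j v (lowerIndex i u k)) l ∧ Q j l ∧
        |F j v| ≤ (Fintype.card J * ν * D + 1 : ℝ) ^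
          (∑ a, ∑ w, lowerIndex j v (lowerIndex i u k) a w) * ∏ a, ∏ b, ρ a b ^ l a b) :
    ∃ j ≠ i, ∃ l, IsDiagram k (l + Pi.single i (Pi.single j 1)) ∧ Q j l ∧
      |x| ≤ (Fintype.card J * ν * D + 1 : ℝ) ^ (∑ a, ∑ w, k a w) *
        ∏ a, ∏ b, ρ a b ^ (l + Pi.single i (Pi.single j 1) : J → J → ℕ) a b := by
  rw [← sum_product'] at hsum
  obtain ⟨⟨j, v⟩, hjv, hne, hle⟩ := exists_le_card_mul_of_abs_le_sum hx
    (hsum ▸ abs_sum_le_sum_abs _ _)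
  obtain ⟨hj, -⟩ := mem_product.1 hjv
  simp only at hj hne hle
  have hkj : 0 < k j v := Nat.pos_of_ne_zero fun h0 => hne (by simp [h0])
  have hFn : F j v ≠ 0 := fun h0 => hne (by simp [h0])
  have hji : j ≠ i := ne_of_mem_erase hj
  obtain ⟨l, hl, hQ, hb⟩ := hF j hj v hkj hFn
  refine ⟨j, hji, l, hl.add_edge hji hk hkj, hQ, hle.trans ?_⟩
  rw [prod_pow_add_edge]
  set B : ℝ := Fintype.card J * ν * D + 1 with hB
  set N' := ∑ a, ∑ w, lowerIndex j v (lowerIndex i u k) a w with hN'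
  have hN : ∑ a, ∑ w, k a w = N' + 1 + 1 := by
    rw [← sum_sum_lowerIndex hk, ← sum_sum_lowerIndex (i := j) (u := v)
      (by rwa [lowerIndex_of_ne hji])]
  have hρ0 : ∀ a b, 0 ≤ ρ a b := fun a b => (abs_nonneg _).trans (hρ a b u u)
  have hπ : 0 ≤ ∏ a, ∏ b, ρ a b ^ l a b :=
    prod_nonneg fun a _ => prod_nonneg fun b _ => pow_nonneg (hρ0 a b) _
  have hB0 : 0 ≤ (Fintype.card J * ν * D : ℝ) := by positivity
  have hB1 : 1 ≤ B := by rw [hB]; linarith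
  have hcard : (#(univ.erase i ×ˢ (univ : Finset (Fin ν))) : ℝ) ≤ Fintype.card J * ν := by
    rw [card_product, card_univ, Fintype.card_fin]
    push_cast
    gcongr
    exact_mod_cast card_le_card (erase_subset _ _)
  have hD' : (k j v : ℝ) ≤ D := by exact_mod_cast hD j v
  rw [abs_mul, abs_mul, Nat.abs_cast, hN]
  calc _ ≤ (Fintype.card J * ν : ℝ) * (ρ i j * (D * (B ^ N' * ∏ a, ∏ b, ρ a b ^ l a b))) := by
        gcongr
        · exact hρ0 _ _
        · exact hρ _ _ _ _
    _ = (Fintype.card J * ν * D) * (B ^ N' * (ρ i j * ∏ a, ∏ b, ρ a b ^ l a b)) := by ring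
    _ ≤ (B * B) * (B ^ N' * (ρ i j * ∏ a, ∏ b, ρ a b ^ l a b)) := by
        have : (Fintype.card J * ν * D : ℝ) ≤ B * B := by nlinarith
        have h2 : 0 ≤ ρ i j := hρ0 _ _
        gcongr
    _ = _ := by ring

/-- **Diagram bound** for moments of products of Hermite polynomials. -/
lemma exists_diagram_bound (hY : IsStdGaussianFamily P Y) {ρ : J → J → ℝ}
    (hρ : ∀ i j u v, |∫ ω, Y i u ω * Y j v ω ∂P| ≤ ρ i j) {D : ℕ} {k : J → Fin ν → ℕ}
    (hD : ∀ j v, k j v ≤ D) (hx : hermiteMoment P Y univ k ≠ 0) :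
    ∃ l, IsDiagram k l ∧ |hermiteMoment P Y univ k| ≤
      (Fintype.card J * ν * D + 1 : ℝ) ^ (∑ a, ∑ w, k a w) * ∏ a, ∏ b, ρ a b ^ l a b := by
  have := hY.isProbabilityMeasure
  induction hN : ∑ a, ∑ w, k a w using Nat.strong_induction_on generalizing k with
  | _ N ih =>
  by_cases h0 : ∃ i u, 0 < k i u
  · obtain ⟨i, u, hk⟩ := h0
    obtain ⟨j, -, l, h1, -, h2⟩ := exists_diagram_of_sum (Q := fun _ _ => True) hρ hD hk hx
      (hY.hermiteMoment_eq_sum (mem_univ i) hk) (by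
        intro j hj v hkj hne
        have e1 := sum_sum_lowerIndex hk
        have e2 := sum_sum_lowerIndex (i := j) (u := v) (k := lowerIndex i u k)
          (by rwa [lowerIndex_of_ne (ne_of_mem_erase hj)])
        obtain ⟨l, hl, hb⟩ := ih _ (by omega)
          (fun a w => (lowerIndex_le.trans lowerIndex_le).trans (hD a w)) hne rfl
        exact ⟨l, hl, trivial, hb⟩)
    exact ⟨_, h1, hN ▸ h2⟩
  · push Not at h0
    have hk0 : k = 0 := by ext a w; exact Nat.le_zero.1 (h0 a w)
    subst hk0
    refine ⟨0, ⟨by simp, by simp⟩, ?_⟩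
    simp at hN
    subst hN
    simp [hermiteMoment, hermiteProd_zero]

/-- **Diagram bound** for covariances of products of Hermite polynomials: only diagrams with an
edge between the two groups of slots contribute. -/
lemma exists_crossing_diagram_bound (hY : IsStdGaussianFamily P Y) {ρ : J → J → ℝ}
    (hρ : ∀ i j u v, |∫ ω, Y i u ω * Y j v ω ∂P| ≤ ρ i j) (A : Finset J) {D : ℕ}
    {k : J → Fin ν → ℕ} (hD : ∀ j v, k j v ≤ D)
    (hx : hermiteMoment P Y univ k - hermiteMoment P Y A k * hermiteMoment P Y Aᶜ k ≠ 0) :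
    ∃ l, IsDiagram k l ∧ (∃ i ∈ A, ∃ j ∉ A, 0 < l i j) ∧
      |hermiteMoment P Y univ k - hermiteMoment P Y A k * hermiteMoment P Y Aᶜ k| ≤
      (Fintype.card J * ν * D + 1 : ℝ) ^ (∑ a, ∑ w, k a w) * ∏ a, ∏ b, ρ a b ^ l a b := by
  have := hY.isProbabilityMeasure
  induction hN : ∑ a, ∑ w, k a w using Nat.strong_induction_on generalizing k with
  | _ N ih =>
  by_cases h0 : ∃ i ∈ A, ∃ u, 0 < k i u
  · obtain ⟨i, hi, u, hk⟩ := h0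
    let F : J → Fin ν → ℝ := fun j v =>
      if j ∈ A then hermiteMoment P Y univ (lowerIndex j v (lowerIndex i u k)) -
        hermiteMoment P Y A (lowerIndex j v (lowerIndex i u k)) *
          hermiteMoment P Y Aᶜ (lowerIndex j v (lowerIndex i u k))
      else hermiteMoment P Y univ (lowerIndex j v (lowerIndex i u k))
    have hsum : hermiteMoment P Y univ k - hermiteMoment P Y A k * hermiteMoment P Y Aᶜ k =
        ∑ j ∈ univ.erase i, ∑ v, (∫ ω, Y i u ω * Y j v ω ∂P) * (k j v * F j v) := by
      rw [hY.hermiteMoment_eq_sum (mem_univ i) hk, hY.hermiteMoment_eq_sum hi hk]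
      have hA : A.erase i = (univ.erase i).filter (· ∈ A) := by ext; simp
      rw [hA, sum_filter, sum_mul, ← sum_sub_distrib]
      refine sum_congr rfl fun j _ => ?_
      by_cases hj : j ∈ A
      · simp only [F, hj, if_true]
        rw [sum_mul, ← sum_sub_distrib]
        refine sum_congr rfl fun v _ => ?_
        have : hermiteMoment P Y Aᶜ (lowerIndex j v (lowerIndex i u k)) =
            hermiteMoment P Y Aᶜ k := by
          refine hermiteMoment_congr fun a ha => ?_
          have ha := mem_compl.1 ha
          rw [lowerIndex_of_ne (by rintro rfl; exact ha hj),
            lowerIndex_of_ne (by rintro rfl; exact ha hi)]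
        rw [this]
        ring
      · simp [F, hj]
    obtain ⟨j, hji, l, h1, hQ, h2⟩ := exists_diagram_of_sum
      (Q := fun j l => j ∈ A → ∃ a ∈ A, ∃ b ∉ A, 0 < l a b) hρ hD hk hx hsum (by
        intro j hj v hkj hne
        have hD' : ∀ a w, lowerIndex j v (lowerIndex i u k) a w ≤ D :=
          fun a w => (lowerIndex_le.trans lowerIndex_le).trans (hD a w)
        by_cases hjA : j ∈ A
        · have e1 := sum_sum_lowerIndex hk
          have e2 := sum_sum_lowerIndex (i := j) (u := v) (k := lowerIndex i u k)
            (by rwa [lowerIndex_of_ne (ne_of_mem_erase hj)])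
          simp only [F, hjA, if_true] at hne ⊢
          obtain ⟨l, hl, hQ, hb⟩ := ih _ (by omega) hD' hne rfl
          exact ⟨l, hl, fun _ => hQ, hb⟩
        · simp only [F, hjA, if_false] at hne ⊢
          obtain ⟨l, hl, hb⟩ := hY.exists_diagram_bound hρ hD' hne
          exact ⟨l, hl, fun h => h.elim, hb⟩)
    refine ⟨_, h1, ?_, hN ▸ h2⟩
    by_cases hjA : j ∈ A
    · obtain ⟨a, ha, b, hb, hab⟩ := hQ hjA
      exact ⟨a, ha, b, hb, hab.trans_le (Nat.le_add_right _ _)⟩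
    · exact ⟨i, hi, j, hjA, by simp⟩
  · push Not at h0
    exfalso
    refine hx ?_
    have hA : ∀ j ∈ A, k j = 0 := fun j hj => by ext w; exact Nat.le_zero.1 (h0 j hj w)
    have e1 : hermiteMoment P Y A k = 1 := by
      rw [hermiteMoment_congr (k' := 0) hA]
      simp [hermiteMoment, hermiteProd_zero]
    have e2 : hermiteMoment P Y univ k = hermiteMoment P Y Aᶜ k := by
      unfold hermiteMoment
      congr 1
      ext ω
      rw [← prod_mul_prod_compl A, prod_eq_one fun j hj => by rw [hA j hj, hermiteProd_zero],
        one_mul]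
    rw [e1, e2, one_mul, sub_self]

end IsStdGaussianFamily

/-! ### Weights of diagrams on four slots -/

lemma pow_mul_pow_le_young {x w lam : ℝ} (hx : 0 ≤ x) (hw : 0 ≤ w) (h0 : 0 < lam) (h1 : lam ≤ 1)
    {r s : ℕ} (hr : 1 ≤ r) :
    x ^ r * w ^ s ≤ lam⁻¹ ^ (r + s) * x ^ (r + s) + lam * w ^ (r + s) := by
  have hi : 1 ≤ lam⁻¹ := (one_le_inv₀ h0).2 h1
  rcases le_total x (lam * w) with h | h
  · have h2 : x ^ r * w ^ s ≤ lam * w ^ (r + s) := by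
      calc x ^ r * w ^ s ≤ (lam * w) ^ r * w ^ s := by gcongr
        _ = lam ^ r * w ^ (r + s) := by ring
        _ ≤ lam * w ^ (r + s) := by
          gcongr
          exact pow_le_of_le_one h0.le h1 (by omega)
    have : 0 ≤ lam⁻¹ ^ (r + s) * x ^ (r + s) := by positivity
    linarith
  · have h3 : w ≤ lam⁻¹ * x := by
      rw [inv_mul_eq_div, le_div_iff₀ h0]; linarith
    have h2 : x ^ r * w ^ s ≤ lam⁻¹ ^ (r + s) * x ^ (r + s) := by
      calc x ^ r * w ^ s ≤ x ^ r * (lam⁻¹ * x) ^ s := by gcongr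
        _ = lam⁻¹ ^ s * x ^ (r + s) := by ring
        _ ≤ lam⁻¹ ^ (r + s) * x ^ (r + s) := by
          gcongr
          omega
    have : 0 ≤ lam * w ^ (r + s) := by positivity
    linarith

/-- A four-edge product is either supported on nearby pairs, or dominated by small multiples of
the products of opposite edges and by products with one far edge. -/
lemma mul_pow_mul_mul_pow_le {p₁ p₂ q₁ q₂ lam : ℝ} (hp₁ : p₁ ∈ Set.Icc (0 : ℝ) 1)
    (hp₂ : p₂ ∈ Set.Icc (0 : ℝ) 1) (hq₁ : q₁ ∈ Set.Icc (0 : ℝ) 1) (hq₂ : q₂ ∈ Set.Icc (0 : ℝ) 1)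
    (h0 : 0 < lam) (h1 : lam ≤ 1) {r s m : ℕ} (hr : 1 ≤ r) (hs : 1 ≤ s) (hm : m ≤ r + s)
    (P₁ P₂ Q₁ Q₂ : Prop) [Decidable P₁] [Decidable P₂] [Decidable Q₁] [Decidable Q₂] :
    (p₁ * p₂) ^ r * (q₁ * q₂) ^ s ≤
      (if P₁ then 1 else 0) * (if Q₁ then 1 else 0) * (if Q₂ then 1 else 0) +
      lam⁻¹ ^ (r + s) * ((if P₁ then 0 else p₁ ^ m) * p₂ ^ m +
        p₁ ^ m * (if P₂ then 0 else p₂ ^ m)) +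
      lam⁻¹ ^ (r + s) * ((if Q₁ then 0 else q₁ ^ m) * q₂ ^ m +
        q₁ ^ m * (if Q₂ then 0 else q₂ ^ m)) +
      lam * (p₁ ^ m * p₂ ^ m + q₁ ^ m * q₂ ^ m) := by
  obtain ⟨hp₁, hp₁'⟩ := hp₁
  obtain ⟨hp₂, hp₂'⟩ := hp₂
  obtain ⟨hq₁, hq₁'⟩ := hq₁
  obtain ⟨hq₂, hq₂'⟩ := hq₂
  set L := lam⁻¹ ^ (r + s) with hL
  have hL0 : 0 ≤ L := by positivity
  set x := p₁ * p₂ with hx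
  set w := q₁ * q₂ with hw
  have hx0 : 0 ≤ x := mul_nonneg hp₁ hp₂
  have hw0 : 0 ≤ w := mul_nonneg hq₁ hq₂
  have hx1 : x ≤ 1 := mul_le_one₀ hp₁' hp₂ hp₂'
  have hw1 : w ≤ 1 := mul_le_one₀ hq₁' hq₂ hq₂'
  have ex : x ^ (r + s) ≤ p₁ ^ m * p₂ ^ m := by
    rw [← mul_pow]; exact pow_le_pow_of_le_one hx0 hx1 hm
  have ew : w ^ (r + s) ≤ q₁ ^ m * q₂ ^ m := by
    rw [← mul_pow]; exact pow_le_pow_of_le_one hw0 hw1 hm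
  have y1 : x ^ r * w ^ s ≤ L * (p₁ ^ m * p₂ ^ m) + lam * (q₁ ^ m * q₂ ^ m) :=
    (pow_mul_pow_le_young hx0 hw0 h0 h1 hr).trans (by gcongr)
  have y2 : x ^ r * w ^ s ≤ L * (q₁ ^ m * q₂ ^ m) + lam * (p₁ ^ m * p₂ ^ m) := by
    have := pow_mul_pow_le_young (s := r) hw0 hx0 h0 h1 hs
    rw [add_comm s r, mul_comm] at this
    exact this.trans (by gcongr)
  have y3 : x ^ r * w ^ s ≤ 1 := mul_le_one₀ (pow_le_one₀ hx0 hx1) (by positivity)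
    (pow_le_one₀ hw0 hw1)
  have a1 : 0 ≤ p₁ ^ m * p₂ ^ m := by positivity
  have a2 : 0 ≤ q₁ ^ m * q₂ ^ m := by positivity
  have b1 : 0 ≤ L * (p₁ ^ m * p₂ ^ m) := by positivity
  have b2 : 0 ≤ L * (q₁ ^ m * q₂ ^ m) := by positivity
  have b3 : 0 ≤ lam * (p₁ ^ m * p₂ ^ m) := by positivity
  have b4 : 0 ≤ lam * (q₁ ^ m * q₂ ^ m) := by positivity
  split_ifs <;> simp only [mul_add, mul_zero, zero_mul, mul_one, add_zero, zero_add] <;> linarith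

lemma le_add_inv_pow_mul_pow {x lam : ℝ} (hx : 0 ≤ x) (hx1 : x ≤ 1) (h0 : 0 < lam) (m : ℕ) :
    x ≤ lam + lam⁻¹ ^ m * x ^ m := by
  rcases le_total x lam with h | h
  · have : 0 ≤ lam⁻¹ ^ m * x ^ m := by positivity
    linarith
  · have h1 : 1 ≤ lam⁻¹ * x := by rw [inv_mul_eq_div, le_div_iff₀ h0]; linarith
    have := one_le_pow₀ h1 (n := m)
    rw [mul_pow] at this
    linarith

lemma diagram_weight_cases {ν : ℕ} {k : Fin 4 → Fin ν → ℕ} {l : Fin 4 → Fin 4 → ℕ}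
    (hl : IsDiagram k l) (hcross : ∃ i ∈ ({0, 1} : Finset (Fin 4)), ∃ j ∉ ({0, 1} : Finset (Fin 4)),
      0 < l i j)
    (h02 : k 2 = k 0) (h13 : k 3 = k 1) {ρ : Fin 4 → Fin 4 → ℝ}
    (hsymm : ∀ i j, ρ i j = ρ j i) (hρ : ∀ i j, ρ i j ∈ Set.Icc (0 : ℝ) 1) :
    ρ 0 1 * ρ 2 3 * ∏ a, ∏ b, ρ a b ^ l a b ≤
        (ρ 0 1 * ρ 2 3) ^ (min (∑ v, k 0 v) (∑ v, k 1 v) + 1) * (ρ 0 2 + ρ 1 3) ∨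
      ∃ r s, 1 ≤ r ∧ 1 ≤ s ∧ r + s = min (∑ v, k 0 v) (∑ v, k 1 v) + 1 ∧
        ρ 0 1 * ρ 2 3 * ∏ a, ∏ b, ρ a b ^ l a b ≤
          (ρ 0 1 * ρ 2 3) ^ r * (ρ 0 2 * ρ 1 3) ^ s +
          (ρ 0 1 * ρ 2 3) ^ r * (ρ 0 3 * ρ 1 2) ^ s := by
  obtain ⟨hl0, hld⟩ := hl
  have d0 := hld 0
  have d1 := hld 1
  have d2 := hld 2
  have d3 := hld 3
  rw [h02] at d2
  rw [h13] at d3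
  simp only [Fin.sum_univ_four, hl0] at d0 d1 d2 d3
  set p := ∑ v, k 0 v
  set q := ∑ v, k 1 v
  have hprod : ∏ a, ∏ b, ρ a b ^ l a b =
      ρ 0 1 ^ (l 0 1 + l 1 0) * ρ 0 2 ^ (l 0 2 + l 2 0) * ρ 0 3 ^ (l 0 3 + l 3 0) *
      ρ 1 2 ^ (l 1 2 + l 2 1) * ρ 1 3 ^ (l 1 3 + l 3 1) * ρ 2 3 ^ (l 2 3 + l 3 2) := by
    simp only [Fin.prod_univ_four, hl0, pow_zero, hsymm 1 0, hsymm 2 0, hsymm 2 1, hsymm 3 0,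
      hsymm 3 1, hsymm 3 2, pow_add]
    ring
  have hcr : 0 < (l 0 2 + l 2 0) + (l 0 3 + l 3 0) + (l 1 2 + l 2 1) + (l 1 3 + l 3 1) := by
    obtain ⟨i, hi, j, hj, hij⟩ := hcross
    fin_cases i <;> fin_cases j <;> simp at hi hj hij <;> omega
  rw [hprod]
  have h1 : l 1 2 + l 2 1 = l 0 3 + l 3 0 := by omega
  have h2 : l 2 3 + l 3 2 = l 0 1 + l 1 0 := by omega
  have h3 : p = (l 0 1 + l 1 0) + (l 0 2 + l 2 0) + (l 0 3 + l 3 0) := by omega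
  have h4 : q = (l 0 1 + l 1 0) + (l 0 3 + l 3 0) + (l 1 3 + l 3 1) := by omega
  rw [h1, h2, h3, h4]
  rw [h1] at hcr
  clear d0 d1 d2 d3 h1 h2 h3 h4 hprod
  generalize l 0 1 + l 1 0 = a at *
  generalize l 0 2 + l 2 0 = b at *
  generalize l 0 3 + l 3 0 = g at *
  generalize l 1 3 + l 3 1 = d at *
  have n01 := (hρ 0 1).1
  have n02 := (hρ 0 2).1
  have n03 := (hρ 0 3).1
  have n12 := (hρ 1 2).1
  have n13 := (hρ 1 3).1
  have n23 := (hρ 2 3).1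
  set x := ρ 0 1 * ρ 2 3 with hx
  have hx0 : 0 ≤ x := mul_nonneg n01 n23
  have hL : x * (ρ 0 1 ^ a * ρ 0 2 ^ b * ρ 0 3 ^ g * ρ 1 2 ^ g * ρ 1 3 ^ d * ρ 2 3 ^ a) =
      x ^ (a + 1) * (ρ 0 2 ^ b * ρ 1 3 ^ d * (ρ 0 3 * ρ 1 2) ^ g) := by
    rw [hx]; ring
  rw [hL]
  by_cases hs : min b d + g = 0
  · left
    obtain rfl : g = 0 := by omega
    have hN : min (a + b + 0) (a + 0 + d) + 1 = a + 1 := by omega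
    rw [hN, pow_zero, mul_one]
    refine mul_le_mul_of_nonneg_left ?_ (by positivity)
    rcases Nat.eq_zero_or_pos b with rfl | hb
    · have := pow_le_of_le_one n13 (hρ 1 3).2 (show d ≠ 0 by omega)
      rw [pow_zero, one_mul]
      linarith
    · obtain rfl : d = 0 := by omega
      have := pow_le_of_le_one n02 (hρ 0 2).2 hb.ne'
      rw [pow_zero, mul_one]
      linarith
  · right
    refine ⟨a + 1, min b d + g, by omega, by omega, by omega, ?_⟩
    rw [← mul_add]
    refine mul_le_mul_of_nonneg_left ?_ (by positivity)
    set y := ρ 0 2 * ρ 1 3 with hy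
    set z := ρ 0 3 * ρ 1 2 with hz
    have hy0 : 0 ≤ y := mul_nonneg n02 n13
    have hz0 : 0 ≤ z := mul_nonneg n03 n12
    calc ρ 0 2 ^ b * ρ 1 3 ^ d * z ^ g ≤ ρ 0 2 ^ min b d * ρ 1 3 ^ min b d * z ^ g := by
          gcongr ?_ * ?_ * _
          · exact pow_le_pow_of_le_one n02 (hρ 0 2).2 (min_le_left _ _)
          · exact pow_le_pow_of_le_one n13 (hρ 1 3).2 (min_le_right _ _)
      _ = y ^ min b d * z ^ g := by rw [hy, mul_pow (ρ 0 2)]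
      _ ≤ _ := by
        rcases le_total y z with h | h
        · have h5 : y ^ min b d * z ^ g ≤ z ^ min b d * z ^ g := by gcongr
          rw [← pow_add] at h5
          have : 0 ≤ y ^ (min b d + g) := by positivity
          linarith
        · have h5 : y ^ min b d * z ^ g ≤ y ^ min b d * y ^ g := by gcongr
          rw [← pow_add] at h5
          have : 0 ≤ z ^ (min b d + g) := by positivity
          linarith

/-! ### Summing the weights -/

section FourSums

variable {J : Type*} [Fintype J]

lemma sum_mul_sum_adjacent (f g : J → J → ℝ) :
    ∑ a, ∑ b, ∑ c, ∑ d, f a b * g c d = (∑ a, ∑ b, f a b) * ∑ a, ∑ b, g a b := by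
  simp_rw [← mul_sum, ← sum_mul]

lemma sum_mul_sum_alternating (f g : J → J → ℝ) :
    ∑ a, ∑ b, ∑ c, ∑ d, f a c * g b d = (∑ a, ∑ b, f a b) * ∑ a, ∑ b, g a b := by
  rw [← sum_mul_sum_adjacent]
  exact sum_congr rfl fun a _ => sum_comm

lemma sum_mul_sum_nested (f g : J → J → ℝ) :
    ∑ a, ∑ b, ∑ c, ∑ d, f a d * g b c = (∑ a, ∑ b, f a b) * ∑ a, ∑ b, g a b := by
  rw [← sum_mul_sum_alternating]
  exact sum_congr rfl fun a _ => sum_congr rfl fun b _ => sum_comm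

lemma sum_four_const_mul (x : ℝ) (F : J → J → J → J → ℝ) :
    ∑ a, ∑ b, ∑ c, ∑ d, x * F a b c d = x * ∑ a, ∑ b, ∑ c, ∑ d, F a b c d := by
  simp_rw [mul_sum]

end FourSums

/-- A symmetric matrix of correlation bounds whose `m`-th powers have row sums at most `C` and
put mass at most `δ` per row on the pairs that are not `near`, each row having at most `κ`
nearby entries. -/
structure IsShortRange {J : Type*} [Fintype J] (ρ : J → J → ℝ) (near : J → J → Prop)
    [DecidableRel near] (m : ℕ) (C δ κ : ℝ) : Prop where
  symm : ∀ a b, ρ a b = ρ b a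
  mem_Icc : ∀ a b, ρ a b ∈ Set.Icc (0 : ℝ) 1
  row : ∀ a, ∑ b, ρ a b ^ m ≤ C
  far : ∑ a, ∑ b, (if near a b then 0 else ρ a b ^ m) ≤ δ * Fintype.card J
  near_card : ∀ a, ∑ b, (if near a b then 1 else 0) ≤ κ

/-- A majorant for the weights of all crossing diagrams on the slots `a, b | c, d`. -/
def diagramMajorant {J : Type*} (ρ : J → J → ℝ) (near : J → J → Prop) [DecidableRel near]
    (m : ℕ) (lam L : ℝ) (a b c d : J) : ℝ :=
  ρ a b ^ m * ρ c d ^ m * (ρ a c + ρ b d) +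
    ((if near a b then 1 else 0) * (if near a c then 1 else 0) * (if near b d then 1 else 0) +
      L * ((if near a b then 0 else ρ a b ^ m) * ρ c d ^ m +
        ρ a b ^ m * (if near c d then 0 else ρ c d ^ m)) +
      L * ((if near a c then 0 else ρ a c ^ m) * ρ b d ^ m +
        ρ a c ^ m * (if near b d then 0 else ρ b d ^ m)) +
      lam * (ρ a b ^ m * ρ c d ^ m + ρ a c ^ m * ρ b d ^ m)) +
    ((if near a b then 1 else 0) * (if near a d then 1 else 0) * (if near b c then 1 else 0) +
      L * ((if near a b then 0 else ρ a b ^ m) * ρ c d ^ m +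
        ρ a b ^ m * (if near c d then 0 else ρ c d ^ m)) +
      L * ((if near a d then 0 else ρ a d ^ m) * ρ b c ^ m +
        ρ a d ^ m * (if near b c then 0 else ρ b c ^ m)) +
      lam * (ρ a b ^ m * ρ c d ^ m + ρ a d ^ m * ρ b c ^ m))

namespace IsShortRange

variable {J : Type*} [Fintype J] {ρ : J → J → ℝ} {near : J → J → Prop} [DecidableRel near]
  {m : ℕ} {C δ κ : ℝ}

lemma diagramMajorant_nonneg (h : IsShortRange ρ near m C δ κ) {lam L : ℝ} (h0 : 0 ≤ lam)
    (hL : 0 ≤ L) (a b c d : J) : 0 ≤ diagramMajorant ρ near m lam L a b c d := by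
  have n : ∀ a b, 0 ≤ ρ a b := fun a b => (h.mem_Icc a b).1
  have n1 := n a b
  have n2 := n a c
  have n3 := n a d
  have n4 := n b c
  have n5 := n b d
  have n6 := n c d
  unfold diagramMajorant
  positivity

lemma sum_le (h : IsShortRange ρ near m C δ κ) {lam : ℝ} (h0 : 0 < lam) :
    ∑ a, ∑ b, ρ a b ≤ lam * Fintype.card J ^ 2 + lam⁻¹ ^ m * (C * Fintype.card J) := by
  calc ∑ a, ∑ b, ρ a b ≤ ∑ a, ∑ b, (lam + lam⁻¹ ^ m * ρ a b ^ m) :=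
        sum_le_sum fun a _ => sum_le_sum fun b _ =>
          le_add_inv_pow_mul_pow (h.mem_Icc a b).1 (h.mem_Icc a b).2 h0 m
    _ = lam * Fintype.card J ^ 2 + lam⁻¹ ^ m * ∑ a, ∑ b, ρ a b ^ m := by
        simp_rw [sum_add_distrib, ← mul_sum]
        simp only [sum_const, card_univ, nsmul_eq_mul]
        ring
    _ ≤ lam * Fintype.card J ^ 2 + lam⁻¹ ^ m * ∑ _a : J, C := by
        gcongr with a _
        exact h.row a
    _ = _ := by
        simp only [sum_const, card_univ, nsmul_eq_mul]
        ring

lemma sum_diagramMajorant_le (h : IsShortRange ρ near m C δ κ) (hC : 0 ≤ C) (hδ : 0 ≤ δ)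
    (hκ : 0 ≤ κ) {lam L : ℝ} (h0 : 0 < lam) (hL : 0 ≤ L) :
    ∑ a, ∑ b, ∑ c, ∑ d, diagramMajorant ρ near m lam L a b c d ≤
      2 * (C ^ 2 * (lam * Fintype.card J ^ 2 + lam⁻¹ ^ m * (C * Fintype.card J))) +
      2 * (κ ^ 3 * Fintype.card J + 4 * (L * (δ * C)) * Fintype.card J ^ 2 +
        2 * (lam * C ^ 2) * Fintype.card J ^ 2) := by
  set n : ℝ := (Fintype.card J : ℝ) with hn
  have hn0 : 0 ≤ n := by positivity
  set f : J → J → ℝ := fun a b => ρ a b ^ m with hf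
  set g : J → J → ℝ := fun a b => if near a b then 0 else ρ a b ^ m with hg
  set e : J → J → ℝ := fun a b => if near a b then 1 else 0 with he
  have hρ0 : ∀ a b, 0 ≤ ρ a b := fun a b => (h.mem_Icc a b).1
  have hf0 : ∀ a b, 0 ≤ f a b := fun a b => pow_nonneg (hρ0 a b) m
  have he0 : ∀ a b, 0 ≤ e a b := fun a b => by simp only [he]; split_ifs <;> norm_num
  have hg0 : ∀ a b, 0 ≤ g a b := fun a b => by
    simp only [hg]
    split_ifs
    exacts [le_rfl, hf0 a b]
  have hfs : ∀ a b, f a b = f b a := fun a b => by simp only [hf, h.symm a b]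
  have hrow : ∀ a, ∑ b, f a b ≤ C := h.row
  have hF : ∑ a, ∑ b, f a b ≤ C * n := by
    refine (sum_le_sum fun a _ => hrow a).trans_eq ?_
    simp [hn, mul_comm]
  have hF0 : 0 ≤ ∑ a, ∑ b, f a b := sum_nonneg fun a _ => sum_nonneg fun b _ => hf0 a b
  have hH : ∑ a, ∑ b, g a b ≤ δ * n := h.far
  have hH0 : 0 ≤ ∑ a, ∑ b, g a b := sum_nonneg fun a _ => sum_nonneg fun b _ => hg0 a b
  have hR := h.sum_le h0
  rw [← hn] at hR
  have t1 : ∑ a, ∑ b, ∑ c, ∑ d, f a b * f c d * ρ a c ≤ C ^ 2 * ∑ a, ∑ b, ρ a b := by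
    calc _ = ∑ a, ∑ c, (∑ b, f a b) * (∑ d, f c d) * ρ a c := by
          refine sum_congr rfl fun a _ => ?_
          rw [sum_comm]
          refine sum_congr rfl fun c _ => ?_
          simp_rw [sum_mul_sum, sum_mul]
      _ ≤ ∑ a, ∑ c, C * C * ρ a c := by
          gcongr with a _ c _
          · exact hρ0 a c
          · exact sum_nonneg fun d _ => hf0 c d
          · exact hrow a
          · exact hrow c
      _ = _ := by simp_rw [← mul_sum]; ring
  have t2 : ∑ a, ∑ b, ∑ c, ∑ d, f a b * f c d * ρ b d ≤ C ^ 2 * ∑ a, ∑ b, ρ a b := by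
    refine le_trans (le_of_eq ?_) t1
    rw [sum_comm]
    refine sum_congr rfl fun b _ => sum_congr rfl fun a _ => ?_
    rw [sum_comm]
    refine sum_congr rfl fun d _ => sum_congr rfl fun c _ => ?_
    rw [hfs a b, hfs c d]
  have t3 : ∑ a, ∑ b, ∑ c, ∑ d, e a b * e a c * e b d ≤ κ ^ 3 * n := by
    calc _ = ∑ a, ∑ b, e a b * (∑ c, e a c) * (∑ d, e b d) := by
          refine sum_congr rfl fun a _ => sum_congr rfl fun b _ => ?_
          rw [mul_assoc, sum_mul_sum, mul_sum]
          simp_rw [mul_sum, mul_assoc]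
      _ ≤ ∑ a, ∑ b, e a b * κ * κ := sum_le_sum fun a _ => sum_le_sum fun b _ =>
          mul_le_mul (mul_le_mul_of_nonneg_left (h.near_card a) (he0 a b)) (h.near_card b)
            (sum_nonneg fun d _ => he0 b d) (mul_nonneg (he0 _ _) hκ)
      _ = ∑ a, (∑ b, e a b) * κ * κ := by simp_rw [sum_mul]
      _ ≤ ∑ _a : J, κ * κ * κ := by
          gcongr with a _
          exact h.near_card a
      _ = _ := by simp [hn]; ring
  have t4 : ∑ a, ∑ b, ∑ c, ∑ d, e a b * e a d * e b c ≤ κ ^ 3 * n := by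
    refine le_trans (le_of_eq ?_) t3
    exact sum_congr rfl fun a _ => sum_congr rfl fun b _ => sum_comm
  have gf : (∑ a, ∑ b, g a b) * (∑ a, ∑ b, f a b) ≤ δ * C * n ^ 2 :=
    (mul_le_mul hH hF hF0 (by positivity)).trans_eq (by ring)
  have ff : (∑ a, ∑ b, f a b) * (∑ a, ∑ b, f a b) ≤ C ^ 2 * n ^ 2 :=
    (mul_le_mul hF hF hF0 (by positivity)).trans_eq (by ring)
  have fg : (∑ a, ∑ b, f a b) * (∑ a, ∑ b, g a b) ≤ δ * C * n ^ 2 := by rwa [mul_comm]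
  have hU : ∀ a b c d, diagramMajorant ρ near m lam L a b c d =
      f a b * f c d * ρ a c + f a b * f c d * ρ b d + e a b * e a c * e b d +
      e a b * e a d * e b c + 2 * L * (g a b * f c d) + 2 * L * (f a b * g c d) +
      L * (g a c * f b d) + L * (f a c * g b d) + L * (g a d * f b c) + L * (f a d * g b c) +
      2 * lam * (f a b * f c d) + lam * (f a c * f b d) + lam * (f a d * f b c) := by
    intro a b c d
    simp only [diagramMajorant, f, g, e]
    ring
  simp_rw [hU, sum_add_distrib]
  simp only [sum_four_const_mul, sum_mul_sum_adjacent, sum_mul_sum_alternating, sum_mul_sum_nested]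
  have l1 := mul_le_mul_of_nonneg_left gf hL
  have l2 := mul_le_mul_of_nonneg_left fg hL
  have l3 := mul_le_mul_of_nonneg_left ff h0.le
  have l4 := mul_le_mul_of_nonneg_left hR (sq_nonneg C)
  nlinarith

end IsShortRange

/-! ### Concentration of quadratic Hermite sums -/

namespace IsStdGaussianFamily

variable {Ω J : Type*} [MeasurableSpace Ω] {P : Measure Ω} {ν : ℕ} {X : J → Fin ν → Ω → ℝ}
  [Fintype J] {ρ : J → J → ℝ} {near : J → J → Prop} [DecidableRel near] {m : ℕ} {C δ κ : ℝ}

lemma abs_cov_mul_le_diagramMajorant (hX : IsStdGaussianFamily P X)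
    (hρ : ∀ a b u v, |∫ ω, X a u ω * X b v ω ∂P| ≤ ρ a b) (h : IsShortRange ρ near m C δ κ)
    {α β : Fin ν → ℕ} (hα : m ≤ ∑ v, α v + 1) (hβ : m ≤ ∑ v, β v + 1) {lam : ℝ} (h0 : 0 < lam)
    (h1 : lam ≤ 1) (a b c d : J) :
    ρ a b * ρ c d * |∫ ω, (hermiteProd α (fun v => X a v ω) * hermiteProd β fun v => X b v ω) *
        (hermiteProd α (fun v => X c v ω) * hermiteProd β fun v => X d v ω) ∂P -
      (∫ ω, hermiteProd α (fun v => X a v ω) * hermiteProd β (fun v => X b v ω) ∂P) *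
        ∫ ω, hermiteProd α (fun v => X c v ω) * hermiteProd β (fun v => X d v ω) ∂P| ≤
      (4 * ν * (∑ v, α v + ∑ v, β v : ℕ) + 1 : ℝ) ^ (2 * (∑ v, α v + ∑ v, β v)) *
        diagramMajorant ρ near m lam (lam⁻¹ ^ (min (∑ v, α v) (∑ v, β v) + 1)) a b c d := by
  set slot : Fin 4 → J := ![a, b, c, d] with hslot
  set k : Fin 4 → Fin ν → ℕ := ![α, β, α, β] with hk
  have hY := hX.reindex slot
  set L := lam⁻¹ ^ (min (∑ v, α v) (∑ v, β v) + 1) with hL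
  have hL0 : 0 ≤ L := by positivity
  have hU0 := h.diagramMajorant_nonneg h0.le hL0 a b c d
  have e1 : ∫ ω, (hermiteProd α (fun v => X a v ω) * hermiteProd β fun v => X b v ω) *
        (hermiteProd α (fun v => X c v ω) * hermiteProd β fun v => X d v ω) ∂P =
      hermiteMoment P (fun i => X (slot i)) univ k := by
    simp [hermiteMoment, Fin.prod_univ_four, slot, k, mul_assoc]
  have e2 : ∫ ω, hermiteProd α (fun v => X a v ω) * hermiteProd β (fun v => X b v ω) ∂P =
      hermiteMoment P (fun i => X (slot i)) {0, 1} k := by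
    simp [hermiteMoment, slot, k]
  have e3 : ∫ ω, hermiteProd α (fun v => X c v ω) * hermiteProd β (fun v => X d v ω) ∂P =
      hermiteMoment P (fun i => X (slot i)) ({0, 1} : Finset (Fin 4))ᶜ k := by
    have : ({0, 1} : Finset (Fin 4))ᶜ = {2, 3} := by decide
    rw [this]
    simp [hermiteMoment, slot, k]
  rw [e1, e2, e3]
  set Cov := hermiteMoment P (fun i => X (slot i)) univ k -
    hermiteMoment P (fun i => X (slot i)) {0, 1} k *
      hermiteMoment P (fun i => X (slot i)) ({0, 1} : Finset (Fin 4))ᶜ k with hCov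
  by_cases hx : Cov = 0
  · rw [hx, abs_zero, mul_zero]
    positivity
  have hD : ∀ j v, k j v ≤ ∑ v, α v + ∑ v, β v := by
    intro j v
    have ha : α v ≤ ∑ v, α v := single_le_sum (fun _ _ => Nat.zero_le _) (mem_univ v)
    have hb : β v ≤ ∑ v, β v := single_le_sum (fun _ _ => Nat.zero_le _) (mem_univ v)
    fin_cases j <;> simp [k] <;> omega
  obtain ⟨l, hl, hcross, hb⟩ := hY.exists_crossing_diagram_bound
    (ρ := fun i j => ρ (slot i) (slot j)) (fun i j u v => hρ _ _ u v) {0, 1} hD hx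
  have hdeg : ∑ a, ∑ w, k a w = 2 * (∑ v, α v + ∑ v, β v) := by
    simp [Fin.sum_univ_four, k]
    ring
  rw [hdeg, Fintype.card_fin, ← hCov] at hb
  push_cast at hb ⊢
  set B := (4 * ν * (∑ v, (α v : ℝ) + ∑ v, (β v : ℝ)) + 1) ^ (2 * (∑ v, α v + ∑ v, β v)) with hB
  have hρm : ∀ i j, ρ i j ∈ Set.Icc (0 : ℝ) 1 := h.mem_Icc
  have hw : ρ a b * ρ c d * ∏ i, ∏ j, ρ (slot i) (slot j) ^ l i j ≤
      diagramMajorant ρ near m lam L a b c d := by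
    have hcases := diagram_weight_cases hl hcross (by simp [k]) (by simp [k])
      (ρ := fun i j => ρ (slot i) (slot j)) (fun i j => h.symm _ _) (fun i j => hρm _ _)
    simp only [slot, k, Matrix.cons_val] at hcases
    have hm : m ≤ min (∑ v, α v) (∑ v, β v) + 1 := by omega
    have p0 : ∀ i j, 0 ≤ ρ i j := fun i j => (hρm i j).1
    have n1 := p0 a b
    have n2 := p0 a c
    have n3 := p0 a d
    have n4 := p0 b c
    have n5 := p0 b d
    have n6 := p0 c d
    rcases hcases with hc | ⟨r, s, hr, hs, hrs, hc⟩
    · refine hc.trans ?_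
      have hx1 : ρ a b * ρ c d ≤ 1 := mul_le_one₀ (hρm a b).2 n6 (hρm c d).2
      have hle := mul_le_mul_of_nonneg_right
        (pow_le_pow_of_le_one (mul_nonneg n1 n6) hx1 hm) (add_nonneg n2 n5)
      rw [mul_pow (ρ a b) (ρ c d) m] at hle
      refine hle.trans ?_
      rw [diagramMajorant, add_assoc]
      exact le_add_of_nonneg_right (by positivity)
    · refine hc.trans ?_
      have w1 := mul_pow_mul_mul_pow_le (hρm a b) (hρm c d) (hρm a c) (hρm b d) h0 h1 hr hs
        (hrs ▸ hm) (near a b) (near c d) (near a c) (near b d)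
      have w2 := mul_pow_mul_mul_pow_le (hρm a b) (hρm c d) (hρm a d) (hρm b c) h0 h1 hr hs
        (hrs ▸ hm) (near a b) (near c d) (near a d) (near b c)
      rw [hrs] at w1 w2
      refine (add_le_add w1 w2).trans ?_
      have : 0 ≤ ρ a b ^ m * ρ c d ^ m * (ρ a c + ρ b d) := by positivity
      rw [diagramMajorant]
      linarith
  calc ρ a b * ρ c d * |Cov| ≤ ρ a b * ρ c d * (B * ∏ i, ∏ j, ρ (slot i) (slot j) ^ l i j) := by
        refine mul_le_mul_of_nonneg_left hb (mul_nonneg (hρm _ _).1 (hρm _ _).1)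
    _ = B * (ρ a b * ρ c d * ∏ i, ∏ j, ρ (slot i) (slot j) ^ l i j) := by ring
    _ ≤ _ := by
        refine mul_le_mul_of_nonneg_left hw (by positivity)

/-- The variance of a double sum of products of Hermite polynomials of the slots is controlled by the diagram majorant. -/
lemma integral_sq_sub_sq_integral_le (hX : IsStdGaussianFamily P X)
    (hρ : ∀ a b u v, |∫ ω, X a u ω * X b v ω ∂P| ≤ ρ a b) (h : IsShortRange ρ near m C δ κ)
    {α β : Fin ν → ℕ} (hα : m ≤ ∑ v, α v + 1) (hβ : m ≤ ∑ v, β v + 1) {lam : ℝ} (h0 : 0 < lam)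
    (h1 : lam ≤ 1) {w : J → J → ℝ} (hw : ∀ a b, |w a b| ≤ ρ a b) :
    ∫ ω, (∑ a, ∑ b, w a b *
        (hermiteProd α (fun v => X a v ω) * hermiteProd β fun v => X b v ω)) ^ 2 ∂P -
      (∫ ω, ∑ a, ∑ b, w a b *
        (hermiteProd α (fun v => X a v ω) * hermiteProd β fun v => X b v ω) ∂P) ^ 2 ≤
      (4 * ν * (∑ v, α v + ∑ v, β v : ℕ) + 1 : ℝ) ^ (2 * (∑ v, α v + ∑ v, β v)) *
        ∑ a, ∑ b, ∑ c, ∑ d, diagramMajorant ρ near m lam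
          (lam⁻¹ ^ (min (∑ v, α v) (∑ v, β v) + 1)) a b c d := by
  have := hX.isProbabilityMeasure
  set H : J → J → Ω → ℝ := fun a b ω =>
    hermiteProd α (fun v => X a v ω) * hermiteProd β fun v => X b v ω with hH
  have mH : ∀ a b, HasAllMoments P (H a b) := fun a b =>
    (hX.hasAllMoments_hermiteProd a α).mul (hX.hasAllMoments_hermiteProd b β)
  have e1 : ∫ ω, (∑ a, ∑ b, w a b * H a b ω) ^ 2 ∂P =
      ∑ a, ∑ b, ∑ c, ∑ d, w a b * w c d * ∫ ω, H a b ω * H c d ω ∂P := by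
    have : ∀ ω, (∑ a, ∑ b, w a b * H a b ω) ^ 2 =
        ∑ a, ∑ b, ∑ c, ∑ d, w a b * w c d * (H a b ω * H c d ω) := by
      intro ω
      rw [sq, ← sum_mul_sum_adjacent]
      refine sum_congr rfl fun a _ => sum_congr rfl fun b _ => sum_congr rfl fun c _ =>
        sum_congr rfl fun d _ => ?_
      ring
    simp_rw [this]
    have M : ∀ a b c d, HasAllMoments P fun ω => w a b * w c d * (H a b ω * H c d ω) :=
      fun a b c d => ((mH a b).mul (mH c d)).const_mul _
    rw [integral_finsetSum _ fun a _ => (HasAllMoments.sum fun b _ => HasAllMoments.sum fun c _ =>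
      HasAllMoments.sum fun d _ => M a b c d).integrable]
    refine sum_congr rfl fun a _ => ?_
    rw [integral_finsetSum _ fun b _ => (HasAllMoments.sum fun c _ =>
      HasAllMoments.sum fun d _ => M a b c d).integrable]
    refine sum_congr rfl fun b _ => ?_
    rw [integral_finsetSum _ fun c _ => (HasAllMoments.sum fun d _ => M a b c d).integrable]
    refine sum_congr rfl fun c _ => ?_
    rw [integral_finsetSum _ fun d _ => (M a b c d).integrable]
    exact sum_congr rfl fun d _ => integral_const_mul _ _
  have e2 : ∫ ω, ∑ a, ∑ b, w a b * H a b ω ∂P = ∑ a, ∑ b, w a b * ∫ ω, H a b ω ∂P := by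
    rw [integral_finsetSum _ fun a _ => (HasAllMoments.sum fun b _ =>
      (mH a b).const_mul _).integrable]
    refine sum_congr rfl fun a _ => ?_
    rw [integral_finsetSum _ fun b _ => ((mH a b).const_mul _).integrable]
    exact sum_congr rfl fun b _ => integral_const_mul _ _
  change ∫ ω, (∑ a, ∑ b, w a b * H a b ω) ^ 2 ∂P - (∫ ω, ∑ a, ∑ b, w a b * H a b ω ∂P) ^ 2 ≤ _
  rw [e1, e2, sq, ← sum_mul_sum_adjacent, ← sum_four_const_mul]
  simp_rw [← sum_sub_distrib]
  refine sum_le_sum fun a _ => sum_le_sum fun b _ => sum_le_sum fun c _ => sum_le_sum fun d _ => ?_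
  refine le_trans ?_ (hX.abs_cov_mul_le_diagramMajorant hρ h hα hβ h0 h1 a b c d)
  calc _ = w a b * w c d * (∫ ω, H a b ω * H c d ω ∂P -
        (∫ ω, H a b ω ∂P) * ∫ ω, H c d ω ∂P) := by ring
    _ ≤ |w a b| * |w c d| * |∫ ω, H a b ω * H c d ω ∂P -
        (∫ ω, H a b ω ∂P) * ∫ ω, H c d ω ∂P| := by
      rw [← abs_mul, ← abs_mul]
      exact le_abs_self _
    _ ≤ _ := by
      have := (h.mem_Icc a b).1
      gcongr
      exacts [hw a b, hw c d]

end IsStdGaussianFamily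

/-! ### Stein kernels and characteristic functions -/

/-- If `Z` admits a Stein kernel `T` for trigonometric test functions, then its characteristic
function is close to a Gaussian one as soon as `T` is close to a constant in `L¹`. -/
lemma norm_charFun_map_sub_exp_le {Ω : Type*} [MeasurableSpace Ω] {P : Measure Ω}
    [IsProbabilityMeasure P] {Z T : Ω → ℝ} (hZm : Measurable Z) (hZ : Integrable Z P)
    (hT : Integrable T P)
    (hcos : ∀ t : ℝ, ∫ ω, Z ω * Real.cos (t * Z ω) ∂P = -t * ∫ ω, T ω * Real.sin (t * Z ω) ∂P)
    (hsin : ∀ t : ℝ, ∫ ω, Z ω * Real.sin (t * Z ω) ∂P = t * ∫ ω, T ω * Real.cos (t * Z ω) ∂P)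
    (v t : ℝ) (hv : 0 ≤ v) :
    ‖charFun (P.map Z) t - Complex.exp (-(v * t ^ 2 / 2 : ℝ))‖ ≤ t ^ 2 * ∫ ω, |T ω - v| ∂P := by
  set Δ := ∫ ω, |T ω - v| ∂P with hΔ
  have hΔ0 : 0 ≤ Δ := integral_nonneg fun ω => abs_nonneg _
  let e : ℝ → Ω → ℂ := fun s ω => Complex.exp (s * Z ω * Complex.I)
  have he : ∀ s ω, e s ω = Real.cos (s * Z ω) + Real.sin (s * Z ω) * Complex.I := by
    intro s ω
    simp only [e]
    rw [← Complex.ofReal_mul, Complex.exp_mul_I, Complex.ofReal_cos, Complex.ofReal_sin]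
  have hem : ∀ s, Measurable (e s) := fun s => by
    simp only [e]
    fun_prop
  have hen : ∀ s ω, ‖e s ω‖ = 1 := fun s ω => by
    simp only [e]
    rw [← Complex.ofReal_mul, Complex.norm_exp_ofReal_mul_I]
  have hei : ∀ s, Integrable (e s) P := fun s =>
    (integrable_const (1 : ℝ)).mono' (hem s).aestronglyMeasurable (ae_of_all _ fun ω => (hen s ω).le)
  have hmul : ∀ {W : Ω → ℝ}, Integrable W P → ∀ s, Integrable (fun ω => (W ω : ℂ) * e s ω) P := by
    intro W hW s
    refine hW.norm.mono' (hW.ofReal.aestronglyMeasurable.mul (hem s).aestronglyMeasurable)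
      (ae_of_all _ fun ω => ?_)
    simp [hen]
  have hsplit : ∀ {W : Ω → ℝ}, Integrable W P → ∀ s, ∫ ω, (W ω : ℂ) * e s ω ∂P =
      (∫ ω, W ω * Real.cos (s * Z ω) ∂P : ℝ) +
        (∫ ω, W ω * Real.sin (s * Z ω) ∂P : ℝ) * Complex.I := by
    intro W hW s
    have hc : Integrable (fun ω => W ω * Real.cos (s * Z ω)) P :=
      hW.norm.mono' (hW.aestronglyMeasurable.mul (by fun_prop)) (ae_of_all _ fun ω => by
        rw [norm_mul]
        exact mul_le_of_le_one_right (norm_nonneg _) (Real.abs_cos_le_one _))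
    have hs : Integrable (fun ω => W ω * Real.sin (s * Z ω)) P :=
      hW.norm.mono' (hW.aestronglyMeasurable.mul (by fun_prop)) (ae_of_all _ fun ω => by
        rw [norm_mul]
        exact mul_le_of_le_one_right (norm_nonneg _) (Real.abs_sin_le_one _))
    rw [← integral_complex_ofReal, ← integral_complex_ofReal, ← integral_mul_const,
      ← integral_add hc.ofReal (hs.ofReal.mul_const _)]
    congr 1
    ext ω
    rw [he]
    push_cast
    ring
  have hstein : ∀ s : ℝ, ∫ ω, (Z ω : ℂ) * e s ω ∂P =
      s * Complex.I * ∫ ω, (T ω : ℂ) * e s ω ∂P := by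
    intro s
    rw [hsplit hZ, hsplit hT, hcos, hsin]
    push_cast
    linear_combination -(s : ℂ) * (∫ ω, T ω * Real.sin (s * Z ω) ∂P : ℝ) * Complex.I_sq
  have hderiv : ∀ s : ℝ, HasDerivAt (fun s : ℝ => ∫ ω, e s ω ∂P)
      (∫ ω, (Z ω : ℂ) * e s ω * Complex.I ∂P) s := by
    intro s
    refine (hasDerivAt_integral_of_dominated_loc_of_deriv_le (s := Set.univ) (F := e)
      (F' := fun r ω => (Z ω : ℂ) * e r ω * Complex.I)
      (bound := fun ω => ‖Z ω‖) Filter.univ_mem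
      (Eventually.of_forall fun r => (hem r).aestronglyMeasurable) (hei s)
      ((hmul hZ s).mul_const _).aestronglyMeasurable (ae_of_all _ fun ω r _ => ?_) hZ.norm
      (ae_of_all _ fun ω r _ => ?_)).2
    · simp [hen]
    · have h1 : HasDerivAt (fun r : ℝ => (r : ℂ) * Z ω * Complex.I) (1 * Z ω * Complex.I) r :=
        (Complex.ofRealCLM.hasDerivAt.mul_const _).mul_const _
      refine h1.cexp.congr_deriv ?_
      simp only [e]
      ring
  let F : ℝ → ℂ := fun s => Complex.exp ((v * s ^ 2 / 2 : ℝ)) * ∫ ω, e s ω ∂P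
  have hF : ∀ s, HasDerivAt F (Complex.exp ((v * s ^ 2 / 2 : ℝ)) *
      (s * ∫ ω, ((v - T ω : ℝ) : ℂ) * e s ω ∂P)) s := by
    intro s
    have h1 : HasDerivAt (fun s : ℝ => ((v * s ^ 2 / 2 : ℝ) : ℂ)) ((v * s : ℝ) : ℂ) s := by
      refine HasDerivAt.ofReal_comp ?_
      refine (((hasDerivAt_pow 2 s).const_mul v).div_const 2).congr_deriv ?_
      simp
      ring
    refine (h1.cexp.mul (hderiv s)).congr_deriv ?_
    have h2 : ∫ ω, ((v - T ω : ℝ) : ℂ) * e s ω ∂P =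
        v * ∫ ω, e s ω ∂P - ∫ ω, (T ω : ℂ) * e s ω ∂P := by
      rw [← integral_const_mul, ← integral_sub ((hei s).const_mul _) (hmul hT s)]
      congr 1
      ext ω
      push_cast
      ring
    rw [h2, integral_mul_const, hstein]
    generalize Complex.exp ((v * s ^ 2 / 2 : ℝ)) = E
    push_cast
    linear_combination (E * s * ∫ ω, (T ω : ℂ) * e s ω ∂P) * Complex.I_sq
  have hbound : ∀ s ∈ Set.Icc (-|t|) |t|, ‖Complex.exp ((v * s ^ 2 / 2 : ℝ)) *
      (s * ∫ ω, ((v - T ω : ℝ) : ℂ) * e s ω ∂P)‖ ≤ Real.exp (v * t ^ 2 / 2) * (|t| * Δ) := by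
    intro s hs
    have hst : |s| ≤ |t| := abs_le.2 hs
    rw [norm_mul, norm_mul, Complex.norm_exp_ofReal, Complex.norm_real, Real.norm_eq_abs]
    have h3 : ‖∫ ω, ((v - T ω : ℝ) : ℂ) * e s ω ∂P‖ ≤ Δ := by
      refine (norm_integral_le_integral_norm _).trans_eq ?_
      congr 1
      ext ω
      rw [norm_mul, hen, mul_one, Complex.norm_real, Real.norm_eq_abs, abs_sub_comm]
    have h4 : s ^ 2 ≤ t ^ 2 := sq_le_sq.2 hst
    gcongr
  have hmain := Convex.norm_image_sub_le_of_norm_hasDerivWithin_le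
    (fun s _ => (hF s).hasDerivWithinAt) hbound (convex_Icc (-|t|) |t|)
    (show (0 : ℝ) ∈ Set.Icc (-|t|) |t| by simp)
    (show t ∈ Set.Icc (-|t|) |t| from ⟨neg_abs_le t, le_abs_self t⟩)
  have hF0 : F 0 = 1 := by simp [F, e]
  have hchar : charFun (P.map Z) t = ∫ ω, e t ω ∂P := by
    rw [charFun_apply_real, integral_map hZm.aemeasurable (by fun_prop)]
  rw [hF0, sub_zero, Real.norm_eq_abs] at hmain
  have hfac : charFun (P.map Z) t - Complex.exp (-(v * t ^ 2 / 2 : ℝ)) =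
      Complex.exp ((-(v * t ^ 2 / 2) : ℝ)) * (F t - 1) := by
    rw [hchar]
    simp only [F]
    rw [mul_sub, ← mul_assoc, ← Complex.exp_add]
    push_cast
    simp
  rw [hfac, norm_mul, Complex.norm_exp_ofReal]
  calc Real.exp (-(v * t ^ 2 / 2)) * ‖F t - 1‖ ≤ Real.exp (-(v * t ^ 2 / 2)) *
        (Real.exp (v * t ^ 2 / 2) * (|t| * Δ) * |t|) := by gcongr
    _ = (Real.exp (-(v * t ^ 2 / 2)) * Real.exp (v * t ^ 2 / 2)) * (|t| * |t|) * Δ := by ring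
    _ = t ^ 2 * Δ := by
      rw [← Real.exp_add, neg_add_cancel, Real.exp_zero, abs_mul_abs_self]
      ring

/-! ### The Stein kernel of a Hermite sum -/

/-- The linear combination `∑ c j k H_k(X(j))` of Hermite polynomials of an array. -/
def hermiteSum {Ω J : Type*} [Fintype J] {ν : ℕ} (X : J → Fin ν → Ω → ℝ)
    (𝒦 : Finset (Fin ν → ℕ)) (c : J → (Fin ν → ℕ) → ℝ) (ω : Ω) : ℝ :=
  ∑ k ∈ 𝒦, ∑ j, c j k * hermiteProd k fun v => X j v ω

/-- The quadratic form in Hermite polynomials that contributes to the Stein kernel of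
`hermiteSum`. -/
def steinTerm {Ω J : Type*} [MeasurableSpace Ω] [Fintype J] {ν : ℕ} (P : Measure Ω)
    (X : J → Fin ν → Ω → ℝ) (c : J → (Fin ν → ℕ) → ℝ) (u : Fin ν) (k k' : Fin ν → ℕ)
    (v : Fin ν) (ω : Ω) : ℝ :=
  ∑ a, ∑ b, c a k * c b k' * (∫ ω, X a u ω * X b v ω ∂P) *
    (hermiteProd (k - Pi.single u 1) (fun w => X a w ω) *
      hermiteProd (k' - Pi.single v 1) fun w => X b w ω)

/-- The Stein kernel of `hermiteSum`, where `u k` is the coordinate of `H_k` that is integrated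
by parts. -/
def steinKernel {Ω J : Type*} [MeasurableSpace Ω] [Fintype J] {ν : ℕ} (P : Measure Ω)
    (X : J → Fin ν → Ω → ℝ) (𝒦 : Finset (Fin ν → ℕ)) (c : J → (Fin ν → ℕ) → ℝ)
    (u : (Fin ν → ℕ) → Fin ν) (ω : Ω) : ℝ :=
  ∑ k ∈ 𝒦, ∑ k' ∈ 𝒦, ∑ v, k' v * steinTerm P X c (u k) k k' v ω

/-- The `L¹`-deviation of a random variable is controlled by its variance. -/
lemma HasAllMoments.integral_abs_sub_integral_le {Ω : Type*} [MeasurableSpace Ω] {P : Measure Ω}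
    [IsProbabilityMeasure P] {W : Ω → ℝ} (hW : HasAllMoments P W) {B : ℝ}
    (hB : ∫ ω, W ω ^ 2 ∂P - (∫ ω, W ω ∂P) ^ 2 ≤ B) :
    ∫ ω, |W ω - ∫ ω', W ω' ∂P| ∂P ≤ √B := by
  set e := ∫ ω, W ω ∂P with he
  have hD : HasAllMoments P fun ω => W ω - e := by
    simpa [sub_eq_add_neg] using hW.add (HasAllMoments.const (-e))
  have habs : HasAllMoments P fun ω => |W ω - e| := fun p hp => (hD p hp).norm
  have hvar := variance_nonneg (fun ω => |W ω - e|) P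
  rw [variance_eq_sub (habs 2 (by simp))] at hvar
  refine Real.le_sqrt_of_sq_le ?_
  have h2 : ∫ ω, |W ω - e| ^ 2 ∂P = ∫ ω, W ω ^ 2 ∂P - e ^ 2 := by
    have h3 : ∀ ω, |W ω - e| ^ 2 = W ω * W ω + (-(2 * e)) * W ω + e ^ 2 := fun ω => by
      rw [sq_abs]
      ring
    simp_rw [h3]
    rw [integral_add (((hW.mul hW).add (hW.const_mul _)).integrable) (integrable_const _),
      integral_add (hW.mul hW).integrable (hW.const_mul _).integrable, integral_const_mul]
    simp only [integral_const, probReal_univ, one_smul, ← sq, ← he]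
    ring
  simp only [Pi.pow_apply] at hvar
  linarith

namespace IsStdGaussianFamily

variable {Ω J : Type*} [MeasurableSpace Ω] {P : Measure Ω} {ν : ℕ} {X : J → Fin ν → Ω → ℝ}
  [Fintype J]

lemma hasAllMoments_hermiteSum (hX : IsStdGaussianFamily P X) (𝒦 : Finset (Fin ν → ℕ))
    (c : J → (Fin ν → ℕ) → ℝ) : HasAllMoments P (hermiteSum X 𝒦 c) :=
  HasAllMoments.sum fun _ _ => HasAllMoments.sum fun _ _ =>
    (hX.hasAllMoments_hermiteProd _ _).const_mul _

lemma measurable_hermiteSum (hX : IsStdGaussianFamily P X) (𝒦 : Finset (Fin ν → ℕ))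
    (c : J → (Fin ν → ℕ) → ℝ) : Measurable (hermiteSum X 𝒦 c) :=
  Finset.measurable_fun_sum _ fun _ _ => Finset.measurable_fun_sum _ fun _ _ =>
    ((measurable_hermiteProd _).comp
      (measurable_pi_lambda _ fun _ => hX.measurable _ _)).const_mul _

lemma hasAllMoments_steinTerm (hX : IsStdGaussianFamily P X) (c : J → (Fin ν → ℕ) → ℝ)
    (u : Fin ν) (k k' : Fin ν → ℕ) (v : Fin ν) : HasAllMoments P (steinTerm P X c u k k' v) :=
  HasAllMoments.sum fun _ _ => HasAllMoments.sum fun _ _ =>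
    ((hX.hasAllMoments_hermiteProd _ _).mul (hX.hasAllMoments_hermiteProd _ _)).const_mul _

lemma hasAllMoments_steinKernel (hX : IsStdGaussianFamily P X) (𝒦 : Finset (Fin ν → ℕ))
    (c : J → (Fin ν → ℕ) → ℝ) (u : (Fin ν → ℕ) → Fin ν) :
    HasAllMoments P (steinKernel P X 𝒦 c u) :=
  HasAllMoments.sum fun _ _ => HasAllMoments.sum fun _ _ => HasAllMoments.sum fun _ _ =>
    (hX.hasAllMoments_steinTerm _ _ _ _ _).const_mul _

/-- Stein's identity for a Hermite sum. -/
lemma integral_hermiteSum_mul (hX : IsStdGaussianFamily P X) {𝒦 : Finset (Fin ν → ℕ)}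
    (c : J → (Fin ν → ℕ) → ℝ) {u : (Fin ν → ℕ) → Fin ν} (hu : ∀ k ∈ 𝒦, 0 < k (u k))
    {φ φ' : ℝ → ℝ} (hφ : ∀ x, HasDerivAt φ (φ' x) x) (hm : Measurable φ) (hm' : Measurable φ')
    (hint : HasAllMoments P fun ω => φ (hermiteSum X 𝒦 c ω))
    (hint' : HasAllMoments P fun ω => φ' (hermiteSum X 𝒦 c ω)) :
    ∫ ω, hermiteSum X 𝒦 c ω * φ (hermiteSum X 𝒦 c ω) ∂P =
      ∫ ω, steinKernel P X 𝒦 c u ω * φ' (hermiteSum X 𝒦 c ω) ∂P := by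
  let S : (J × Fin ν → ℝ) → ℝ := fun y =>
    ∑ k ∈ 𝒦, ∑ j, c j k * hermiteProd k fun v => y (j, v)
  let S' : J → Fin ν → (J × Fin ν → ℝ) → ℝ := fun a q y =>
    ∑ k ∈ 𝒦, ∑ j, c j k * ∑ v, (∫ ω, X a q ω * X j v ω ∂P) *
      (k v * hermiteProd (k - Pi.single v 1) fun w => y (j, w))
  have hmH : ∀ (κ : Fin ν → ℕ) j, Measurable fun y : J × Fin ν → ℝ =>
      hermiteProd κ fun v => y (j, v) := fun κ j =>
    (measurable_hermiteProd κ).comp (measurable_pi_lambda _ fun v => measurable_pi_apply _)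
  have hSm : Measurable S := Finset.measurable_fun_sum _ fun k _ =>
    Finset.measurable_fun_sum _ fun j _ => (hmH _ _).const_mul _
  have hSm' : ∀ a q, Measurable (S' a q) := fun a q => Finset.measurable_fun_sum _ fun k _ =>
    Finset.measurable_fun_sum _ fun j _ => (Finset.measurable_fun_sum _ fun v _ =>
      ((hmH _ _).const_mul _).const_mul _).const_mul _
  have hS : ∀ a q y, HasDerivAt
      (fun t : ℝ => S (y + t • fun b => ∫ ω, X a q ω * X b.1 b.2 ω ∂P)) (S' a q y) 0 :=
    fun a q y => HasDerivAt.fun_sum fun k _ => HasDerivAt.fun_sum fun j _ =>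
      (hasDerivAt_hermiteProd k (fun v => y (j, v))
        fun v => ∫ ω, X a q ω * X j v ω ∂P).const_mul _
  have hSM' : ∀ a q, HasAllMoments P fun ω => S' a q fun b => X b.1 b.2 ω := fun a q =>
    HasAllMoments.sum fun k _ => HasAllMoments.sum fun j _ => (HasAllMoments.sum fun v _ =>
      ((hX.hasAllMoments_hermiteProd _ _).const_mul _).const_mul _).const_mul _
  have key : ∀ a, ∀ k ∈ 𝒦,
      ∫ ω, hermiteProd k (fun v => X a v ω) * φ (hermiteSum X 𝒦 c ω) ∂P =
      ∫ ω, hermiteProd (k - Pi.single (u k) 1) (fun v => X a v ω) *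
        (φ' (hermiteSum X 𝒦 c ω) * S' a (u k) fun b => X b.1 b.2 ω) ∂P := fun a k hk =>
    hX.integral_hermiteProd_mul a (hu k hk) (G := fun y => φ (S y))
      (G' := fun y => φ' (S y) * S' a (u k) y) (fun y => by
        have h1 := hS a (u k) y
        have h2 := hφ (S (y + (0 : ℝ) • fun b => ∫ ω, X a (u k) ω * X b.1 b.2 ω ∂P))
        have h3 := HasDerivAt.comp (0 : ℝ) h2 h1
        simp only [zero_smul, add_zero] at h3
        exact h3)
      (hm.comp hSm) ((hm'.comp hSm).mul (hSm' _ _)) hint (hint'.mul (hSM' _ _))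
  have hl : ∀ ω, hermiteSum X 𝒦 c ω * φ (hermiteSum X 𝒦 c ω) = ∑ k ∈ 𝒦, ∑ a, c a k *
      (hermiteProd k (fun v => X a v ω) * φ (hermiteSum X 𝒦 c ω)) := fun ω => by
    generalize φ (hermiteSum X 𝒦 c ω) = z
    simp_rw [hermiteSum, sum_mul, mul_assoc]
  have hr : ∀ ω, steinKernel P X 𝒦 c u ω * φ' (hermiteSum X 𝒦 c ω) = ∑ k ∈ 𝒦, ∑ a, c a k *
      (hermiteProd (k - Pi.single (u k) 1) (fun v => X a v ω) *
        (φ' (hermiteSum X 𝒦 c ω) * S' a (u k) fun b => X b.1 b.2 ω)) := fun ω => by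
    generalize φ' (hermiteSum X 𝒦 c ω) = z
    rw [steinKernel, sum_mul]
    refine sum_congr rfl fun k _ => ?_
    simp only [S', steinTerm, mul_sum, sum_mul]
    rw [sum_comm (s := univ) (t := 𝒦)]
    refine sum_congr rfl fun k' _ => ?_
    rw [sum_comm]
    refine sum_congr rfl fun a _ => ?_
    rw [sum_comm]
    refine sum_congr rfl fun b _ => sum_congr rfl fun v _ => ?_
    ring
  have ml : ∀ a k, HasAllMoments P fun ω => c a k *
      (hermiteProd k (fun v => X a v ω) * φ (hermiteSum X 𝒦 c ω)) := fun a k =>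
    ((hX.hasAllMoments_hermiteProd _ _).mul hint).const_mul _
  have mr : ∀ a k, HasAllMoments P fun ω => c a k *
      (hermiteProd (k - Pi.single (u k) 1) (fun v => X a v ω) *
        (φ' (hermiteSum X 𝒦 c ω) * S' a (u k) fun b => X b.1 b.2 ω)) := fun a k =>
    ((hX.hasAllMoments_hermiteProd _ _).mul (hint'.mul (hSM' _ _))).const_mul _
  simp_rw [hl, hr]
  rw [integral_finsetSum _ fun k _ => (HasAllMoments.sum fun a _ => ml a k).integrable,
    integral_finsetSum _ fun k _ => (HasAllMoments.sum fun a _ => mr a k).integrable]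
  refine sum_congr rfl fun k hk => ?_
  rw [integral_finsetSum _ fun a _ => (ml a k).integrable,
    integral_finsetSum _ fun a _ => (mr a k).integrable]
  refine sum_congr rfl fun a _ => ?_
  rw [integral_const_mul, integral_const_mul, key a k hk]

lemma integral_hermiteSum_sq (hX : IsStdGaussianFamily P X) {𝒦 : Finset (Fin ν → ℕ)}
    (c : J → (Fin ν → ℕ) → ℝ) {u : (Fin ν → ℕ) → Fin ν} (hu : ∀ k ∈ 𝒦, 0 < k (u k)) :
    ∫ ω, hermiteSum X 𝒦 c ω ^ 2 ∂P = ∫ ω, steinKernel P X 𝒦 c u ω ∂P := by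
  have := hX.isProbabilityMeasure
  have h := hX.integral_hermiteSum_mul c hu (φ := id) (φ' := fun _ => 1) hasDerivAt_id
    measurable_id measurable_const (hX.hasAllMoments_hermiteSum _ _) (HasAllMoments.const _)
  simpa [sq] using h

/-- The characteristic function of a Hermite sum is close to that of the Gaussian law with the
same variance as soon as the Stein kernel concentrates. -/
lemma norm_charFun_hermiteSum_sub_le (hX : IsStdGaussianFamily P X) {𝒦 : Finset (Fin ν → ℕ)}
    (c : J → (Fin ν → ℕ) → ℝ) {u : (Fin ν → ℕ) → Fin ν} (hu : ∀ k ∈ 𝒦, 0 < k (u k)) (t : ℝ) :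
    ‖charFun (P.map (hermiteSum X 𝒦 c)) t -
        Complex.exp (-((∫ ω, hermiteSum X 𝒦 c ω ^ 2 ∂P) * t ^ 2 / 2 : ℝ))‖ ≤
      t ^ 2 * ∫ ω, |steinKernel P X 𝒦 c u ω - ∫ ω', steinKernel P X 𝒦 c u ω' ∂P| ∂P := by
  have := hX.isProbabilityMeasure
  have hZ := hX.measurable_hermiteSum 𝒦 c
  have hcosm : ∀ s : ℝ, HasAllMoments P fun ω => Real.cos (s * hermiteSum X 𝒦 c ω) := fun s =>
    .of_bound (by fun_prop) 1 fun ω => Real.abs_cos_le_one _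
  have hsinm : ∀ s : ℝ, HasAllMoments P fun ω => Real.sin (s * hermiteSum X 𝒦 c ω) := fun s =>
    .of_bound (by fun_prop) 1 fun ω => Real.abs_sin_le_one _
  rw [← hX.integral_hermiteSum_sq c hu]
  refine norm_charFun_map_sub_exp_le hZ (hX.hasAllMoments_hermiteSum 𝒦 c).integrable
    (hX.hasAllMoments_steinKernel 𝒦 c u).integrable (fun s => ?_) (fun s => ?_) _ _
    (integral_nonneg fun ω => sq_nonneg _)
  · have h := hX.integral_hermiteSum_mul c hu (φ := fun x => Real.cos (s * x))
      (φ' := fun x => -s * Real.sin (s * x)) (fun x => by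
        refine ((Real.hasDerivAt_cos _).comp x ((hasDerivAt_id x).const_mul s)).congr_deriv ?_
        simp
        ring) (by fun_prop) (by fun_prop) (hcosm s) ((hsinm s).const_mul _)
    rw [h, ← integral_const_mul]
    congr 1
    ext ω
    ring
  · have h := hX.integral_hermiteSum_mul c hu (φ := fun x => Real.sin (s * x))
      (φ' := fun x => s * Real.cos (s * x)) (fun x => by
        refine ((Real.hasDerivAt_sin _).comp x ((hasDerivAt_id x).const_mul s)).congr_deriv ?_
        simp
        ring) (by fun_prop) (by fun_prop) (hsinm s) ((hcosm s).const_mul _)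
    rw [h, ← integral_const_mul]
    congr 1
    ext ω
    ring

end IsStdGaussianFamily

/-! ### Concentration of the Stein kernel -/

namespace IsStdGaussianFamily

variable {Ω J : Type*} [MeasurableSpace Ω] {P : Measure Ω} {ν : ℕ} {X : J → Fin ν → Ω → ℝ}
  [Fintype J] {ρ : J → J → ℝ} {near : J → J → Prop} [DecidableRel near] {m : ℕ} {C δ κ : ℝ}

lemma integral_abs_steinTerm_sub_le (hX : IsStdGaussianFamily P X)
    (hρ : ∀ a b u v, |∫ ω, X a u ω * X b v ω ∂P| ≤ ρ a b) (h : IsShortRange ρ near m C δ κ)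
    (hC : 0 ≤ C) (hδ : 0 ≤ δ) (hκ : 0 ≤ κ) {lam : ℝ} (h0 : 0 < lam) (h1 : lam ≤ 1)
    {c : J → (Fin ν → ℕ) → ℝ} {s : ℝ} (hs : 0 < s) {t : ℕ} {k k' : Fin ν → ℕ} {u v : Fin ν}
    (hc : ∀ j, |c j k| ≤ s) (hc' : ∀ j, |c j k'| ≤ s) (hu : 0 < k u) (hv : 0 < k' v)
    (hk : m ≤ ∑ w, k w) (hkt : ∑ w, k w ≤ t) (hk' : m ≤ ∑ w, k' w) (hkt' : ∑ w, k' w ≤ t) :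
    ∫ ω, |steinTerm P X c u k k' v ω - ∫ ω', steinTerm P X c u k k' v ω' ∂P| ∂P ≤
      √((s ^ 2) ^ 2 * ((8 * ν * t + 1) ^ (4 * t) *
        (2 * (C ^ 2 * (lam * Fintype.card J ^ 2 + lam⁻¹ ^ m * (C * Fintype.card J))) +
        2 * (κ ^ 3 * Fintype.card J + 4 * (lam⁻¹ ^ t * (δ * C)) * Fintype.card J ^ 2 +
          2 * (lam * C ^ 2) * Fintype.card J ^ 2)))) := by
  have := hX.isProbabilityMeasure
  refine (hX.hasAllMoments_steinTerm c u k k' v).integral_abs_sub_integral_le ?_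
  set w : J → J → ℝ := fun a b =>
    (s ^ 2)⁻¹ * (c a k * c b k' * ∫ ω, X a u ω * X b v ω ∂P) with hw
  have hs2 : s ^ 2 ≠ 0 := by positivity
  have hwle : ∀ a b, |w a b| ≤ ρ a b := by
    intro a b
    rw [hw, abs_mul, abs_mul, abs_mul, abs_of_pos (by positivity : 0 < (s ^ 2)⁻¹)]
    calc (s ^ 2)⁻¹ * (|c a k| * |c b k'| * |∫ ω, X a u ω * X b v ω ∂P|) ≤
        (s ^ 2)⁻¹ * (s * s * ρ a b) := by
          gcongr
          exacts [hc a, hc' b, hρ a b u v]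
      _ = ρ a b := by field_simp
  have e1 := sum_sub_single k hu
  have e2 := sum_sub_single k' hv
  have main := hX.integral_sq_sub_sq_integral_le hρ h (α := k - Pi.single u 1)
    (β := k' - Pi.single v 1) (by omega) (by omega) h0 h1 hwle
  have hS : ∀ ω, steinTerm P X c u k k' v ω = s ^ 2 * ∑ a, ∑ b, w a b *
      (hermiteProd (k - Pi.single u 1) (fun w => X a w ω) *
      hermiteProd (k' - Pi.single v 1) fun w => X b w ω) := by
    intro ω
    simp only [steinTerm, mul_sum, hw]
    refine sum_congr rfl fun a _ => sum_congr rfl fun b _ => ?_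
    field_simp
  simp_rw [hS, mul_pow]
  rw [integral_const_mul, integral_const_mul, mul_pow, ← mul_sub]
  refine mul_le_mul_of_nonneg_left (main.trans ?_) (by positivity)
  clear main
  generalize ∑ w, (k - Pi.single u 1 : Fin ν → ℕ) w = p at e1 ⊢
  generalize ∑ w, (k' - Pi.single v 1 : Fin ν → ℕ) w = q at e2 ⊢
  have hL : (0 : ℝ) ≤ lam⁻¹ ^ (min (p) (q) + 1) := by
    positivity
  have hinv : 1 ≤ lam⁻¹ := (one_le_inv₀ h0).2 h1
  have hsum := h.sum_diagramMajorant_le hC hδ hκ h0 hL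
  have hb : (0 : ℝ) ≤ 8 * ν * t := by positivity
  have hD : (4 * ν * (p + q : ℕ) + 1 : ℝ) ^ (2 * (p + q)) ≤
      (8 * ν * t + 1) ^ (4 * t) := by
    have h2 : p + q ≤ 2 * t := by omega
    generalize p + q = r at h2 ⊢
    have h3 : (r : ℝ) ≤ 2 * t := by exact_mod_cast h2
    calc (4 * ν * (r : ℝ) + 1) ^ (2 * r) ≤ (8 * ν * t + 1) ^ (2 * r) := by
          refine pow_le_pow_left₀ (by positivity) ?_ _
          nlinarith [(Nat.cast_nonneg ν : (0 : ℝ) ≤ ν)]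
      _ ≤ _ := pow_le_pow_right₀ (by linarith) (by omega)
  refine mul_le_mul hD (hsum.trans ?_) ?_ (by positivity)
  · have hLt : lam⁻¹ ^ (min (p) (q) + 1) ≤
        lam⁻¹ ^ t := pow_le_pow_right₀ hinv (by omega)
    gcongr
  · exact sum_nonneg fun a _ => sum_nonneg fun b _ => sum_nonneg fun c _ => sum_nonneg fun d _ =>
      h.diagramMajorant_nonneg h0.le hL a b c d

/-- If the coefficients are of order `n^{-1/2}`, with `n` the size of the array, then the Stein
kernel of a Hermite sum concentrates in `L¹`. -/
lemma integral_abs_steinKernel_sub_le [Nonempty J] (hX : IsStdGaussianFamily P X)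
    (hρ : ∀ a b u v, |∫ ω, X a u ω * X b v ω ∂P| ≤ ρ a b) (h : IsShortRange ρ near m C δ κ)
    (hC : 0 ≤ C) (hδ : 0 ≤ δ) (hκ : 0 ≤ κ) {lam : ℝ} (h0 : 0 < lam) (h1 : lam ≤ 1)
    {𝒦 : Finset (Fin ν → ℕ)} {c : J → (Fin ν → ℕ) → ℝ} {A : ℝ} (hA : 0 < A) {t : ℕ}
    (hc : ∀ k ∈ 𝒦, ∀ j, |c j k| ≤ A / √(Fintype.card J)) {u : (Fin ν → ℕ) → Fin ν}
    (hu : ∀ k ∈ 𝒦, 0 < k (u k)) (hk : ∀ k ∈ 𝒦, m ≤ ∑ w, k w ∧ ∑ w, k w ≤ t) :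
    ∫ ω, |steinKernel P X 𝒦 c u ω - ∫ ω', steinKernel P X 𝒦 c u ω' ∂P| ∂P ≤
      (∑ _k ∈ 𝒦, ∑ k' ∈ 𝒦, ∑ v, (k' v : ℝ)) * √(A ^ 4 * (8 * ν * t + 1) ^ (4 * t) *
        (6 * C ^ 2 * lam + 8 * lam⁻¹ ^ t * C * δ +
          (2 * C ^ 3 * lam⁻¹ ^ m + 2 * κ ^ 3) / Fintype.card J)) := by
  have := hX.isProbabilityMeasure
  set n : ℝ := (Fintype.card J : ℝ) with hn
  have hn0 : 0 < n := by
    rw [hn]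
    exact_mod_cast Fintype.card_pos
  set R := √(A ^ 4 * (8 * ν * t + 1) ^ (4 * t) * (6 * C ^ 2 * lam + 8 * lam⁻¹ ^ t * C * δ +
          (2 * C ^ 3 * lam⁻¹ ^ m + 2 * κ ^ 3) / n)) with hR
  have mT : ∀ k k' v, HasAllMoments P (steinTerm P X c (u k) k k' v) := fun k k' v =>
    hX.hasAllMoments_steinTerm c (u k) k k' v
  have mD : ∀ k k' v, HasAllMoments P fun ω => (k' v : ℝ) *
      |steinTerm P X c (u k) k k' v ω - ∫ ω', steinTerm P X c (u k) k k' v ω' ∂P| :=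
    fun k k' v => HasAllMoments.const_mul (fun p hp =>
      ((mT k k' v p hp).sub (memLp_const _)).norm) _
  have hterm : ∀ k ∈ 𝒦, ∀ k' ∈ 𝒦, ∀ v, ∫ ω, (k' v : ℝ) *
      |steinTerm P X c (u k) k k' v ω - ∫ ω', steinTerm P X c (u k) k k' v ω' ∂P| ∂P ≤
      k' v * R := by
    intro k hk1 k' hk1' v
    rw [integral_const_mul]
    rcases Nat.eq_zero_or_pos (k' v) with hz | hz
    · simp [hz]
    refine mul_le_mul_of_nonneg_left ?_ (Nat.cast_nonneg _)
    refine (hX.integral_abs_steinTerm_sub_le hρ h hC hδ hκ h0 h1 (s := A / √n) (t := t)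
      (by positivity) (hc k hk1) (hc k' hk1') (hu k hk1) hz (hk k hk1).1 (hk k hk1).2
      (hk k' hk1').1 (hk k' hk1').2).trans_eq ?_
    rw [hR, div_pow, Real.sq_sqrt hn0.le]
    congr 1
    rw [← hn]
    field_simp
    ring
  have hint : ∫ ω', steinKernel P X 𝒦 c u ω' ∂P = ∑ k ∈ 𝒦, ∑ k' ∈ 𝒦, ∑ v, (k' v : ℝ) *
      ∫ ω', steinTerm P X c (u k) k k' v ω' ∂P := by
    simp only [steinKernel]
    rw [integral_finsetSum _ fun k _ => (HasAllMoments.sum fun k' _ => HasAllMoments.sum fun v _ =>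
      (mT k k' v).const_mul _).integrable]
    refine sum_congr rfl fun k _ => ?_
    rw [integral_finsetSum _ fun k' _ => (HasAllMoments.sum fun v _ =>
      (mT k k' v).const_mul _).integrable]
    refine sum_congr rfl fun k' _ => ?_
    rw [integral_finsetSum _ fun v _ => ((mT k k' v).const_mul _).integrable]
    exact sum_congr rfl fun v _ => integral_const_mul _ _
  calc ∫ ω, |steinKernel P X 𝒦 c u ω - ∫ ω', steinKernel P X 𝒦 c u ω' ∂P| ∂P
      ≤ ∫ ω, ∑ k ∈ 𝒦, ∑ k' ∈ 𝒦, ∑ v, (k' v : ℝ) *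
        |steinTerm P X c (u k) k k' v ω - ∫ ω', steinTerm P X c (u k) k k' v ω' ∂P| ∂P := by
        refine integral_mono (((hX.hasAllMoments_steinKernel 𝒦 c u).integrable.sub
          (integrable_const _)).abs) (HasAllMoments.sum fun k _ => HasAllMoments.sum fun k' _ =>
            HasAllMoments.sum fun v _ => mD k k' v).integrable fun ω => ?_
        rw [hint]
        simp only [steinKernel, ← sum_sub_distrib, ← mul_sub]
        refine (abs_sum_le_sum_abs _ _).trans (sum_le_sum fun k _ => ?_)
        refine (abs_sum_le_sum_abs _ _).trans (sum_le_sum fun k' _ => ?_)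
        refine (abs_sum_le_sum_abs _ _).trans (sum_le_sum fun v _ => ?_)
        rw [abs_mul, Nat.abs_cast]
    _ = ∑ k ∈ 𝒦, ∑ k' ∈ 𝒦, ∑ v, ∫ ω, (k' v : ℝ) *
        |steinTerm P X c (u k) k k' v ω - ∫ ω', steinTerm P X c (u k) k k' v ω' ∂P| ∂P := by
        rw [integral_finsetSum _ fun k _ => (HasAllMoments.sum fun k' _ =>
          HasAllMoments.sum fun v _ => mD k k' v).integrable]
        refine sum_congr rfl fun k _ => ?_
        rw [integral_finsetSum _ fun k' _ => (HasAllMoments.sum fun v _ => mD k k' v).integrable]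
        refine sum_congr rfl fun k' _ => ?_
        rw [integral_finsetSum _ fun v _ => (mD k k' v).integrable]
    _ ≤ ∑ k ∈ 𝒦, ∑ k' ∈ 𝒦, ∑ v, (k' v : ℝ) * R :=
        sum_le_sum fun k hk1 => sum_le_sum fun k' hk1' => sum_le_sum fun v _ =>
          hterm k hk1 k' hk1' v
    _ = _ := by simp only [sum_mul]

end IsStdGaussianFamily

/-! ### Central limit theorem for Hermite sums -/

lemma IsJointGaussian.hasGaussianLaw {Ω ι : Type*} [MeasurableSpace Ω] [Fintype ι] {P : Measure Ω}
    {X : ι → Ω → ℝ} (hm : ∀ i, Measurable (X i)) (h : IsJointGaussian P X) :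
    HasGaussianLaw (fun ω i => X i ω) P where
  isGaussian_map := by
    classical
    refine isGaussian_of_map_eq_gaussianReal fun L => ?_
    obtain ⟨μ, v, hL⟩ := h univ fun i => L (Pi.single i 1)
    refine ⟨μ, v, ?_⟩
    rw [Measure.map_map (by fun_prop) (measurable_pi_lambda _ hm), ← hL]
    congr 1
    ext ω
    have := (L : (ι → ℝ) →ₗ[ℝ] ℝ).pi_apply_eq_sum_univ fun i => X i ω
    simp only [ContinuousLinearMap.coe_coe, smul_eq_mul] at this
    simp only [Function.comp_apply]
    rw [this]
    refine sum_congr rfl fun i _ => ?_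
    rw [mul_comm]
    congr 2
    ext j
    simp [Pi.single_apply, eq_comm]

/-- Central limit theorem from Stein kernels: if the characteristic function of `Z n` is close to
that of the Gaussian law with the same variance, and the variances are bounded away from zero, then
the normalized sequence converges in distribution to the standard Gaussian law. -/
lemma tendsto_integral_comp_normalized {Ω : ℕ → Type*} [∀ n, MeasurableSpace (Ω n)]
    {P : ∀ n, Measure (Ω n)} [∀ n, IsProbabilityMeasure (P n)] {Z : ∀ n, Ω n → ℝ}
    (hZ : ∀ n, Measurable (Z n)) {Δ : ℕ → ℝ} (hΔ : Tendsto Δ atTop (𝓝 0))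
    (hchar : ∀ n t, ‖charFun ((P n).map (Z n)) t -
      Complex.exp (-((∫ ω, Z n ω ^ 2 ∂P n) * t ^ 2 / 2 : ℝ))‖ ≤ t ^ 2 * Δ n)
    (hvar : 0 < liminf (fun n => ∫ ω, Z n ω ^ 2 ∂P n) atTop)
    (ψ : BoundedContinuousFunction ℝ ℝ) :
    Tendsto (fun n => ∫ ω, ψ ((√(∫ ω', Z n ω' ^ 2 ∂P n))⁻¹ * Z n ω) ∂P n) atTop
      (𝓝 (∫ x, ψ x ∂gaussianReal 0 1)) := by
  set V : ℕ → ℝ := fun n => ∫ ω, Z n ω ^ 2 ∂P n with hV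
  have hWm : ∀ n, Measurable fun ω => (√(V n))⁻¹ * Z n ω := fun n => (hZ n).const_mul _
  let μ : ℕ → ProbabilityMeasure ℝ := fun n =>
    ⟨(P n).map fun ω => (√(V n))⁻¹ * Z n ω, Measure.isProbabilityMeasure_map (hWm n).aemeasurable⟩
  let μ₀ : ProbabilityMeasure ℝ := ⟨gaussianReal 0 1, inferInstance⟩
  suffices hμ : Tendsto μ atTop (𝓝 μ₀) by
    have h := ProbabilityMeasure.tendsto_iff_forall_integral_tendsto.1 hμ ψ
    refine h.congr fun n => ?_
    exact integral_map (hWm n).aemeasurable ψ.continuous.aestronglyMeasurable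
  refine ProbabilityMeasure.tendsto_of_tendsto_charFun fun t => ?_
  obtain ⟨c, hc0, hc⟩ := exists_between hvar
  have hev : ∀ᶠ n in atTop, c < V n := eventually_lt_of_lt_liminf hc
    (isBoundedUnder_of_eventually_ge (a := 0) (Eventually.of_forall fun n =>
      integral_nonneg fun ω => sq_nonneg _))
  have h0 : charFun (μ₀ : Measure ℝ) t = Complex.exp (-(t ^ 2 / 2 : ℝ)) := by
    change charFun (gaussianReal 0 1) t = _
    rw [charFun_gaussianReal]
    congr 1
    push_cast
    simp
  rw [h0, tendsto_iff_norm_sub_tendsto_zero]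
  have hlim : Tendsto (fun n => t ^ 2 * c⁻¹ * |Δ n|) atTop (𝓝 0) := by
    simpa using hΔ.abs.const_mul (t ^ 2 * c⁻¹)
  refine squeeze_zero' (Eventually.of_forall fun n => norm_nonneg _) ?_ hlim
  filter_upwards [hev] with n hn
  have hVn : 0 < V n := hc0.trans hn
  have h1 : charFun (μ n : Measure ℝ) t = charFun ((P n).map (Z n)) ((√(V n))⁻¹ * t) :=
    charFun_map_mul_comp (hZ n).aemeasurable _ _
  have h2 := hchar n ((√(V n))⁻¹ * t)
  have h3 : ((√(V n))⁻¹ * t) ^ 2 = (V n)⁻¹ * t ^ 2 := by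
    rw [mul_pow, inv_pow, Real.sq_sqrt hVn.le]
  have h4 : V n * ((V n)⁻¹ * t ^ 2) / 2 = t ^ 2 / 2 := by field_simp
  rw [h3] at h2
  change ‖_ - Complex.exp (-(V n * ((V n)⁻¹ * t ^ 2) / 2 : ℝ))‖ ≤ _ at h2
  rw [h4] at h2
  rw [h1]
  refine h2.trans ?_
  calc (V n)⁻¹ * t ^ 2 * Δ n ≤ (V n)⁻¹ * t ^ 2 * |Δ n| := by
        gcongr
        exact le_abs_self _
    _ ≤ c⁻¹ * t ^ 2 * |Δ n| := by gcongr
    _ = t ^ 2 * c⁻¹ * |Δ n| := by ring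

/-- Central limit theorem for Hermite sums over short range dependent Gaussian arrays. -/
lemma tendsto_integral_comp_normalized_hermiteSum {ν m t : ℕ} [Nonempty (Fin ν)] (hm : 1 ≤ m)
    {Ω J : ℕ → Type*} [∀ n, MeasurableSpace (Ω n)] [∀ n, Fintype (J n)]
    (hJ : ∀ n, Fintype.card (J n) = n) {P : ∀ n, Measure (Ω n)}
    {X : ∀ n, J n → Fin ν → Ω n → ℝ} (hX : ∀ n, IsStdGaussianFamily (P n) (X n))
    {ρ : ∀ n, J n → J n → ℝ} (hρ : ∀ n a b u v, |∫ ω, X n a u ω * X n b v ω ∂P n| ≤ ρ n a b)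
    {C : ℝ} (hC : 0 ≤ C)
    (hsr : ∀ δ : ℝ, 0 < δ → ∃ (κ : ℝ) (near : ∀ n, J n → J n → Prop)
      (_ : ∀ n, DecidableRel (near n)), 0 ≤ κ ∧
        ∀ n, 1 ≤ n → IsShortRange (ρ n) (near n) m C δ κ)
    {𝒦 : Finset (Fin ν → ℕ)} (hk : ∀ k ∈ 𝒦, m ≤ ∑ w, k w ∧ ∑ w, k w ≤ t)
    {c : ∀ n, J n → (Fin ν → ℕ) → ℝ} {A : ℝ} (hA : 0 < A)
    (hc : ∀ n, ∀ k ∈ 𝒦, ∀ j, |c n j k| ≤ A / √n)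
    (hvar : 0 < liminf (fun n => ∫ ω, hermiteSum (X n) 𝒦 (c n) ω ^ 2 ∂P n) atTop)
    (ψ : BoundedContinuousFunction ℝ ℝ) :
    Tendsto (fun n => ∫ ω, ψ ((√(∫ ω', hermiteSum (X n) 𝒦 (c n) ω' ^ 2 ∂P n))⁻¹ *
      hermiteSum (X n) 𝒦 (c n) ω) ∂P n) atTop (𝓝 (∫ x, ψ x ∂gaussianReal 0 1)) := by
  have hprob : ∀ n, IsProbabilityMeasure (P n) := fun n => (hX n).isProbabilityMeasure
  have hpos : ∀ k ∈ 𝒦, ∃ u, 0 < k u := by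
    intro k hk1
    by_contra! h0
    have h1 : ∑ w, k w = 0 := sum_eq_zero fun w _ => Nat.le_zero.1 (h0 w)
    have := (hk k hk1).1
    omega
  choose! u hu using hpos
  refine tendsto_integral_comp_normalized (fun n => (hX n).measurable_hermiteSum 𝒦 (c n)) ?_
    (fun n s => (hX n).norm_charFun_hermiteSum_sub_le (c n) hu s) hvar ψ
  set Q : ℝ := ∑ _k ∈ 𝒦, ∑ k' ∈ 𝒦, ∑ v, (k' v : ℝ) with hQ
  have hQ0 : 0 ≤ Q := by positivity
  set D : ℝ := A ^ 4 * (8 * ν * t + 1) ^ (4 * t) with hD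
  have hD0 : 0 ≤ D := by positivity
  have hsmall : ∀ η : ℝ, 0 < η → ∀ᶠ ε : ℝ in 𝓝[>] 0, Q * √(D * ε) < η := by
    intro η hη
    have : Tendsto (fun ε : ℝ => Q * √(D * ε)) (𝓝 0) (𝓝 (Q * √(D * 0))) :=
      Continuous.tendsto (by fun_prop) 0
    rw [mul_zero, Real.sqrt_zero, mul_zero] at this
    exact (this.eventually_lt_const hη).filter_mono nhdsWithin_le_nhds
  have hlin : ∀ B ε : ℝ, 0 < ε → ∀ᶠ x : ℝ in 𝓝[>] 0, B * x < ε := by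
    intro B ε hε
    have : Tendsto (fun x : ℝ => B * x) (𝓝 0) (𝓝 (B * 0)) := Continuous.tendsto (by fun_prop) 0
    rw [mul_zero] at this
    exact (this.eventually_lt_const hε).filter_mono nhdsWithin_le_nhds
  refine tendsto_order.2 ⟨fun b hb => Eventually.of_forall fun n =>
    hb.trans_le (integral_nonneg fun ω => abs_nonneg _), fun η hη => ?_⟩
  obtain ⟨ε, hε, hε0⟩ := ((hsmall η hη).and self_mem_nhdsWithin).exists
  have hε3 : 0 < ε / 3 := div_pos hε0 three_pos
  obtain ⟨lam, ⟨hlam, hlam1⟩, hlam0⟩ := (((hlin (6 * C ^ 2) _ hε3).and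
    ((eventually_le_nhds (zero_lt_one' ℝ)).filter_mono nhdsWithin_le_nhds)).and
      self_mem_nhdsWithin).exists
  obtain ⟨δ, hδ, hδ0⟩ :=
    ((hlin (8 * lam⁻¹ ^ t * C) _ hε3).and self_mem_nhdsWithin).exists
  obtain ⟨κ, near, hdec, hκ, hnear⟩ := hsr δ hδ0
  have hn := (tendsto_const_div_atTop_nhds_zero_nat
    (2 * C ^ 3 * lam⁻¹ ^ m + 2 * κ ^ 3)).eventually_lt_const hε3
  filter_upwards [hn, eventually_ge_atTop 1] with n hn hn1
  have : Nonempty (J n) := Fintype.card_pos_iff.1 (by rw [hJ]; exact hn1)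
  have key := (hX n).integral_abs_steinKernel_sub_le (hρ n) (hnear n hn1) hC
    (le_of_lt hδ0) hκ hlam0 hlam1 hA (c := c n) (by rw [hJ]; exact hc n) hu hk
  rw [hJ] at key
  refine (key.trans ?_).trans_lt hε
  gcongr
  linarith

namespace IsStdGaussianFamily

variable {Ω J : Type*} [MeasurableSpace Ω] {P : Measure Ω} {ν : ℕ} {X : J → Fin ν → Ω → ℝ}

lemma abs_cov_le_one (hX : IsStdGaussianFamily P X) (a b : J) (u v : Fin ν) :
    |∫ ω, X a u ω * X b v ω ∂P| ≤ 1 := by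
  have m1 := (hX.hasAllMoments a u).mul (hX.hasAllMoments a u)
  have m2 := (hX.hasAllMoments b v).mul (hX.hasAllMoments b v)
  have e1 : ∫ ω, X a u ω * X a u ω ∂P = 1 := by simp [hX.std]
  have e2 : ∫ ω, X b v ω * X b v ω ∂P = 1 := by simp [hX.std]
  calc |∫ ω, X a u ω * X b v ω ∂P| ≤ ∫ ω, |X a u ω * X b v ω| ∂P := abs_integral_le_integral_abs
    _ ≤ ∫ ω, 1 / 2 * (X a u ω * X a u ω + X b v ω * X b v ω) ∂P := by
      refine integral_mono ((hX.hasAllMoments a u).mul (hX.hasAllMoments b v)).integrable.abs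
        ((m1.add m2).const_mul _).integrable fun ω => ?_
      refine abs_le.2 ⟨?_, ?_⟩
      · nlinarith [sq_nonneg (X a u ω + X b v ω)]
      · nlinarith [sq_nonneg (X a u ω - X b v ω)]
    _ = 1 := by
      rw [integral_const_mul, integral_add m1.integrable m2.integrable, e1, e2]
      norm_num

end IsStdGaussianFamily

/-- The largest absolute cross-covariance between the slots of two Gaussian vectors. -/
def maxCov {Ω J : Type*} [MeasurableSpace Ω] (P : Measure Ω) {ν : ℕ} [Nonempty (Fin ν)]
    (X : J → Fin ν → Ω → ℝ) (a b : J) : ℝ :=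
  univ.sup' univ_nonempty fun p : Fin ν × Fin ν => |∫ ω, X a p.1 ω * X b p.2 ω ∂P|

section maxCov

variable {Ω J : Type*} [MeasurableSpace Ω] {P : Measure Ω} {ν : ℕ} [Nonempty (Fin ν)]
  {X : J → Fin ν → Ω → ℝ}

lemma abs_cov_le_maxCov (a b : J) (u v : Fin ν) :
    |∫ ω, X a u ω * X b v ω ∂P| ≤ maxCov P X a b :=
  le_sup' (fun p : Fin ν × Fin ν => |∫ ω, X a p.1 ω * X b p.2 ω ∂P|) (mem_univ (u, v))

lemma maxCov_nonneg (a b : J) : 0 ≤ maxCov P X a b :=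
  (abs_nonneg _).trans (abs_cov_le_maxCov a b (Classical.arbitrary _) (Classical.arbitrary _))

lemma maxCov_comm (a b : J) : maxCov P X a b = maxCov P X b a := by
  have : ∀ a b : J, maxCov P X a b ≤ maxCov P X b a := fun a b =>
    sup'_le _ _ fun p _ => by
      simp_rw [mul_comm (X a p.1 _)]
      exact abs_cov_le_maxCov b a p.2 p.1
  exact le_antisymm (this a b) (this b a)

lemma maxCov_pow_le (a b : J) (m : ℕ) :
    maxCov P X a b ^ m ≤ ∑ p : Fin ν × Fin ν, |∫ ω, X a p.1 ω * X b p.2 ω ∂P| ^ m := by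
  obtain ⟨p, hp, h⟩ := exists_mem_eq_sup' (univ_nonempty (α := Fin ν × Fin ν))
    fun p : Fin ν × Fin ν => |∫ ω, X a p.1 ω * X b p.2 ω ∂P|
  rw [maxCov, h]
  exact single_le_sum (f := fun p : Fin ν × Fin ν => |∫ ω, X a p.1 ω * X b p.2 ω ∂P| ^ m)
    (fun p _ => by positivity) hp

/-- Row sums and off-diagonal sums of the cross-covariances control those of `maxCov`. -/
lemma IsStdGaussianFamily.isShortRange_maxCov [Fintype J] (hX : IsStdGaussianFamily P X)
    {near : J → J → Prop} [DecidableRel near] {m : ℕ} {C δ κ : ℝ}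
    (hrow : ∀ u v a, ∑ b, |∫ ω, X a u ω * X b v ω ∂P| ^ m ≤ C)
    (hfar : ∀ u v, ∑ a, ∑ b, (if near a b then 0 else |∫ ω, X a u ω * X b v ω ∂P| ^ m) ≤
      δ * Fintype.card J)
    (hnear : ∀ a, ∑ b, (if near a b then 1 else 0) ≤ κ) :
    IsShortRange (maxCov P X) near m ((ν * ν : ℕ) * C) ((ν * ν : ℕ) * δ) κ where
  symm := maxCov_comm
  mem_Icc a b := ⟨maxCov_nonneg a b, sup'_le _ _ fun p _ => hX.abs_cov_le_one a b p.1 p.2⟩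
  row a := by
    refine (sum_le_sum fun b _ => maxCov_pow_le a b m).trans ?_
    rw [sum_comm]
    refine (sum_le_card_nsmul _ _ C fun p _ => hrow p.1 p.2 a).trans_eq ?_
    simp
  far := by
    calc ∑ a, ∑ b, (if near a b then 0 else maxCov P X a b ^ m)
        ≤ ∑ a, ∑ b, ∑ p : Fin ν × Fin ν,
          (if near a b then 0 else |∫ ω, X a p.1 ω * X b p.2 ω ∂P| ^ m) := by
          refine sum_le_sum fun a _ => sum_le_sum fun b _ => ?_
          split_ifs
          · simp
          · exact maxCov_pow_le a b m
      _ = ∑ p : Fin ν × Fin ν, ∑ a, ∑ b,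
          (if near a b then 0 else |∫ ω, X a p.1 ω * X b p.2 ω ∂P| ^ m) := by
          simp_rw [sum_comm (s := (univ : Finset J)) (t := (univ : Finset (Fin ν × Fin ν)))]
      _ ≤ _ := by
          refine (sum_le_card_nsmul _ _ _ fun p _ => hfar p.1 p.2).trans_eq ?_
          simp
          ring
  near_card := hnear

end maxCov

lemma sum_ite_abs_sub_le (s : Finset ℤ) (a : ℤ) (K : ℕ) :
    ∑ b : s, (if |a - (b : ℤ)| ≤ K then 1 else 0 : ℝ) ≤ 2 * K + 1 := by
  rw [sum_coe_sort s fun b => (if |a - b| ≤ K then 1 else 0 : ℝ), sum_boole]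
  have hsub : s.filter (fun b => |a - b| ≤ K) ⊆ Icc (a - K) (a + K) := by
    intro b hb
    have := abs_le.1 (mem_filter.1 hb).2
    rw [mem_Icc]
    omega
  have h := card_le_card hsub
  rw [Int.card_Icc] at h
  have h2 : #(s.filter fun b => |a - b| ≤ K) ≤ 2 * K + 1 := by omega
  exact_mod_cast h2

/-- the CLT (3.22) in the proof of Theorem 1 (ii) of
Bardet–Surgailis, for blockwise fixed finite Hermite combinations. -/
theorem clt_blockwise_hermite_combinations
    (ν m : ℕ) (hν : 1 ≤ ν) (hm : 1 ≤ m)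
    (Ω : ℕ → Type) (ms : ∀ n, MeasurableSpace (Ω n)) (P : ∀ n, Measure (Ω n))
    (hP : ∀ n, IsProbabilityMeasure (P n))
    (X : (n : ℕ) → ℤ → Fin ν → Ω n → ℝ)
    (hmeas : ∀ n k u, Measurable (X n k u))
    (hG : ∀ n : ℕ, IsJointGaussian (P n)
      (fun ku : (Finset.Icc (1 : ℤ) (n : ℤ)) × Fin ν => X n (ku.1 : ℤ) ku.2))
    (hcent : ∀ (n : ℕ), ∀ k ∈ Finset.Icc (1 : ℤ) (n : ℤ), ∀ u,
      ∫ ω, X n k u ω ∂(P n) = 0)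
    (hstd : ∀ (n : ℕ), ∀ k ∈ Finset.Icc (1 : ℤ) (n : ℤ), ∀ u v,
      ∫ ω, X n k u ω * X n k v ω ∂(P n) = if u = v then 1 else 0)
    -- condition (3.1)
    (hcov : ∃ M' : ℝ, ∀ (u v : Fin ν) (n : ℕ), ∀ k ∈ Finset.Icc (1 : ℤ) (n : ℤ),
      ∑ j ∈ Finset.Icc (1 : ℤ) (n : ℤ),
        |∫ ω, X n j u ω * X n k v ω ∂(P n)| ^ m ≤ M')
    -- condition (3.2)
    (hcov2 : ∀ δ : ℝ, 0 < δ → ∃ K : ℕ, ∀ (u v : Fin ν) (n : ℕ), 1 ≤ n →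
      (n : ℝ)⁻¹ * ∑ jk ∈ (Finset.Icc (1 : ℤ) (n : ℤ) ×ˢ Finset.Icc (1 : ℤ) (n : ℤ)).filter
          (fun jk => (K : ℤ) < |jk.1 - jk.2|),
        |∫ ω, X n jk.1 u ω * X n jk.2 v ω ∂(P n)| ^ m ≤ δ)
    -- a fixed partition `0 = τ_0 < τ_1 < … < τ_M < τ_{M+1} = 1`
    (M : ℕ) (τ : Fin (M + 2) → ℝ) (hτ0 : τ 0 = 0) (hτ1 : τ (Fin.last (M + 1)) = 1)
    (hτmono : StrictMono τ)
    -- fixed finite linear combinations of Hermite polynomials `H_k`, `m ≤ |k| ≤ t`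
    (t : ℕ) (c : Fin (M + 1) → (Fin ν → ℕ) → ℝ) (g : Fin (M + 1) → (Fin ν → ℝ) → ℝ)
    (hg : ∀ i x, g i x =
      ∑ kk ∈ (Fintype.piFinset fun _ : Fin ν => Finset.range (t + 1)).filter
          (fun kk => m ≤ ∑ u, kk u ∧ ∑ u, kk u ≤ t),
        c i kk * hermiteProd kk x)
    -- positivity of the asymptotic variance
    (hvar : 0 < Filter.liminf (fun n : ℕ =>
      ∫ ω, ((Real.sqrt n)⁻¹ * ∑ i : Fin (M + 1),
          ∑ k ∈ (Finset.Icc (1 : ℤ) (n : ℤ)).filter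
            (fun k : ℤ => τ i.castSucc < (k : ℝ) / (n : ℝ) ∧ (k : ℝ) / (n : ℝ) ≤ τ i.succ),
        g i (fun u => X n k u ω)) ^ 2 ∂(P n)) atTop) :
    ∀ ψ : BoundedContinuousFunction ℝ ℝ,
      Tendsto (fun n : ℕ =>
          ∫ ω, ψ (((Real.sqrt (∫ ω', ((Real.sqrt n)⁻¹ * ∑ i : Fin (M + 1),
              ∑ k ∈ (Finset.Icc (1 : ℤ) (n : ℤ)).filter
                (fun k : ℤ => τ i.castSucc < (k : ℝ) / (n : ℝ) ∧ (k : ℝ) / (n : ℝ) ≤ τ i.succ),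
            g i (fun u => X n k u ω')) ^ 2 ∂(P n)))⁻¹) *
            ((Real.sqrt n)⁻¹ * ∑ i : Fin (M + 1),
              ∑ k ∈ (Finset.Icc (1 : ℤ) (n : ℤ)).filter
                (fun k : ℤ => τ i.castSucc < (k : ℝ) / (n : ℝ) ∧ (k : ℝ) / (n : ℝ) ≤ τ i.succ),
            g i (fun u => X n k u ω))) ∂(P n)) atTop
        (𝓝 (∫ x, ψ x ∂(gaussianReal 0 1))) := by
  have : Nonempty (Fin ν) := ⟨⟨0, hν⟩⟩
  classical
  set J : ℕ → Type := fun n => Finset.Icc (1 : ℤ) (n : ℤ) with hJdef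
  let Y : ∀ n, J n → Fin ν → Ω n → ℝ := fun n j => X n j
  have hY : ∀ n, IsStdGaussianFamily (P n) (Y n) := fun n =>
    ⟨fun j u => hmeas n j u, (hG n).hasGaussianLaw fun _ => hmeas _ _ _,
      fun j u => hcent n j j.2 u, fun j u v => hstd n j j.2 u v⟩
  have hJ : ∀ n, Fintype.card (J n) = n := fun n => by simp [J]
  set 𝒦 := (Fintype.piFinset fun _ : Fin ν => Finset.range (t + 1)).filter
    (fun kk => m ≤ ∑ u, kk u ∧ ∑ u, kk u ≤ t) with h𝒦
  let d : ∀ n, J n → (Fin ν → ℕ) → ℝ := fun n j kk => (√n)⁻¹ * ∑ i : Fin (M + 1),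
    if τ i.castSucc < ((j : ℤ) : ℝ) / (n : ℝ) ∧ ((j : ℤ) : ℝ) / (n : ℝ) ≤ τ i.succ
      then c i kk else 0
  have hZ : ∀ (n : ℕ) (ω : Ω n), (√n)⁻¹ * ∑ i : Fin (M + 1), ∑ k ∈ (Finset.Icc (1 : ℤ) (n : ℤ)).filter
      (fun k : ℤ => τ i.castSucc < (k : ℝ) / (n : ℝ) ∧ (k : ℝ) / (n : ℝ) ≤ τ i.succ),
      g i (fun u => X n k u ω) = hermiteSum (Y n) 𝒦 (d n) ω := by
    intro n ω
    have h1 : ∀ kk, ∑ j : J n, d n j kk * hermiteProd kk (fun v => Y n j v ω) =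
        (√n)⁻¹ * ∑ i : Fin (M + 1), ∑ k ∈ (Finset.Icc (1 : ℤ) (n : ℤ)).filter
          (fun k : ℤ => τ i.castSucc < (k : ℝ) / (n : ℝ) ∧ (k : ℝ) / (n : ℝ) ≤ τ i.succ),
          c i kk * hermiteProd kk fun v => X n k v ω := by
      intro kk
      simp only [d, Y, mul_assoc, ← mul_sum, sum_mul, ite_mul, zero_mul]
      rw [sum_comm]
      congr 1
      refine sum_congr rfl fun i _ => ?_
      rw [sum_filter, mul_sum]
      simp only [mul_ite, mul_zero]
      exact sum_coe_sort (Finset.Icc (1 : ℤ) (n : ℤ)) fun k : ℤ =>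
        if τ i.castSucc < (k : ℝ) / (n : ℝ) ∧ (k : ℝ) / (n : ℝ) ≤ τ i.succ then
          c i kk * hermiteProd kk (fun v => X n k v ω) else 0
    simp only [hermiteSum, h1, ← mul_sum, hg]
    congr 1
    rw [sum_comm]
    refine sum_congr rfl fun i _ => ?_
    simp only [mul_sum]
    exact sum_comm
  simp only [hZ] at hvar ⊢
  obtain ⟨M', hM'⟩ := hcov
  have hcomm : ∀ n (a b : J n) u v, ∫ ω, Y n a u ω * Y n b v ω ∂P n =
      ∫ ω, X n b v ω * X n a u ω ∂P n := fun n a b u v => by simp only [Y, mul_comm]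
  refine tendsto_integral_comp_normalized_hermiteSum hm hJ hY
    (ρ := fun n => maxCov (P n) (Y n)) (fun n => abs_cov_le_maxCov)
    (C := (ν * ν : ℕ) * |M'|) (by positivity) ?_ (𝒦 := 𝒦) (t := t)
    (fun k hk => (mem_filter.1 hk).2) (A := 1 + ∑ kk ∈ 𝒦, ∑ i, |c i kk|) (by positivity) ?_ hvar
  · intro δ hδ
    have hν2 : (0 : ℝ) < (ν * ν : ℕ) := by
      have : 0 < ν * ν := Nat.mul_pos hν hν
      exact_mod_cast this
    obtain ⟨K, hK⟩ := hcov2 (δ / (ν * ν : ℕ)) (by positivity)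
    refine ⟨2 * K + 1, fun n a b => |(a : ℤ) - b| ≤ K, inferInstance, by positivity,
      fun n hn => ?_⟩
    have hδ' : δ = (ν * ν : ℕ) * (δ / (ν * ν : ℕ)) := by field_simp
    rw [hδ']
    refine (hY n).isShortRange_maxCov (fun u v a => ?_) (fun u v => ?_)
      fun a => sum_ite_abs_sub_le _ _ _
    · simp only [hcomm]
      refine le_trans ?_ (le_abs_self M')
      exact (sum_coe_sort (Finset.Icc (1 : ℤ) (n : ℤ)) fun j : ℤ =>
        |∫ ω, X n j v ω * X n a u ω ∂P n| ^ m).trans_le (hM' v u n a a.2)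
    · have h1 := hK u v n hn
      have hn0 : (0 : ℝ) < n := by exact_mod_cast hn
      rw [inv_mul_le_iff₀ hn0, sum_filter, sum_product] at h1
      rw [hJ, mul_comm]
      refine Eq.trans_le ?_ h1
      rw [← sum_coe_sort (Finset.Icc (1 : ℤ) (n : ℤ))]
      refine sum_congr rfl fun a _ => ?_
      rw [← sum_coe_sort (Finset.Icc (1 : ℤ) (n : ℤ))]
      refine sum_congr rfl fun b _ => ?_
      simp only [← not_le, ite_not, Y]
  · intro n kk hkk j
    have h1 : |∑ i : Fin (M + 1), if τ i.castSucc < ((j : ℤ) : ℝ) / (n : ℝ) ∧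
        ((j : ℤ) : ℝ) / (n : ℝ) ≤ τ i.succ then c i kk else 0| ≤ ∑ i, |c i kk| := by
      refine (abs_sum_le_sum_abs _ _).trans (sum_le_sum fun i _ => ?_)
      split_ifs
      · exact le_rfl
      · simp
    have h2 : ∑ i, |c i kk| ≤ ∑ kk ∈ 𝒦, ∑ i, |c i kk| :=
      single_le_sum (f := fun kk => ∑ i, |c i kk|) (fun _ _ => by positivity) hkk
    rw [div_eq_inv_mul, abs_mul, abs_of_nonneg (by positivity : 0 ≤ (√(n : ℝ))⁻¹)]
    refine mul_le_mul_of_nonneg_left ?_ (by positivity)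
    linarith
end
end
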